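/- The space S_{12,2}(Γ₂,ε) has dimension 1 over ℂ. -/

import Mathlib

noncomputable section

open Matrix Complex Filter Topology

/-- The standard symplectic form matrix of size 4. -/
def J4 : Matrix (Fin 4) (Fin 4) ℤ := !![0,0,1,0; 0,0,0,1; -1,0,0,0; 0,-1,0,0]

/-- The Siegel modular group `Γ₂ = Sp(4,ℤ)`, as a set of 4×4 integer matrices. -/
def Sp4Z : Set (Matrix (Fin 4) (Fin 4) ℤ) := {γ | γᵀ * J4 * γ = J4}

/-- The principal congruence subgroup `Γ₂[2]` of level 2. -/
def Sp4Z2 : Set (Matrix (Fin 4) (Fin 4) ℤ) :=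
  {γ | γ ∈ Sp4Z ∧ ∀ i j, ((γ i j : ZMod 2) = if i = j then 1 else 0)}

/-- The Siegel upper half space of degree 2: symmetric 2×2 complex matrices with
positive definite imaginary part (encoded as functions `Fin 2 → Fin 2 → ℂ`). -/
def H2 : Set (Fin 2 → Fin 2 → ℂ) :=
  {τ | (Matrix.of τ).IsSymm ∧ (Matrix.of fun i j => (τ i j).im).PosDef}

/-- The four 2×2 blocks of a 4×4 integer matrix, as complex matrices. -/
def blk (γ : Matrix (Fin 4) (Fin 4) ℤ) (r s : Fin 2) : Matrix (Fin 2) (Fin 2) ℂ :=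
  Matrix.of fun i j =>
    ((γ ⟨2 * (r : ℕ) + (i : ℕ), by have h1 := r.isLt; have h2 := i.isLt; omega⟩
        ⟨2 * (s : ℕ) + (j : ℕ), by have h1 := s.isLt; have h2 := j.isLt; omega⟩ : ℤ) : ℂ)

/-- The factor `cτ + d`. -/
def den (γ : Matrix (Fin 4) (Fin 4) ℤ) (τ : Fin 2 → Fin 2 → ℂ) : Matrix (Fin 2) (Fin 2) ℂ :=
  blk γ 1 0 * Matrix.of τ + blk γ 1 1

/-- The action `γ·τ = (aτ+b)(cτ+d)⁻¹` of `Sp(4)` on the Siegel upper half space. -/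
def moeb (γ : Matrix (Fin 4) (Fin 4) ℤ) (τ : Fin 2 → Fin 2 → ℂ) : Fin 2 → Fin 2 → ℂ :=
  fun i j => ((blk γ 0 0 * Matrix.of τ + blk γ 0 1) * (den γ τ)⁻¹) i j

/-- Matrix coefficients of the `j`-th symmetric power of the standard representation of
`GL(2,ℂ)`, in the basis `x₁^(j-i) x₂^i`. -/
def symCoeff (j : ℕ) (m : Matrix (Fin 2) (Fin 2) ℂ) (l i : Fin (j + 1)) : ℂ :=
  (((Polynomial.C (m 0 0) + Polynomial.C (m 1 0) * Polynomial.X) ^ (j - (l : ℕ)) *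
    (Polynomial.C (m 0 1) + Polynomial.C (m 1 1) * Polynomial.X) ^ (l : ℕ)).coeff i)

/-- The `j`-th symmetric power `Sym^j(m)` acting on coordinate vectors. -/
def symAct (j : ℕ) (m : Matrix (Fin 2) (Fin 2) ℂ) (v : Fin (j + 1) → ℂ) : Fin (j + 1) → ℂ :=
  fun i => ∑ l, symCoeff j m l i * v l

lemma symAct_add (j : ℕ) (m : Matrix (Fin 2) (Fin 2) ℂ) (v w : Fin (j + 1) → ℂ) :
    symAct j m (v + w) = symAct j m v + symAct j m w := by
  funext i
  simp [symAct, mul_add, Finset.sum_add_distrib]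

lemma symAct_smul (j : ℕ) (m : Matrix (Fin 2) (Fin 2) ℂ) (a : ℂ) (v : Fin (j + 1) → ℂ) :
    symAct j m (a • v) = a • symAct j m v := by
  funext i
  simp only [symAct, Pi.smul_apply, smul_eq_mul, Finset.mul_sum]
  exact Finset.sum_congr rfl fun l _ => by ring

lemma symAct_zero (j : ℕ) (m : Matrix (Fin 2) (Fin 2) ℂ) : symAct j m 0 = 0 := by
  funext i; simp [symAct]

/-- The weight `(j,k)` automorphy action `Sym^j(m) ⊗ det(m)^k`. -/
def wt (j : ℕ) (k : ℤ) (m : Matrix (Fin 2) (Fin 2) ℂ) (v : Fin (j + 1) → ℂ) :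
    Fin (j + 1) → ℂ :=
  (m.det ^ k) • symAct j m v

lemma wt_add (j : ℕ) (k : ℤ) (m : Matrix (Fin 2) (Fin 2) ℂ) (v w : Fin (j + 1) → ℂ) :
    wt j k m (v + w) = wt j k m v + wt j k m w := by
  simp [wt, symAct_add, smul_add]

lemma wt_smul (j : ℕ) (k : ℤ) (m : Matrix (Fin 2) (Fin 2) ℂ) (a : ℂ) (v : Fin (j + 1) → ℂ) :
    wt j k m (a • v) = a • wt j k m v := by
  rw [wt, wt, symAct_smul, smul_comm]

lemma wt_zero (j : ℕ) (k : ℤ) (m : Matrix (Fin 2) (Fin 2) ℂ) : wt j k m 0 = 0 := by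
  simp [wt, symAct_zero]

/-- The slash operation `(F|γ)(τ) = Sym^j(cτ+d)⁻¹ det(cτ+d)⁻ᵏ F(γ·τ)`. -/
def slashS (j : ℕ) (k : ℤ) (γ : Matrix (Fin 4) (Fin 4) ℤ)
    (F : (Fin 2 → Fin 2 → ℂ) → (Fin (j + 1) → ℂ)) (τ : Fin 2 → Fin 2 → ℂ) :
    Fin (j + 1) → ℂ :=
  ((den γ τ).det ^ (-k)) • symAct j ((den γ τ)⁻¹) (F (moeb γ τ))

lemma slashS_add (j : ℕ) (k : ℤ) (γ : Matrix (Fin 4) (Fin 4) ℤ)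
    (F G : (Fin 2 → Fin 2 → ℂ) → (Fin (j + 1) → ℂ)) (τ : Fin 2 → Fin 2 → ℂ) :
    slashS j k γ (F + G) τ = slashS j k γ F τ + slashS j k γ G τ := by
  simp [slashS, symAct_add, smul_add]

lemma slashS_smul (j : ℕ) (k : ℤ) (γ : Matrix (Fin 4) (Fin 4) ℤ) (a : ℂ)
    (F : (Fin 2 → Fin 2 → ℂ) → (Fin (j + 1) → ℂ)) (τ : Fin 2 → Fin 2 → ℂ) :
    slashS j k γ (a • F) τ = a • slashS j k γ F τ := by
  simp only [slashS, Pi.smul_apply, symAct_smul]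
  rw [smul_comm]

lemma slashS_zero (j : ℕ) (k : ℤ) (γ : Matrix (Fin 4) (Fin 4) ℤ) (τ : Fin 2 → Fin 2 → ℂ) :
    slashS j k γ (0 : (Fin 2 → Fin 2 → ℂ) → (Fin (j + 1) → ℂ)) τ = 0 := by
  simp [slashS, symAct_zero]

/-- The diagonal point `diag(τ₁,τ₂)` of the Siegel upper half space. -/
def diagH (τ₁ τ₂ : ℂ) : Fin 2 → Fin 2 → ℂ :=
  fun i j => if i = j then (if i = 0 then τ₁ else τ₂) else 0

/-- `F` is a Siegel cusp form of degree 2 and weight `(j,k)` on `Γ`, with character `χ`: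
holomorphic on `ℍ₂`, transforming by `F(γ·τ) = χ(γ) Sym^j(cτ+d) det(cτ+d)^k F(τ)` for `γ ∈ Γ`,
with `(F|γ)(diag(τ₁,it)) → 0` as `t → ∞` for every `γ ∈ Γ₂`, and (normalization) vanishing
off `ℍ₂`. -/
def IsSiegelCuspForm (j : ℕ) (k : ℤ) (Γ : Set (Matrix (Fin 4) (Fin 4) ℤ))
    (χ : Matrix (Fin 4) (Fin 4) ℤ → ℂ)
    (F : (Fin 2 → Fin 2 → ℂ) → (Fin (j + 1) → ℂ)) : Prop :=
  DifferentiableOn ℂ F H2 ∧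
  (∀ γ ∈ Γ, ∀ τ ∈ H2, F (moeb γ τ) = χ γ • wt j k (den γ τ) (F τ)) ∧
  (∀ γ ∈ Sp4Z, ∀ τ₁ : ℂ, 0 < τ₁.im →
    Tendsto (fun t : ℝ => slashS j k γ F (diagH τ₁ (t * Complex.I))) atTop (𝓝 0)) ∧
  (∀ τ, τ ∉ H2 → F τ = 0)

/-- The space `S_{j,k}(Γ, χ)` of Siegel cusp forms of degree 2 and weight `(j,k)` on `Γ`
with character `χ`, as a complex vector space. -/
def SiegelCusp (j : ℕ) (k : ℤ) (Γ : Set (Matrix (Fin 4) (Fin 4) ℤ))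
    (χ : Matrix (Fin 4) (Fin 4) ℤ → ℂ) :
    Submodule ℂ ((Fin 2 → Fin 2 → ℂ) → (Fin (j + 1) → ℂ)) where
  carrier := {F | IsSiegelCuspForm j k Γ χ F}
  add_mem' := by
    rintro F G hF hG
    refine ⟨hF.1.add hG.1, ?_, ?_, ?_⟩
    · intro γ hγ τ hτ
      show F (moeb γ τ) + G (moeb γ τ) = χ γ • wt j k (den γ τ) (F τ + G τ)
      rw [wt_add, smul_add, hF.2.1 γ hγ τ hτ, hG.2.1 γ hγ τ hτ]
    · intro γ hγ τ₁ hτ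
      have h := (hF.2.2.1 γ hγ τ₁ hτ).add (hG.2.2.1 γ hγ τ₁ hτ)
      rw [add_zero] at h
      exact h.congr fun t => (slashS_add j k γ F G _).symm
    · intro τ hτ
      show F τ + G τ = 0
      rw [hF.2.2.2 τ hτ, hG.2.2.2 τ hτ, add_zero]
  zero_mem' := by
    refine ⟨?_, ?_, ?_, ?_⟩
    · exact differentiableOn_const 0
    · intro γ hγ τ hτ
      show (0 : Fin (j + 1) → ℂ) = χ γ • wt j k (den γ τ) 0
      rw [wt_zero, smul_zero]
    · intro γ hγ τ₁ hτ
      have : (fun t : ℝ => slashS j k γ (0 : (Fin 2 → Fin 2 → ℂ) → (Fin (j + 1) → ℂ))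
          (diagH τ₁ (t * Complex.I))) = fun _ => 0 := by
        funext t; exact slashS_zero j k γ _
      rw [this]
      exact tendsto_const_nhds
    · intro τ _; rfl
  smul_mem' := by
    rintro a F hF
    refine ⟨hF.1.const_smul a, ?_, ?_, ?_⟩
    · intro γ hγ τ hτ
      show a • F (moeb γ τ) = χ γ • wt j k (den γ τ) (a • F τ)
      rw [hF.2.1 γ hγ τ hτ, wt_smul, smul_comm]
    · intro γ hγ τ₁ hτ
      have h := (hF.2.2.1 γ hγ τ₁ hτ).const_smul a
      rw [smul_zero] at h
      exact h.congr fun t => (slashS_smul j k γ a F _).symm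
    · intro τ hτ
      show a • F τ = 0
      rw [hF.2.2.2 τ hτ, smul_zero]

/-- `ε` is (on `Γ₂`) the unique nontrivial homomorphism `Γ₂ → {±1}`. -/
def IsEps (ε : Matrix (Fin 4) (Fin 4) ℤ → ℂ) : Prop :=
  (∀ γ ∈ Sp4Z, ε γ = 1 ∨ ε γ = -1) ∧
  (∀ γ ∈ Sp4Z, ∀ δ ∈ Sp4Z, ε (γ * δ) = ε γ * ε δ) ∧
  (∃ γ ∈ Sp4Z, ε γ ≠ 1)

section
/-- `e(x) = exp(2πix)`. -/
def ee (x : ℂ) : ℂ := cexp (2 * (Real.pi : ℂ) * I * x)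

lemma ee_add (x y : ℂ) : ee (x + y) = ee x * ee y := by
  rw [ee, ee, ee, ← Complex.exp_add]; ring_nf
lemma ee_neg (x : ℂ) : ee (-x) = (ee x)⁻¹ := by
  rw [ee, ee, ← Complex.exp_neg]; ring_nf
lemma ee_zero : ee 0 = 1 := by simp [ee]
lemma ee_ne (x : ℂ) : ee x ≠ 0 := Complex.exp_ne_zero _
lemma ee_int (n : ℤ) : ee n = 1 := by
  rw [ee, Complex.exp_eq_one_iff]; exact ⟨n, by ring⟩
lemma ee_one : ee 1 = 1 := by simpa using ee_int 1
lemma ee_half : ee (1/2) = -1 := by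
  rw [ee, ← Complex.exp_pi_mul_I]; ring_nf
lemma norm_ee (x : ℂ) : ‖ee x‖ = Real.exp (-(2 * Real.pi * x.im)) := by
  rw [ee, Complex.norm_exp]; congr 1; simp
lemma ee_diff : Differentiable ℂ ee := by unfold ee; fun_prop
@[fun_prop] lemma ee_cont : Continuous ee := ee_diff.continuous
lemma ee_pow (x : ℂ) (n : ℕ) : ee x ^ n = ee (n * x) := by
  rw [ee, ee, ← Complex.exp_nat_mul]; ring_nf

/-- Fourier coefficient at height `v`. -/
def coef (g : ℂ → ℂ) (n : ℤ) (v : ℝ) : ℂ :=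
  ∫ u in (0:ℝ)..1, g (u + v * I) * ee (-(n * (u + v * I)))

/-- holomorphic and 1-periodic on `Im > c`. -/
structure PerHol (c : ℝ) (g : ℂ → ℂ) : Prop where
  d : DifferentiableOn ℂ g {τ | c < τ.im}
  p : ∀ τ : ℂ, c < τ.im → g (τ + 1) = g τ

lemma isOpen_imgt (c : ℝ) : IsOpen {τ : ℂ | c < τ.im} :=
  isOpen_lt continuous_const Complex.continuous_im

lemma PerHol.line_cont {c : ℝ} {g : ℂ → ℂ} (h : PerHol c g) {v : ℝ} (hv : c < v) :
    Continuous fun u : ℝ => g (u + v * I) := by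
  refine h.d.continuousOn.comp_continuous (by fun_prop) fun u => ?_
  simpa using hv

lemma PerHol.twist {c : ℝ} {g : ℂ → ℂ} (h : PerHol c g) (n : ℤ) :
    PerHol c fun τ => g τ * ee (-(n * τ)) := by
  refine ⟨h.d.mul (Differentiable.differentiableOn ?_), fun τ hτ => ?_⟩
  · exact ee_diff.comp (by fun_prop)
  · rw [h.p τ hτ]; congr 1
    rw [show -((n:ℂ) * (τ + 1)) = -(n * τ) + ((-n : ℤ) : ℂ) by push_cast; ring, ee_add, ee_int,
      mul_one]

lemma PerHol.int_indep {c : ℝ} {g : ℂ → ℂ} (h : PerHol c g) {v w : ℝ} (hv : c < v) (hw : c < w) :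
    ∫ u in (0:ℝ)..1, g (u + v * I) = ∫ u in (0:ℝ)..1, g (u + w * I) := by
  have := Complex.integral_boundary_rect_eq_zero_of_differentiableOn g (v * I) (1 + w * I)
    (h.d.mono fun z hz => by
      have h2 := (Complex.mem_reProdIm.1 hz).2
      simp only [mul_im, ofReal_re, I_im, mul_one, ofReal_im, I_re, mul_zero, add_zero, add_im,
        one_im, zero_add] at h2
      exact lt_of_lt_of_le (lt_min hv hw) h2.1)
  simp only [mul_re, ofReal_re, I_re, mul_zero, ofReal_im, I_im, mul_one, sub_self, add_re,
    one_re, add_zero, mul_im, add_im, one_im, zero_add, ofReal_zero, ofReal_one] at this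
  have h2 : ∫ y in v..w, g (1 + y * I) = ∫ y in v..w, g (y * I) := by
    apply intervalIntegral.integral_congr
    intro y hy
    have : c < y := lt_of_lt_of_le (lt_min hv hw) hy.1
    show g (1 + y * I) = g (y * I)
    rw [add_comm]; exact h.p _ (by simpa using this)
  rw [h2] at this
  linear_combination this

lemma PerHol.coef_indep {c : ℝ} {g : ℂ → ℂ} (h : PerHol c g) (n : ℤ) {v w : ℝ} (hv : c < v)
    (hw : c < w) : coef g n v = coef g n w := (h.twist n).int_indep hv hw

lemma coef_bound {g : ℂ → ℂ} {n : ℤ} {v C : ℝ} (hC : ∀ x : ℝ, ‖g (x + v * I)‖ ≤ C) :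
    ‖coef g n v‖ ≤ C * Real.exp (2 * Real.pi * n * v) := by
  have := intervalIntegral.norm_integral_le_of_norm_le_const (a := (0:ℝ)) (b := 1)
    (f := fun u : ℝ => g (u + v * I) * ee (-(n * (u + v * I))))
    (C := C * Real.exp (2 * Real.pi * n * v)) (fun u _ => by
      rw [norm_mul, norm_ee]
      have : -(2 * Real.pi * (-((n:ℂ) * (u + v * I))).im) = 2 * Real.pi * n * v := by
        simp; ring
      rw [this]; gcongr; exact hC u)
  simpa [coef] using this

lemma PerHol.p_int {c : ℝ} {g : ℂ → ℂ} (h : PerHol c g) (n : ℕ) :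
    ∀ τ : ℂ, c < τ.im → g (τ + n) = g τ := by
  induction n with
  | zero => simp
  | succ k ih => intro τ hτ; rw [Nat.cast_succ, ← add_assoc, h.p _ (by simpa using hτ), ih τ hτ]

lemma PerHol.p_int' {c : ℝ} {g : ℂ → ℂ} (h : PerHol c g) (n : ℤ)
    (τ : ℂ) (hτ : c < τ.im) : g (τ + n) = g τ := by
  obtain ⟨k, rfl | rfl⟩ := n.eq_nat_or_neg
  · simpa using h.p_int k τ hτ
  · have := h.p_int k (τ + ((-(k:ℤ) : ℤ) : ℂ)) (by simpa using hτ)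
    rw [← this]; congr 1; push_cast; ring

lemma PerHol.line_bdd {c : ℝ} {g : ℂ → ℂ} (h : PerHol c g) {v : ℝ} (hv : c < v) :
    ∃ C, 0 ≤ C ∧ ∀ x : ℝ, ‖g (x + v * I)‖ ≤ C := by
  obtain ⟨C, hC⟩ := (isCompact_Icc (a := (0:ℝ)) (b := 1)).exists_bound_of_continuousOn
    (h.line_cont hv).continuousOn
  refine ⟨C, (norm_nonneg _).trans (hC 0 (by simp)), fun x => ?_⟩
  have := h.p_int' (⌊x⌋) (Int.fract x + v * I) (by simpa using hv)
  have h2 : ((Int.fract x : ℝ) : ℂ) + v * I + (⌊x⌋:ℂ) = x + v * I := by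
    have := Int.fract_add_floor x
    have h3 : (x:ℂ) = (Int.fract x : ℝ) + (⌊x⌋:ℂ) := by exact_mod_cast this.symm
    rw [h3]; ring
  rw [h2] at this
  rw [this]; exact hC _ ⟨Int.fract_nonneg x, (Int.fract_lt_one x).le⟩

lemma PerHol.summ {c : ℝ} {g : ℂ → ℂ} (h : PerHol c g) {y : ℝ} (hy : c < y) :
    Summable fun n : ℤ => ‖coef g n y‖ * Real.exp (-(2 * Real.pi * n * y)) := by
  have key : ∀ y', c < y' → ∃ C, 0 ≤ C ∧ ∀ n : ℤ, ‖coef g n y‖ * Real.exp (-(2 * Real.pi * n * y))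
      ≤ C * Real.exp (2 * Real.pi * n * (y' - y)) := by
    intro y' hy'
    obtain ⟨C, hC0, hC⟩ := h.line_bdd hy'
    refine ⟨C, hC0, fun n => ?_⟩
    rw [h.coef_indep n hy hy']
    calc _ ≤ C * Real.exp (2 * Real.pi * n * y') * Real.exp (-(2 * Real.pi * n * y)) := by
          gcongr; exact coef_bound hC
      _ = _ := by rw [mul_assoc, ← Real.exp_add]; ring_nf
  apply Summable.of_nat_of_neg
  · obtain ⟨C, hC0, hC⟩ := key ((c + y) / 2) (by linarith)
    refine Summable.of_nonneg_of_le (fun n => by positivity) (fun n => hC n)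
      (Summable.mul_left _ ?_)
    have := Real.summable_exp_nat_mul_of_ge (c := 2 * Real.pi * ((c + y) / 2 - y))
      (by have := Real.pi_pos; nlinarith) (f := fun n => n) (fun i => le_rfl)
    refine this.congr fun n => ?_
    push_cast; ring_nf
  · obtain ⟨C, hC0, hC⟩ := key (y + 1) (by linarith)
    refine Summable.of_nonneg_of_le (fun n => by positivity) (fun n => hC _)
      (Summable.mul_left _ ?_)
    have := Real.summable_exp_nat_mul_of_ge (c := 2 * Real.pi * (-1))
      (by have := Real.pi_pos; nlinarith) (f := fun n => n) (fun i => le_rfl)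
    refine this.congr fun n => ?_
    push_cast; ring_nf

lemma PerHol.hasSum {c : ℝ} {g : ℂ → ℂ} (h : PerHol c g) {v : ℝ} (hv : c < v) (τ : ℂ)
    (hτ : c < τ.im) : HasSum (fun n : ℤ => coef g n v * ee (n * τ)) (g τ) := by
  set y := τ.im with hy
  have : Fact ((0:ℝ) < 1) := ⟨one_pos⟩
  let G0 : ℝ → ℂ := fun u => g (u + y * I)
  have hper : Function.Periodic G0 1 := fun u => by
    show g _ = g _
    rw [← h.p (u + y * I) (by simpa using hτ)]; congr 1; push_cast; ring
  let G : C(AddCircle (1:ℝ), ℂ) := ⟨hper.lift, continuous_coinduced_dom.2 (h.line_cont hτ)⟩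
  have hco : ∀ n : ℤ, fourierCoeff G n = coef g n v * ee (n * (y * I)) := by
    intro n
    rw [h.coef_indep n hv hτ, fourierCoeff_eq_intervalIntegral G n 0, coef,
      ← intervalIntegral.integral_mul_const]
    simp only [zero_add, div_one, one_smul]
    apply intervalIntegral.integral_congr
    intro u _
    show fourier (-n) (u : AddCircle (1:ℝ)) • g (u + y * I) = _
    simp only [fourier_coe_apply]
    rw [smul_eq_mul, mul_comm, mul_assoc (g _)]
    congr 1
    rw [← ee_add, ee]; congr 1; push_cast; ring
  have hs : Summable (fourierCoeff G) := by
    rw [← summable_norm_iff]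
    refine (h.summ hτ).congr fun n => ?_
    rw [hco, norm_mul, norm_ee, h.coef_indep n hv hτ]; congr 2; simp; ring
  have := has_pointwise_sum_fourier_series_of_summable hs (τ.re : AddCircle (1:ℝ))
  have e1 : G (τ.re : AddCircle (1:ℝ)) = g τ := by
    show g _ = g _
    rw [hy, Complex.re_add_im]
  rw [e1] at this
  convert this using 1
  funext n
  symm
  rw [hco, fourier_coe_apply, smul_eq_mul, mul_assoc]
  congr 1
  have h3 : ee (n * (y * I)) * ee (n * τ.re) = ee (n * τ) := by
    rw [← ee_add]; congr 1; conv_rhs => rw [← Complex.re_add_im τ]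
    ring
  rw [← h3]; congr 1
  rw [ee]; congr 1; push_cast; ring

lemma PerHol.eq_zero {c : ℝ} {g : ℂ → ℂ} (h : PerHol c g) {v : ℝ} (hv : c < v)
    (h0 : ∀ n, coef g n v = 0) (τ : ℂ) (hτ : c < τ.im) : g τ = 0 := by
  have := h.hasSum hv τ hτ
  simp only [h0, zero_mul] at this
  exact this.unique hasSum_zero

lemma PerHol.decay {c : ℝ} {g : ℂ → ℂ} (h : PerHol c g) {v : ℝ} (hv : c < v) (N : ℤ)
    (h0 : ∀ n < N, coef g n v = 0) {y1 C : ℝ} (hy1 : c < y1) (hC : ∀ x : ℝ, ‖g (x + y1 * I)‖ ≤ C)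
    (τ : ℂ) (hτ : y1 + 1 ≤ τ.im) :
    ‖g τ‖ ≤ 2 * C * Real.exp (-(2 * Real.pi * N * (τ.im - y1))) := by
  have hC0 : 0 ≤ C := (norm_nonneg _).trans (hC 0)
  have hs := h.hasSum hv τ (by linarith)
  have hinj : Function.Injective (fun k : ℕ => N + (k:ℤ)) := fun a b hab => by simpa using hab
  rw [← hinj.hasSum_iff (by
    intro n hn
    rw [h0 n, zero_mul]
    by_contra hlt
    exact hn ⟨(n - N).toNat, by simp; omega⟩)] at hs
  have hg : HasSum (fun k : ℕ => C * Real.exp (-(2 * Real.pi * N * (τ.im - y1))) * (1/2:ℝ) ^ k)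
      (C * Real.exp (-(2 * Real.pi * N * (τ.im - y1))) * 2) := hasSum_geometric_two.mul_left _
  rw [← hs.tsum_eq]
  refine (tsum_of_norm_bounded hg fun k => ?_).trans (by linarith)
  simp only [Function.comp]
  rw [norm_mul, norm_ee, h.coef_indep _ hv hy1]
  have hr : Real.exp (-(2 * Real.pi * (τ.im - y1))) ≤ 1/2 := by
    have h1 : Real.exp (-(2 * Real.pi * (τ.im - y1))) ≤ Real.exp (-1) := by
      apply Real.exp_le_exp.2; nlinarith [Real.pi_gt_three]
    have h2 := Real.exp_one_gt_d9
    rw [Real.exp_neg 1] at h1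
    refine h1.trans ?_
    rw [one_div]; apply inv_anti₀ <;> linarith
  calc _ ≤ C * Real.exp (2 * Real.pi * (N + (k:ℤ) : ℤ) * y1) *
        Real.exp (-(2 * Real.pi * (((N + (k:ℤ) : ℤ) : ℂ) * τ).im)) := by
        gcongr; exact coef_bound hC
    _ = C * Real.exp (-(2 * Real.pi * N * (τ.im - y1))) *
        Real.exp (-(2 * Real.pi * (τ.im - y1))) ^ k := by
        rw [← Real.exp_nat_mul, mul_assoc C, mul_assoc C, ← Real.exp_add, ← Real.exp_add]
        congr 2; simp; ring
    _ ≤ _ := by gcongr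

end

section
lemma param_diff {U : Set ℂ} (hU : IsOpen U) (h : ℂ → ℝ → ℂ)
    (hc : ContinuousOn (Function.uncurry h) (U ×ˢ Set.univ))
    (hd : ∀ u, DifferentiableOn ℂ (fun x => h x u) U) :
    DifferentiableOn ℂ (fun x => ∫ u in (0:ℝ)..1, h x u) U := by
  intro x0 hx0
  obtain ⟨r, hr, hrU⟩ := Metric.nhds_basis_closedBall.mem_iff.1 (hU.mem_nhds hx0)
  obtain ⟨C, hC⟩ := ((isCompact_closedBall x0 r).prod
    (isCompact_Icc (a := (0:ℝ)) (b := 1))).exists_bound_of_continuousOn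
    (hc.mono (Set.prod_mono hrU (Set.subset_univ _)))
  have hcu : ∀ x ∈ U, Continuous (h x) := fun x hx =>
    hc.comp_continuous (f := fun u : ℝ => (x, u)) (by fun_prop) fun u => ⟨hx, trivial⟩
  have hhalf : ∀ x ∈ Metric.ball x0 (r/2), Metric.closedBall x (r/2) ⊆ Metric.closedBall x0 r := by
    intro x hx
    apply Metric.closedBall_subset_closedBall'
    have := Metric.mem_ball.1 hx; linarith
  have hxU : ∀ x ∈ Metric.ball x0 (r/2), x ∈ U := fun x hx =>
    hrU (hhalf x hx (Metric.mem_closedBall_self (by positivity)))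
  have hb : Metric.ball x0 (r/2) ∈ 𝓝 x0 := Metric.ball_mem_nhds _ (by positivity)
  have hdx : ∀ x ∈ U, ∀ u, HasDerivAt (fun x => h x u) (deriv (fun x => h x u) x) x :=
    fun x hx u => ((hd u).differentiableAt (hU.mem_nhds hx)).hasDerivAt
  refine (intervalIntegral.hasDerivAt_integral_of_dominated_loc_of_deriv_le
    (F := h) (F' := fun x u => deriv (fun x => h x u) x) (bound := fun _ => C / (r/2))
    (μ := MeasureTheory.volume) (a := 0) (b := 1) hb ?_ ?_ ?_ ?_ ?_ ?_).2.differentiableAt.differentiableWithinAt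
  · filter_upwards [hb] with x hx using (hcu x (hxU x hx)).aestronglyMeasurable
  · exact (hcu x0 hx0).intervalIntegrable _ _
  · have hseq : Tendsto (fun n : ℕ => x0 + ((r/2) * (1 / ((n:ℝ) + 2)) : ℝ)) atTop (𝓝[≠] x0) := by
      rw [tendsto_nhdsWithin_iff]
      constructor
      · have h1 : Tendsto (fun n : ℕ => 1 / ((n:ℝ) + 2)) atTop (𝓝 0) :=
          tendsto_const_nhds.div_atTop (tendsto_atTop_add_const_right _ _ tendsto_natCast_atTop_atTop)
        have := (Complex.continuous_ofReal.tendsto _).comp (h1.const_mul (r/2))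
        simpa using this.const_add x0
      · refine Eventually.of_forall fun n => ?_
        simp only [Set.mem_compl_iff, Set.mem_singleton_iff, add_eq_left, ofReal_eq_zero]
        positivity
    refine aestronglyMeasurable_of_tendsto_ae atTop
      (f := fun n : ℕ => fun u => slope (fun x => h x u) x0 (x0 + ((r/2) * (1 / ((n:ℝ) + 2)) : ℝ))) ?_ ?_
    · intro n
      apply Continuous.aestronglyMeasurable
      simp only [slope_def_field]
      refine ((hcu _ (hxU _ ?_)).sub (hcu _ hx0)).div_const _
      rw [Metric.mem_ball, dist_eq_norm, add_sub_cancel_left, Complex.norm_real, Real.norm_of_nonneg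
        (by positivity)]
      have : (1:ℝ) / ((n:ℝ) + 2) < 1 := by rw [div_lt_one (by positivity)]; linarith [Nat.cast_nonneg (α := ℝ) n]
      nlinarith
    · exact Eventually.of_forall fun u => (hdx x0 hx0 u).tendsto_slope.comp hseq
  · refine Eventually.of_forall fun u hu x hx => ?_
    refine Complex.norm_deriv_le_of_forall_mem_sphere_norm_le (by positivity) ?_ fun z hz => ?_
    · refine ((hd u).mono ?_).diffContOnCl
      rw [closure_ball _ (by positivity)]
      exact (hhalf x hx).trans hrU
    · rw [Set.uIoc_of_le zero_le_one] at hu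
      exact hC (z, u) ⟨hhalf x hx (Metric.sphere_subset_closedBall hz), hu.1.le, hu.2⟩
  · exact intervalIntegrable_const
  · exact Eventually.of_forall fun u _ x hx => hdx x (hxU x hx) u

lemma param_cont {X : Type*} [TopologicalSpace X] {U : Set X} (h : X → ℝ → ℂ)
    (hc : ContinuousOn (Function.uncurry h) (U ×ˢ Set.univ)) :
    ContinuousOn (fun x => ∫ u in (0:ℝ)..1, h x u) U := by
  rw [continuousOn_iff_continuous_restrict]
  exact intervalIntegral.continuous_parametric_intervalIntegral_of_continuous'
    (f := fun (x : U) u => h x u)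
    (hc.comp_continuous (f := fun p : U × ℝ => ((p.1 : X), p.2)) (by fun_prop) fun p => ⟨p.1.2, trivial⟩) 0 1

lemma int_swap (h : ℝ → ℝ → ℂ) (hc : Continuous (Function.uncurry h)) :
    ∫ u in (0:ℝ)..1, ∫ v in (0:ℝ)..1, h u v = ∫ v in (0:ℝ)..1, ∫ u in (0:ℝ)..1, h u v := by
  simp only [intervalIntegral.integral_of_le zero_le_one]
  apply MeasureTheory.integral_integral_swap
  rw [MeasureTheory.Measure.prod_restrict]
  refine (hc.continuousOn.integrableOn_compact
    ((isCompact_Icc (a := (0:ℝ)) (b := 1)).prod (isCompact_Icc (a := (0:ℝ)) (b := 1)))).mono_set ?_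
  exact Set.prod_mono Set.Ioc_subset_Icc_self Set.Ioc_subset_Icc_self

end

section
lemma int_shift {Q : ℂ → Prop} {w : ℂ} (h : ∀ z, Q z ↔ Q (z + w)) (z : ℂ) (n : ℤ) :
    Q z ↔ Q (z + n * w) := by
  induction n using Int.induction_on with
  | zero => simp
  | succ k ih => rw [ih, h]; push_cast; ring_nf
  | pred k ih =>
    rw [ih, h (z + ((-(k:ℤ) - 1 : ℤ) : ℂ) * w)]
    rw [show z + ((-(k:ℤ) - 1 : ℤ) : ℂ) * w + w = z + ((-(k:ℤ) : ℤ) : ℂ) * w by push_cast; ring]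

lemma latt_ind {Q : ℂ → Prop} {a : ℂ} (h1 : ∀ z, Q z ↔ Q (z + 1)) (ha : ∀ z, Q z ↔ Q (z + a))
    (h0 : Q 0) (m n : ℤ) : Q (m + n * a) := by
  rw [← int_shift ha]
  have := (int_shift (w := 1) h1 0 m).1 h0
  simpa using this

lemma dper_bdd {a : ℂ} (ha : 0 < a.im) {N : ℂ → ℝ} (hN : Continuous N)
    (h1 : ∀ z, N (z + 1) = N z) (h2 : ∀ z, N (z + a) = N z) : ∃ C, ∀ z, N z ≤ C := by
  obtain ⟨C, hC⟩ := (IsCompact.reProdIm (isCompact_Icc (a := (0:ℝ)) (b := 1))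
    (isCompact_Icc (a := (0:ℝ)) (b := a.im))).bddAbove_image (hN.continuousOn)
  refine ⟨C, fun z => ?_⟩
  set n := ⌊z.im / a.im⌋ with hn
  set z' := z - n * a with hz'
  set m := ⌊z'.re⌋ with hm
  have e1 : N (z' - m) = N z' := by
    have := (int_shift (Q := fun x => N x = N z') (w := 1) (fun x => by rw [h1]) z' (-m)).1 rfl
    rw [← this]; congr 1; push_cast; ring
  have e2 : N z' = N z := by
    have := (int_shift (Q := fun x => N x = N z) (w := a) (fun x => by rw [h2]) z (-n)).1 rfl
    rw [← this, hz']; congr 1; push_cast; ring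
  rw [← e2, ← e1]
  apply hC
  refine Set.mem_image_of_mem _ ?_
  rw [Complex.mem_reProdIm]
  have f1 := Int.floor_le (z.im / a.im)
  have f2 := Int.lt_floor_add_one (z.im / a.im)
  rw [← hn] at f1 f2
  rw [le_div_iff₀ ha] at f1
  rw [div_lt_iff₀ ha] at f2
  have f3 := Int.floor_le z'.re
  have f4 := Int.lt_floor_add_one z'.re
  rw [← hm] at f3 f4
  have i1 : (z' - m).im = z.im - n * a.im := by simp [hz']
  have i2 : (z' - m).re = z'.re - m := by simp
  rw [i1, i2]
  constructor <;> constructor <;> linarith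

lemma ell_const {a : ℂ} (ha : 0 < a.im) {R : ℂ → ℂ} (hR : Differentiable ℂ R)
    (h1 : ∀ z, R (z + 1) = R z) (h2 : ∀ z, R (z + a) = R z) (z : ℂ) : R z = R 0 := by
  obtain ⟨C, hC⟩ := dper_bdd ha (N := fun z => ‖R z‖) (hR.continuous.norm)
    (fun z => by rw [h1]) (fun z => by rw [h2])
  apply hR.apply_eq_apply_of_bounded
  rw [isBounded_iff_forall_norm_le]
  exact ⟨C, by rintro _ ⟨w, rfl⟩; exact hC w⟩

lemma div_simple {φ P : ℂ → ℂ} (hφ : Differentiable ℂ φ) (hP : Differentiable ℂ P)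
    (hs : ∀ z, P z = 0 → deriv P z ≠ 0) (h0 : ∀ z, P z = 0 → φ z = 0) :
    ∃ H : ℂ → ℂ, Differentiable ℂ H ∧ ∀ z, φ z = H z * P z := by
  classical
  refine ⟨fun z => if P z = 0 then deriv φ z / deriv P z else φ z / P z, fun z0 => ?_, fun z => ?_⟩
  · by_cases hz : P z0 = 0
    · have d1 : Differentiable ℂ (dslope φ z0) := by
        rw [← differentiableOn_univ, Complex.differentiableOn_dslope univ_mem]
        exact hφ.differentiableOn
      have d2 : Differentiable ℂ (dslope P z0) := by
        rw [← differentiableOn_univ, Complex.differentiableOn_dslope univ_mem]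
        exact hP.differentiableOn
      have hne : dslope P z0 z0 ≠ 0 := by rw [dslope_same]; exact hs z0 hz
      have hd : DifferentiableAt ℂ (fun z => dslope φ z0 z / dslope P z0 z) z0 :=
        (d1 z0).div (d2 z0) hne
      refine hd.congr_of_eventuallyEq ?_
      filter_upwards [d2.continuous.continuousAt.eventually_ne hne] with z hz2
      rcases eq_or_ne z z0 with rfl | hzz
      · simp [hz]
      · have hzz' := sub_ne_zero.2 hzz
        rw [dslope_of_ne _ hzz, slope_def_field, hz, sub_zero] at hz2
        have hPz : P z ≠ 0 := fun h => hz2 (by rw [h, zero_div])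
        simp only [hPz, if_false]
        rw [dslope_of_ne _ hzz, dslope_of_ne _ hzz, slope_def_field, slope_def_field, hz, h0 z0 hz]
        field_simp
        simp [mul_comm]
    · have : ∀ᶠ z in 𝓝 z0, P z ≠ 0 := hP.continuous.continuousAt.eventually_ne hz
      refine ((hφ z0).div (hP z0) hz).congr_of_eventuallyEq ?_
      filter_upwards [this] with z hz2
      simp [hz2]
  · by_cases hz : P z = 0
    · simp [hz, h0 z hz]
    · simp [hz]

/-- auxiliary product -/
def Apr (q w : ℂ) : ℂ := ∏' n : ℕ, (1 + -(q ^ (n + 1) * w))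

lemma Apr_summ {q : ℂ} (hq : ‖q‖ < 1) (w : ℂ) : Summable fun n : ℕ => ‖-(q ^ (n + 1) * w)‖ := by
  simp only [norm_neg, norm_mul, norm_pow]
  exact ((summable_nat_add_iff 1).mpr
    (summable_geometric_of_lt_one (norm_nonneg _) hq)).mul_right _

lemma Apr_step {q : ℂ} (hq : ‖q‖ < 1) (w : ℂ) : Apr q w = (1 - q * w) * Apr q (q * w) := by
  rw [Apr, tprod_eq_zero_mul' (f := fun n : ℕ => 1 + -(q ^ (n + 1) * w)), Apr]
  · congr 1
    · ring
    · congr 1; ext n; ring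
  · have := multipliable_one_add_of_summable (Apr_summ hq (q * w))
    refine this.congr fun n => ?_
    ring

lemma Apr_diff {q : ℂ} (hq : ‖q‖ < 1) : Differentiable ℂ (Apr q) := by
  intro w0
  have hU : IsOpen (Metric.ball (0:ℂ) (‖w0‖ + 1)) := Metric.isOpen_ball
  have := (((summable_nat_add_iff 1).mpr
    (summable_geometric_of_lt_one (norm_nonneg q) hq)).mul_right
    (‖w0‖ + 1)).hasProdLocallyUniformlyOn_nat_one_add (f := fun n w => -(q ^ (n + 1) * w)) hU
    (.of_forall fun n w hw => by
      rw [norm_neg, norm_mul, norm_pow]; gcongr; exact (mem_ball_zero_iff.1 hw).le)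
    (fun n => by fun_prop)
  have hd := this.differentiableOn (.of_forall fun s ↦ by
      have : DifferentiableOn ℂ (fun w => ∏ n ∈ s, (1 + -(q ^ (n + 1) * w)))
        (Metric.ball (0:ℂ) (‖w0‖ + 1)) := DifferentiableOn.fun_finsetProd (fun _ _ ↦ by fun_prop)
      simpa [Finset.prod_fn] using this) hU
  exact hd.differentiableAt (hU.mem_nhds (by simp))

lemma Apr_zero {q : ℂ} (hq : ‖q‖ < 1) {w : ℂ} (h : Apr q w = 0) : ∃ n : ℕ, q ^ (n + 1) * w = 1 := by
  by_contra! hne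
  refine tprod_one_add_ne_zero_of_summable (fun n => ?_) (Apr_summ hq w) h
  rw [← sub_eq_add_neg, sub_ne_zero]; exact (hne n).symm

lemma ee_eq_one {x : ℂ} (h : ee x = 1) : ∃ n : ℤ, x = n := by
  rw [ee, Complex.exp_eq_one_iff] at h
  obtain ⟨n, hn⟩ := h
  refine ⟨n, ?_⟩
  have := Complex.two_pi_I_ne_zero
  apply mul_left_cancel₀ this; rw [hn]; ring

structure IsP (a : ℂ) (P : ℂ → ℂ) : Prop where
  d : Differentiable ℂ P
  p1 : ∀ z, P (z + 1) = -P z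
  pa : ∀ z, P (z + a) = -ee (-z - a / 2) * P z
  z0 : P 0 = 0
  zer : ∀ z, P z = 0 → ∃ m n : ℤ, z = m + n * a
  sim : ∀ z, P z = 0 → deriv P z ≠ 0

lemma exists_P {a : ℂ} (ha : 0 < a.im) : ∃ P, IsP a P := by
  have hq : ‖ee a‖ < 1 := by
    rw [norm_ee, Real.exp_lt_one_iff]
    have := Real.pi_pos
    simp only [Left.neg_neg_iff]; positivity
  set q := ee a with hqd
  set B : ℂ → ℂ := fun z => Apr q (ee z) * Apr q (ee (-z)) with hB
  set P : ℂ → ℂ := fun z => (ee (z/2) - ee (-(z/2))) * B z with hPd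
  have dB : Differentiable ℂ B := ((Apr_diff hq).comp ee_diff).mul
    ((Apr_diff hq).comp (ee_diff.comp differentiable_neg))
  have ds : Differentiable ℂ fun z : ℂ => ee (z/2) - ee (-(z/2)) :=
    (ee_diff.comp (by fun_prop)).sub (ee_diff.comp (by fun_prop))
  have dP : Differentiable ℂ P := ds.mul dB
  have p1 : ∀ z, P (z + 1) = -P z := by
    intro z
    have e1 : ee ((z+1)/2) = -ee (z/2) := by rw [add_div, ee_add, ee_half]; ring
    have e2 : ee (-((z+1)/2)) = -ee (-(z/2)) := by rw [ee_neg, e1, ee_neg, inv_neg]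
    have e3 : ee (z+1) = ee z := by rw [ee_add, ee_one, mul_one]
    have e4 : ee (-(z+1)) = ee (-z) := by rw [ee_neg, e3, ee_neg]
    simp only [hPd, hB, e1, e2, e3, e4]; ring
  have pa : ∀ z, P (z + a) = -ee (-z - a / 2) * P z := by
    intro z
    have s1 := Apr_step hq (ee z)
    have s2 := Apr_step hq (ee (-(z + a)))
    rw [hqd, ← ee_add, show a + -(z + a) = -z by ring, ← hqd] at s2
    rw [hqd, ← ee_add, add_comm a z, ← hqd] at s1
    have t1 : ee ((z+a)/2) = ee (-((z+a)/2)) * ee (z+a) := by rw [← ee_add]; congr 1; ring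
    have t2 : ee (-z - a/2) * ee (z/2) = ee (-((z+a)/2)) := by rw [← ee_add]; congr 1; ring
    have t3 : ee (-z - a/2) * ee (-(z/2)) = ee (-((z+a)/2)) * ee (-z) := by
      rw [← ee_add, ← ee_add]; congr 1; ring
    simp only [hPd, hB]
    rw [s2, s1, t1]
    linear_combination (- (1 - ee (z+a)) * Apr q (ee (z+a)) * Apr q (ee (-z))) * (t3 - t2)
  have z0 : P 0 = 0 := by simp [hPd]
  have hd0 : deriv P 0 ≠ 0 := by
    have h1 : HasDerivAt (fun z : ℂ => ee (z/2) - ee (-(z/2))) (2 * Real.pi * I) 0 := by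
      unfold ee
      have : HasDerivAt (fun z : ℂ => cexp (2 * Real.pi * I * (z/2)) - cexp (2 * Real.pi * I * (-(z/2))))
        (cexp (2 * Real.pi * I * (0/2)) * (2 * Real.pi * I * (1/2)) -
         cexp (2 * Real.pi * I * (-(0/2))) * (2 * Real.pi * I * (-(1/2)))) 0 :=
        ((((hasDerivAt_id (0:ℂ)).div_const 2).const_mul _).cexp).sub
          (((((hasDerivAt_id (0:ℂ)).div_const 2).neg).const_mul _).cexp)
      convert this using 1
      simp; ring
    have h2 := (h1.mul (dB 0).hasDerivAt).deriv
    have h3 : deriv P 0 = 2 * Real.pi * I * B 0 := by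
      rw [show P = (fun z : ℂ => ee (z/2) - ee (-(z/2))) * B from rfl, h2]; simp
    rw [h3]
    have hA : Apr q 1 ≠ 0 := fun h => by
      obtain ⟨n, hn⟩ := Apr_zero hq h
      rw [mul_one] at hn
      have := congrArg norm hn
      rw [norm_pow, norm_one] at this
      exact (pow_lt_one₀ (norm_nonneg _) hq (by omega)).ne this
    have : B 0 ≠ 0 := by simp [hB, ee_zero, hA]
    exact mul_ne_zero Complex.two_pi_I_ne_zero this
  have zer : ∀ z, P z = 0 → ∃ m n : ℤ, z = m + n * a := by
    intro z hz
    rcases mul_eq_zero.1 hz with h | h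
    · have : ee z = 1 := by
        rw [show z = z/2 + z/2 by ring, ee_add]
        nth_rw 1 [sub_eq_zero.1 h]; rw [← ee_add]; simp [ee_zero]
      obtain ⟨n, hn⟩ := ee_eq_one this
      exact ⟨n, 0, by simp [hn]⟩
    rcases mul_eq_zero.1 h with h | h
    · obtain ⟨n, hn⟩ := Apr_zero hq h
      rw [hqd, ee_pow, ← ee_add] at hn
      obtain ⟨k, hk⟩ := ee_eq_one hn
      exact ⟨k, -(n+1), by rw [← hk]; push_cast; ring⟩
    · obtain ⟨n, hn⟩ := Apr_zero hq h
      rw [hqd, ee_pow, ← ee_add] at hn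
      obtain ⟨k, hk⟩ := ee_eq_one hn
      exact ⟨-k, n+1, by push_cast; rw [← hk]; push_cast; ring⟩
  refine ⟨P, dP, p1, pa, z0, zer, fun z hz => ?_⟩
  obtain ⟨m, n, rfl⟩ := zer z hz
  refine (latt_ind (Q := fun z => P z = 0 ∧ deriv P z ≠ 0) ?_ ?_ ⟨z0, hd0⟩ m n).2
  · intro z
    have : deriv P (z + 1) = -deriv P z := by
      rw [← deriv_comp_add_const, show (fun x => P (x + 1)) = fun x => -P x from funext p1]
      simp
    rw [p1, this]; simp
  · intro z
    have : P z = 0 → deriv P (z + a) = -ee (-z - a/2) * deriv P z := by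
      intro hz
      rw [← deriv_comp_add_const, show (fun x => P (x + a)) = fun x => -ee (-x - a/2) * P x from funext pa]
      have hD : DifferentiableAt ℂ (fun x => -ee (-x - a/2)) z :=
        (ee_diff.comp (by fun_prop : Differentiable ℂ fun x : ℂ => -x - a/2)).neg z
      rw [deriv_fun_mul hD (dP z), hz]; simp
    have hne := ee_ne (-z - a/2)
    rw [pa]
    constructor
    · rintro ⟨h1, h2⟩; rw [this h1, h1]; simp [hne, h2]
    · rintro ⟨h1, h2⟩
      have h1' : P z = 0 := by simpa [hne] using h1
      rw [this h1'] at h2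
      exact ⟨h1', fun h => h2 (by rw [h, mul_zero])⟩

lemma lemZ {a : ℂ} (ha : 0 < a.im) {P : ℂ → ℂ} (hP : IsP a P) (M : ℕ) : ∀ φ : ℂ → ℂ,
    Differentiable ℂ φ → (∀ z, φ (z + 1) = (-1) ^ M * φ z) →
    (∀ z, φ (z + a) = (-1) ^ M * ee (-(M * z) - M * a / 2) * φ z) →
    (M : ℕ∞) ≤ analyticOrderAt φ 0 → ∃ c, ∀ z, φ z = c * P z ^ M := by
  induction M with
  | zero =>
    intro φ hd h1 h2 _
    refine ⟨φ 0, fun z => ?_⟩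
    rw [pow_zero, mul_one]
    exact ell_const ha hd (by simpa using h1) (by simpa [ee_zero] using h2) z
  | succ M ih =>
    intro φ hd h1 h2 ho
    have h00 : φ 0 = 0 := apply_eq_zero_of_analyticOrderAt_ne_zero (by
      intro h; rw [h] at ho; simp at ho)
    have hl : ∀ z, P z = 0 → φ z = 0 := by
      intro z hz
      obtain ⟨m, n, rfl⟩ := hP.zer z hz
      refine latt_ind (Q := fun z => φ z = 0) ?_ ?_ h00 m n
      · intro z; rw [h1]; simp
      · intro z; rw [h2]; simp [ee_ne]
    obtain ⟨H, hH, hHP⟩ := div_simple hd hP.d hP.sim hl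
    -- identities for H hold where P ≠ 0, extend by density
    have hdense : Dense {z | P z ≠ 0} := by
      have hcl : {z | P z ≠ 0} = {z | P z = 0}ᶜ := rfl
      rw [hcl]
      have hsub : {z | P z = 0} ⊆ Set.range (fun p : ℤ × ℤ => (p.1:ℂ) + p.2 * a) := by
        intro z hz
        obtain ⟨m, n, h⟩ := hP.zer z hz
        exact ⟨(m, n), h.symm⟩
      exact ((Set.countable_range _).mono hsub).dense_compl ℂ
    have ext : ∀ f g : ℂ → ℂ, Continuous f → Continuous g → (∀ z, P z ≠ 0 → f z = g z) →
        ∀ z, f z = g z := fun f g hf hg h z =>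
      congrFun (Continuous.ext_on hdense hf hg (fun z hz => h z hz)) z
    have H1 : ∀ z, H (z + 1) = (-1) ^ M * H z := by
      refine ext _ _ (hH.continuous.comp (by fun_prop)) (continuous_const.mul hH.continuous) ?_
      intro z hz
      have := h1 z
      rw [hHP, hHP, hP.p1] at this
      apply mul_right_cancel₀ hz
      rw [pow_succ] at this; linear_combination -this
    have H2 : ∀ z, H (z + a) = (-1) ^ M * ee (-(M * z) - M * a / 2) * H z := by
      refine ext _ _ (hH.continuous.comp (by fun_prop)) ((continuous_const.mul
        (ee_cont.comp (by fun_prop))).mul hH.continuous) ?_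
      intro z hz
      have := h2 z
      rw [hHP, hHP, hP.pa] at this
      have e : ee (-(((M + 1 : ℕ) : ℂ) * z) - ((M + 1 : ℕ) : ℂ) * a / 2) =
        ee (-(M * z) - M * a / 2) * ee (-z - a/2) := by
        rw [← ee_add]; congr 1; push_cast; ring
      rw [e] at this
      apply mul_right_cancel₀ hz
      apply mul_right_cancel₀ (ee_ne (-z - a/2))
      rw [pow_succ] at this; linear_combination -this
    have oP : analyticOrderAt P 0 = 1 := by
      have := (hP.d.analyticAt 0).analyticOrderAt_sub_eq_one_of_deriv_ne_zero (hP.sim 0 hP.z0)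
      simpa [hP.z0] using this
    have oH : (M : ℕ∞) ≤ analyticOrderAt H 0 := by
      have e : φ = H * P := funext hHP
      rw [e, analyticOrderAt_mul (hH.analyticAt 0) (hP.d.analyticAt 0), oP] at ho
      push_cast at ho
      exact (ENat.add_le_add_iff_right (by simp)).1 ho
    obtain ⟨c, hc⟩ := ih H hH H1 H2 oH
    exact ⟨c, fun z => by rw [hHP, hc, pow_succ]; ring⟩

end

section
lemma G_step {g : ℂ → ℂ} (hd : DifferentiableOn ℂ g {a | 0 < a.im})
    {n : ℝ} {k : ℕ} {y1 B M : ℝ} (hy1 : 0 < y1)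
    (hB : ∀ a : ℂ, y1 ≤ a.im → ‖g a‖ ≤ B * Real.exp (-(2 * Real.pi * n * a.im)))
    (hM : ∀ a : ℂ, 0 < a.im → ‖g a‖ ^ 2 * a.im ^ k ≤ M) (a : ℂ) (ha : y1 ≤ a.im) :
    ‖g a‖ ^ 2 * a.im ^ k ≤ M * Real.exp (-((a.im - y1) * (4 * Real.pi * n - k / y1))) := by
  set f : ℂ → ℂ := fun w => (g (I * w + y1 * I) * ee (-(n * (I * w + y1 * I)))) ^ 2 with hf
  have him : ∀ w : ℂ, (I * w + y1 * I).im = w.re + y1 := by intro w; simp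
  have hnorm : ∀ w : ℂ, ‖f w‖ = ‖g (I * w + y1 * I)‖ ^ 2 * Real.exp (4 * Real.pi * n * (w.re + y1)) := by
    intro w
    rw [hf, norm_pow, norm_mul, mul_pow, norm_ee, ← Real.exp_nat_mul]
    congr 2
    simp; ring
  have hbd : ∀ w : ℂ, 0 ≤ w.re → ‖f w‖ ≤ B ^ 2 := by
    intro w hw
    rw [hnorm]
    have h1 := hB (I * w + y1 * I) (by rw [him]; linarith)
    rw [him] at h1
    calc _ ≤ (B * Real.exp (-(2 * Real.pi * n * (w.re + y1)))) ^ 2 *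
          Real.exp (4 * Real.pi * n * (w.re + y1)) := by gcongr
      _ = B ^ 2 := by
        rw [mul_pow, mul_assoc, ← Real.exp_nat_mul, ← Real.exp_add]
        rw [show ((2:ℕ):ℝ) * -(2 * Real.pi * n * (w.re + y1)) + 4 * Real.pi * n * (w.re + y1) = 0 by
          push_cast; ring, Real.exp_zero, mul_one]
  have hdf : DifferentiableOn ℂ f {w | -y1 < w.re} := by
    refine DifferentiableOn.pow (DifferentiableOn.mul (hd.comp (by fun_prop) ?_) ?_) 2
    · intro w hw
      show (0:ℝ) < Complex.im _
      rw [him]; have : -y1 < w.re := hw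
      linarith
    · exact (ee_diff.comp (by fun_prop)).differentiableOn
  have hPL := PhragmenLindelof.right_half_plane_of_bounded_on_real (f := f)
    (C := M * (y1 ^ k)⁻¹ * Real.exp (4 * Real.pi * n * y1)) (z := -I * a - y1) ?_ ?_ ?_ ?_ ?_
  · rw [hnorm] at hPL
    have e1 : I * (-I * a - y1) + y1 * I = a := by linear_combination -a * I_mul_I
    have e2 : (-I * a - y1 : ℂ).re + y1 = a.im := by simp
    rw [e1, e2] at hPL
    have hM0 : 0 ≤ M := le_trans (mul_nonneg (sq_nonneg _) (by simpa using pow_nonneg hy1.le k)) (hM (y1 * I) (by simpa using hy1))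
    have hya : 0 < a.im := by linarith
    have h3 : (a.im / y1) ^ k ≤ Real.exp ((a.im - y1) * (k / y1)) := by
      have : a.im / y1 ≤ Real.exp ((a.im - y1) / y1) := by
        have := Real.add_one_le_exp ((a.im - y1) / y1)
        have e : (a.im - y1) / y1 + 1 = a.im / y1 := by field_simp; ring
        rwa [e] at this
      calc _ ≤ (Real.exp ((a.im - y1) / y1)) ^ k := by gcongr
        _ = _ := by rw [← Real.exp_nat_mul]; ring_nf
    have h4 : ‖g a‖ ^ 2 ≤ M * (y1 ^ k)⁻¹ * Real.exp (4 * Real.pi * n * y1) *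
        Real.exp (-(4 * Real.pi * n * a.im)) := by
      rw [Real.exp_neg, ← div_eq_mul_inv, le_div_iff₀ (Real.exp_pos _)]; exact hPL
    calc _ ≤ M * (y1 ^ k)⁻¹ * Real.exp (4 * Real.pi * n * y1) *
        Real.exp (-(4 * Real.pi * n * a.im)) * a.im ^ k := by gcongr
      _ = M * Real.exp (-((a.im - y1) * (4 * Real.pi * n))) * (a.im / y1) ^ k := by
        rw [show -((a.im - y1) * (4 * Real.pi * n)) = 4 * Real.pi * n * y1 + -(4 * Real.pi * n * a.im)
          by ring, Real.exp_add, div_pow]; field_simp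
      _ ≤ M * Real.exp (-((a.im - y1) * (4 * Real.pi * n))) * Real.exp ((a.im - y1) * (k / y1)) := by
        gcongr
      _ = _ := by rw [mul_assoc, ← Real.exp_add]; ring_nf
  · refine (hdf.mono ?_).diffContOnCl
    rw [Complex.closure_setOfPred_lt_re]
    intro w hw
    show -y1 < w.re
    have : 0 ≤ w.re := hw
    linarith
  · refine ⟨1, by norm_num, 0, ?_⟩
    simp only [zero_mul, Real.exp_zero]
    refine Asymptotics.IsBigO.of_bound (B ^ 2) ?_
    rw [eventually_inf_principal]
    refine Eventually.of_forall fun w hw => ?_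
    simpa using hbd w (le_of_lt hw)
  · refine ⟨B ^ 2, ?_⟩
    rw [eventually_map]
    filter_upwards [eventually_ge_atTop (0:ℝ)] with x hx
    exact hbd x (by simpa using hx)
  · intro x
    rw [hnorm]
    have := hM (I * (x * I) + y1 * I) (by rw [him]; simpa using hy1)
    rw [him] at this
    simp only [mul_re, ofReal_re, I_re, mul_zero, ofReal_im, I_im, mul_one, sub_self, zero_add] at this ⊢
    gcongr
    rw [← div_eq_mul_inv, le_div_iff₀ (by positivity)]
    exact this
  · simp; linarith

lemma g_inv {g : ℂ → ℂ}
    (h1 : ∀ a : ℂ, 0 < a.im → ‖g (a + 1)‖ = ‖g a‖) (k : ℕ)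
    (hS : ∀ a : ℂ, 0 < a.im → ‖g (-1 / a)‖ = ‖a‖ ^ k * ‖g a‖) :
  ∀ a : ℂ, 0 < a.im → ∃ b : ℂ, 0.866 ≤ b.im ∧
    ‖g b‖ ^ 2 * b.im ^ k = ‖g a‖ ^ 2 * a.im ^ k := by
  intro a ha
  let h : UpperHalfPlane → ℝ := fun z => ‖g z‖ ^ 2 * z.im ^ k
  have hTi : ∀ z : UpperHalfPlane, h (ModularGroup.T • z) = h z := by
    intro z
    simp only [h]
    rw [UpperHalfPlane.modular_T_smul]
    have e : (((1:ℝ) +ᵥ z : UpperHalfPlane) : ℂ) = z + 1 := by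
      rw [UpperHalfPlane.coe_vadd]; push_cast; ring
    rw [e, h1 _ z.im_pos, UpperHalfPlane.vadd_im]
  have hSi : ∀ z : UpperHalfPlane, h (ModularGroup.S • z) = h z := by
    intro z
    simp only [h]
    have e : ((ModularGroup.S • z : UpperHalfPlane) : ℂ) = -1 / z := by
      rw [UpperHalfPlane.modular_S_smul]
      show (-(z:ℂ))⁻¹ = _
      rw [inv_neg, neg_div, one_div]
    rw [← UpperHalfPlane.coe_im, e, hS _ z.im_pos]
    have : ((-1 / (z:ℂ)).im) = z.im / ‖(z:ℂ)‖ ^ 2 := by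
      rw [← Complex.normSq_eq_norm_sq, neg_div, one_div, neg_im, inv_im]
      simp [neg_div]
    rw [this, div_pow, mul_pow]
    have hz : ‖(z:ℂ)‖ ≠ 0 := norm_ne_zero_iff.2 z.ne_zero
    field_simp
    ring
  have hall : ∀ γ : SpecialLinearGroup (Fin 2) ℤ, ∀ z : UpperHalfPlane, h (γ • z) = h z := by
    intro γ
    have hγ : γ ∈ Subgroup.closure {ModularGroup.S, ModularGroup.T} := by
      simp [SpecialLinearGroup.SL2Z_generators]
    induction hγ using Subgroup.closure_induction with
    | mem x hx => rcases hx with rfl | rfl; exacts [hSi, hTi]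
    | one => simp
    | mul x y _ _ hx hy => intro z; rw [mul_smul, hx, hy]
    | inv x _ hx => intro z; rw [← hx (x⁻¹ • z), smul_inv_smul]
  obtain ⟨γ, hγ⟩ := ModularGroup.exists_smul_mem_fd ⟨a, ha⟩
  refine ⟨((γ • ⟨a, ha⟩ : UpperHalfPlane) : ℂ), ?_, ?_⟩
  swap
  · have := hall γ ⟨a, ha⟩
    simp only [h] at this
    exact this
  have h3 := ModularGroup.three_le_four_mul_im_sq_of_mem_fd hγ
  have h4 := (γ • (⟨a, ha⟩ : UpperHalfPlane)).im_pos
  rw [UpperHalfPlane.coe_im]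
  by_contra hlt
  push Not at hlt
  nlinarith

/-- Genus one vanishing. -/
lemma genus_one {g : ℂ → ℂ} (hd : DifferentiableOn ℂ g {a | 0 < a.im})
    (h1 : ∀ a : ℂ, 0 < a.im → ‖g (a + 1)‖ = ‖g a‖) (k : ℕ)
    (hS : ∀ a : ℂ, 0 < a.im → ‖g (-1 / a)‖ = ‖a‖ ^ k * ‖g a‖) (n C y0 : ℝ)
    (hdec : ∀ a : ℂ, y0 ≤ a.im → ‖g a‖ ≤ C * Real.exp (-(2 * Real.pi * n * a.im)))
    (hk : (k:ℝ) < 10.87 * n) (a : ℂ) (ha : 0 < a.im) : g a = 0 := by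
  have hpi := Real.pi_gt_d4
  have hn : 0 < n := by
    have : (0:ℝ) ≤ k := Nat.cast_nonneg k
    linarith
  -- bound on Im ≥ c
  have hbc : ∀ c : ℝ, 0 < c → ∃ B, 0 ≤ B ∧ ∀ a : ℂ, c ≤ a.im →
      ‖g a‖ ≤ B * Real.exp (-(2 * Real.pi * n * a.im)) := by
    intro c hc
    set N : ℂ → ℝ := fun a => ‖g a‖ * Real.exp (2 * Real.pi * n * a.im) with hN
    have hNc : ContinuousOn N {a | 0 < a.im} :=
      hd.continuousOn.norm.mul (by fun_prop)
    obtain ⟨B, hB⟩ := (IsCompact.reProdIm (isCompact_Icc (a := (0:ℝ)) (b := 1))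
      (isCompact_Icc (a := c) (b := y0))).bddAbove_image (hNc.mono (fun a ha => by
        have := (Complex.mem_reProdIm.1 ha).2.1
        exact lt_of_lt_of_le hc this))
    have hper : ∀ (m : ℕ) (a : ℂ), 0 < a.im → ‖g (a + m)‖ = ‖g a‖ := by
      intro m
      induction m with
      | zero => simp
      | succ m ih => intro a ha; rw [Nat.cast_succ, ← add_assoc, h1 _ (by simpa using ha), ih a ha]
    refine ⟨max 0 (max B C), le_max_left _ _, fun a ha => ?_⟩
    by_cases hy : y0 ≤ a.im
    · refine (hdec a hy).trans ?_
      gcongr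
      exact (le_max_right _ _).trans (le_max_right _ _)
    · push Not at hy
      have hfl : ‖g (a - (⌊a.re⌋ : ℂ))‖ = ‖g a‖ := by
        obtain ⟨m, hm | hm⟩ := (⌊a.re⌋).eq_nat_or_neg
        · rw [hm]; have := hper m (a - m) (by simp; linarith)
          push_cast; rw [← this]; simp
        · rw [hm]; have := hper m a (by linarith)
          push_cast; rw [sub_neg_eq_add, this]
      have := hB (Set.mem_image_of_mem N (x := a - (⌊a.re⌋ : ℂ)) (by
        rw [Complex.mem_reProdIm]
        have f1 := Int.floor_le a.re
        have f2 := Int.lt_floor_add_one a.re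
        constructor <;> constructor <;> simp only [sub_re, intCast_re, sub_im, intCast_im] <;> linarith))
      simp only [hN, hfl] at this
      simp only [sub_im, intCast_im, sub_zero] at this
      rw [Real.exp_neg, ← div_eq_mul_inv, le_div_iff₀ (Real.exp_pos _)]
      exact this.trans ((le_max_left _ _).trans (le_max_right _ _))
  have hinv := g_inv h1 k hS
  obtain ⟨B, hB0, hB⟩ := hbc 0.8655 (by norm_num)
  -- global bound
  obtain ⟨t, ht⟩ : ∃ t, t = 4 * Real.pi * n := ⟨_, rfl⟩
  have htp : 0 < t := by rw [ht]; positivity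
  have hM0 : ∀ a : ℂ, 0 < a.im → ‖g a‖ ^ 2 * a.im ^ k ≤ B ^ 2 * (k.factorial / t ^ k) := by
    intro a ha
    obtain ⟨b, hb, e⟩ := hinv a ha
    rw [← e]
    have hbp : 0 < b.im := by linarith
    have h5 := Real.pow_div_factorial_le_exp (x := t * b.im) (by positivity) k
    rw [div_le_iff₀ (by positivity), mul_pow] at h5
    have h6 : b.im ^ k ≤ Real.exp (t * b.im) * (k.factorial / t ^ k) := by
      rw [← mul_div_assoc, le_div_iff₀ (by positivity)]; linarith
    calc _ ≤ (B * Real.exp (-(2 * Real.pi * n * b.im))) ^ 2 * (Real.exp (t * b.im) * (k.factorial / t ^ k)) := by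
          gcongr; exact hB b (by linarith)
      _ = B ^ 2 * (k.factorial / t ^ k) * (Real.exp (-(2 * Real.pi * n * b.im)) ^ 2 * Real.exp (t * b.im)) := by ring
      _ = _ := by
        rw [← Real.exp_nat_mul, ← Real.exp_add,
          show ((2:ℕ):ℝ) * -(2 * Real.pi * n * b.im) + t * b.im = 0 by rw [ht]; push_cast; ring,
          Real.exp_zero, mul_one]
  obtain ⟨c, hc⟩ : ∃ c, c = 0.0005 * (t - k / 0.8655) := ⟨_, rfl⟩
  have hcp : 0 < c := by
    have : (k:ℝ) / 0.8655 < t := by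
      rw [div_lt_iff₀ (by norm_num)]; rw [ht]; nlinarith
    rw [hc]; linarith
  have hiter : ∀ j : ℕ, ∀ a : ℂ, 0 < a.im → ‖g a‖ ^ 2 * a.im ^ k ≤
      B ^ 2 * (k.factorial / t ^ k) * Real.exp (-c) ^ j := by
    intro j
    induction j with
    | zero => simpa using hM0
    | succ j ih =>
      intro a ha
      obtain ⟨b, hb, e⟩ := hinv a ha
      rw [← e]
      refine (G_step hd (by norm_num) hB ih b (by linarith)).trans ?_
      have e3 : Real.exp (-c) ^ (j + 1) = Real.exp (-c) ^ j * Real.exp (-c) := pow_succ _ _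
      rw [e3, ← mul_assoc]
      have h7 : (0:ℝ) ≤ t - k / 0.8655 := by rw [hc] at hcp; linarith
      refine mul_le_mul_of_nonneg_left (Real.exp_le_exp.2 (neg_le_neg ?_)) (by positivity)
      rw [hc, ← ht]
      exact mul_le_mul_of_nonneg_right (by linarith) h7
  have hlim : Tendsto (fun j : ℕ => B ^ 2 * (k.factorial / t ^ k) * Real.exp (-c) ^ j) atTop (𝓝 0) := by
    have := (tendsto_pow_atTop_nhds_zero_of_lt_one (Real.exp_pos (-c)).le
      (by rw [Real.exp_lt_one_iff]; linarith)).const_mul (B ^ 2 * (k.factorial / t ^ k))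
    simpa using this
  have hle := ge_of_tendsto' hlim (fun j => hiter j a ha)
  have hp : 0 < a.im ^ k := by positivity
  have : ‖g a‖ ^ 2 ≤ 0 := by
    by_contra h; push Not at h
    nlinarith [mul_pos h hp]
  have : ‖g a‖ = 0 := by nlinarith [norm_nonneg (g a)]
  exact norm_eq_zero.1 this

end

section
lemma PerHol.coef_shift {c : ℝ} {g : ℂ → ℂ} (h : PerHol c g) (w : ℂ) (n : ℤ) {v v' : ℝ}
    (hv : c < v + w.im) (hv' : c < v') :
    coef (fun b => g (b + w)) n v = ee (n * w) * coef g n v' := by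
  rw [h.coef_indep n hv' hv]
  set V := v + w.im with hV
  set G : ℝ → ℂ := fun u => g (u + V * I) * ee (-(n * (u + V * I))) with hG
  have hper : Function.Periodic G 1 := fun u => by
    have := (h.twist n).p (u + V * I) (by simpa using hv)
    simp only [hG]
    rw [← this]; push_cast; ring_nf
  have e1 : ∫ u in (0:ℝ)..1, G (u + w.re) = ∫ u in (0:ℝ)..1, G u := by
    rw [intervalIntegral.integral_comp_add_right]
    have := hper.intervalIntegral_add_eq w.re 0
    simpa [add_comm] using this
  have hw : (w.re : ℂ) + w.im * I = w := Complex.re_add_im w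
  show ∫ u in (0:ℝ)..1, g (u + v * I + w) * ee (-(n * (u + v * I))) = ee (n * w) * ∫ u in (0:ℝ)..1, G u
  rw [← e1, ← intervalIntegral.integral_const_mul]
  congr 1; ext u
  simp only [hG]
  have e2 : ((u + w.re : ℝ) : ℂ) + V * I = u + v * I + w := by
    rw [hV]; push_cast; linear_combination hw
  rw [e2, mul_left_comm, ← ee_add]; ring_nf

lemma coef_sum {ι : Type*} (s : Finset ι) (c : ι → ℂ) (g : ι → ℂ → ℂ) (n : ℤ) (v : ℝ)
    (hg : ∀ i ∈ s, Continuous fun u : ℝ => g i (u + v * I)) :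
    coef (fun b => ∑ i ∈ s, c i * g i b) n v = ∑ i ∈ s, c i * coef (g i) n v := by
  unfold coef
  simp only [← intervalIntegral.integral_const_mul, Finset.sum_mul]
  rw [intervalIntegral.integral_finsetSum]
  · simp only [mul_assoc]
  · intro i hi
    exact Continuous.intervalIntegrable ((continuous_const.mul (hg i hi)).mul (by fun_prop)) _ _

lemma coef_congr {g h : ℂ → ℂ} {n : ℤ} {v : ℝ} (e : ∀ b : ℂ, b.im = v → g b = h b) :
    coef g n v = coef h n v := by
  unfold coef
  congr 1; ext u
  rw [e _ (by simp)]

def Dom : Set (ℂ × ℂ × ℂ) := {p | 0 < p.1.im ∧ p.2.1.im ^ 2 < p.1.im * p.2.2.im}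

lemma Dom_open : IsOpen Dom := by
  refine IsOpen.and (isOpen_lt ?_ ?_) (isOpen_lt ?_ ?_) <;> fun_prop

structure Dat (f : ℕ → ℂ → ℂ → ℂ → ℂ) : Prop where
  H : ∀ l, DifferentiableOn ℂ (fun p : ℂ × ℂ × ℂ => f l p.1 p.2.1 p.2.2) Dom
  T1 : ∀ l a z b, (a, z, b) ∈ Dom → f l (a + 1) z b = -f l a z b
  T2 : ∀ l a z b, (a, z, b) ∈ Dom → f l a z (b + 1) = -f l a z b
  T12 : ∀ l a z b, (a, z, b) ∈ Dom → f l a (z + 1) b = -f l a z b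
  W : ∀ l a z b, (a, z, b) ∈ Dom → l ≤ 12 → f l b z a = -f (12 - l) a z b
  D : ∀ l a z b, (a, z, b) ∈ Dom → f l a (-z) b = (-1) ^ l * f l a z b
  U : ∀ i a z b, (a, z, b) ∈ Dom → f i a (z + a) (b + 2 * z + a) =
    -∑ l ∈ Finset.range 13, ((-1) ^ (l - i) * (l.choose i : ℂ)) * f l a z b
  S : ∀ i a z b, (a, z, b) ∈ Dom → f i (-1 / a) (z / a) (b - z ^ 2 / a) =
    -a ^ 2 * ∑ l ∈ Finset.range 13, (a ^ (12 - l) * z ^ (l - i) * (l.choose i : ℂ)) * f l a z b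

/-- height bound -/
def hc (a z : ℂ) : ℝ := z.im ^ 2 / a.im

lemma mem_Dom {a z b : ℂ} (ha : 0 < a.im) (hb : hc a z < b.im) : (a, z, b) ∈ Dom :=
  ⟨ha, by have : z.im ^ 2 / a.im < b.im := hb
          rw [div_lt_iff₀ ha] at this; show z.im ^ 2 < a.im * b.im; linarith⟩

lemma Dom_hc {a z b : ℂ} (h : (a, z, b) ∈ Dom) : hc a z < b.im := by
  have h1 : 0 < a.im := h.1
  have h2 : z.im ^ 2 < a.im * b.im := h.2
  show z.im ^ 2 / a.im < b.im
  rw [div_lt_iff₀ h1]; linarith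

variable {f : ℕ → ℂ → ℂ → ℂ → ℂ}

lemma Dat.per (h : Dat f) (l : ℕ) {a z : ℂ} (ha : 0 < a.im) :
    PerHol (hc a z) (fun b => f l a z b * ee (-(b / 2))) := by
  refine ⟨DifferentiableOn.mul ?_ ?_, fun b hb => ?_⟩
  · exact (h.H l).comp (f := fun b : ℂ => (a, z, b)) (by fun_prop) fun b hb => mem_Dom ha hb
  · exact (ee_diff.comp (by fun_prop)).differentiableOn
  · rw [h.T2 l a z b (mem_Dom ha hb), show -((b + 1) / 2) = -(b / 2) + -(1 / 2) by ring, ee_add,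
      ee_neg (1 / 2), ee_half]
    ring

def phi (f : ℕ → ℂ → ℂ → ℂ → ℂ) (m : ℤ) (l : ℕ) (a z : ℂ) : ℂ :=
  coef (fun b => f l a z b * ee (-(b / 2))) m (hc a z + 1)

lemma Dat.phi_eq (h : Dat f) (m : ℤ) (l : ℕ) {a z : ℂ} (ha : 0 < a.im) {v : ℝ} (hv : hc a z < v) :
    phi f m l a z = coef (fun b => f l a z b * ee (-(b / 2))) m v :=
  (h.per l ha).coef_indep m (by linarith) hv

lemma Dat.phi_T1 (h : Dat f) (m : ℤ) (l : ℕ) {a z : ℂ} (ha : 0 < a.im) :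
    phi f m l (a + 1) z = -phi f m l a z := by
  have e : hc (a + 1) z = hc a z := by simp [hc]
  rw [phi, phi, e, ← neg_one_mul, coef, coef, ← intervalIntegral.integral_const_mul]
  congr 1; ext u
  rw [h.T1 l _ _ _ (mem_Dom ha (by simp))]; ring

lemma Dat.phi_T12 (h : Dat f) (m : ℤ) (l : ℕ) {a z : ℂ} (ha : 0 < a.im) :
    phi f m l a (z + 1) = -phi f m l a z := by
  have e : hc a (z + 1) = hc a z := by simp [hc]
  rw [phi, phi, e, ← neg_one_mul, coef, coef, ← intervalIntegral.integral_const_mul]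
  congr 1; ext u
  rw [h.T12 l _ _ _ (mem_Dom ha (by simp))]; ring

lemma Dat.phi_D (h : Dat f) (m : ℤ) (l : ℕ) {a z : ℂ} (ha : 0 < a.im) :
    phi f m l a (-z) = (-1) ^ l * phi f m l a z := by
  have e : hc a (-z) = hc a z := by simp [hc]
  rw [phi, phi, e, coef, coef, ← intervalIntegral.integral_const_mul]
  congr 1; ext u
  rw [h.D l _ _ _ (mem_Dom ha (by simp))]; ring

lemma Dat.phi_U (h : Dat f) (m : ℤ) (i : ℕ) {a z : ℂ} (ha : 0 < a.im) :
    phi f m i a (z + a) * ee ((m + 1 / 2) * (2 * z + a)) =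
    -∑ l ∈ Finset.range 13, ((-1) ^ (l - i) * (l.choose i : ℂ)) * phi f m l a z := by
  have e1 := (h.per i (z := z + a) ha).coef_shift (2 * z + a) m (v := hc a z + 1)
    (v' := hc a (z + a) + 1) (by
      simp only [hc, add_im, mul_im, re_ofNat, im_ofNat, zero_mul, add_zero]
      rw [show (z.im + a.im) ^ 2 / a.im = z.im ^ 2 / a.im + 2 * z.im + a.im by field_simp; ring]
      linarith) (by linarith)
  have e2 : ee ((m + 1 / 2) * (2 * z + a)) = ee (m * (2 * z + a)) * ee ((2 * z + a) / 2) := by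
    rw [← ee_add]; ring_nf
  rw [e2, ← mul_assoc, mul_comm (phi _ _ _ _ _)]
  unfold phi
  rw [← e1]
  have e3 := coef_sum (Finset.range 13) (fun l => -ee (-((2 * z + a) / 2)) * ((-1) ^ (l - i) * (l.choose i : ℂ)))
    (fun l b => f l a z b * ee (-(b / 2))) m (hc a z + 1)
    (fun l _ => (h.per l ha).line_cont (by linarith))
  rw [coef_congr (h := fun b => ∑ l ∈ Finset.range 13,
    (-ee (-((2 * z + a) / 2)) * ((-1) ^ (l - i) * (l.choose i : ℂ))) * (f l a z b * ee (-(b / 2))))]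
  · rw [e3, Finset.sum_mul, ← Finset.sum_neg_distrib]
    refine Finset.sum_congr rfl fun l _ => ?_
    rw [ee_neg]
    have := ee_ne ((2 * z + a) / 2)
    field_simp
  · intro b hb
    have := h.U i a z b (mem_Dom ha (by rw [hb]; linarith))
    rw [← add_assoc, this, show -((b + 2 * z + a) / 2) = -((2 * z + a) / 2) + -(b / 2) by ring, ee_add,
      neg_mul, Finset.sum_mul, ← Finset.sum_neg_distrib]
    refine Finset.sum_congr rfl fun l _ => ?_
    ring

lemma im_S {a : ℂ} (ha : 0 < a.im) : 0 < (-1 / a).im := by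
  rw [neg_div, one_div, neg_im, inv_im]
  have : 0 < normSq a := normSq_pos.2 (by rintro rfl; simp at ha)
  rw [neg_div, neg_neg]; positivity

lemma hc_S {a : ℂ} (z : ℂ) (ha : 0 < a.im) : hc (-1 / a) (z / a) = hc a z + (-(z ^ 2 / a)).im := by
  have ha0 : a ≠ 0 := by rintro rfl; simp at ha
  have hn : a.re ^ 2 + a.im ^ 2 ≠ 0 := by positivity
  have hi : a.im ≠ 0 := ha.ne'
  unfold hc
  rw [neg_div a 1, one_div, neg_im, inv_im, neg_im, div_im, div_im, normSq_apply, ← pow_two, ← pow_two, pow_two z, mul_re, mul_im]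
  field_simp
  ring

lemma Dat.phi_S (h : Dat f) (m : ℤ) (i : ℕ) {a z : ℂ} (ha : 0 < a.im) :
    phi f m i (-1 / a) (z / a) * ee (-((m + 1 / 2) * (z ^ 2 / a))) =
    -a ^ 2 * ∑ l ∈ Finset.range 13, (a ^ (12 - l) * z ^ (l - i) * (l.choose i : ℂ)) * phi f m l a z := by
  have e1 := (h.per i (z := z / a) (im_S ha)).coef_shift (-(z ^ 2 / a)) m (v := hc a z + 1)
    (v' := hc (-1 / a) (z / a) + 1) (by rw [hc_S z ha]; linarith) (by linarith)
  have e2 : ee (-((m + 1 / 2) * (z ^ 2 / a))) = ee (m * (-(z ^ 2 / a))) * ee (-(z ^ 2 / a / 2)) := by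
    rw [← ee_add]; ring_nf
  rw [e2, ← mul_assoc, mul_comm (phi _ _ _ _ _)]
  unfold phi
  rw [← e1]
  have e3 := coef_sum (Finset.range 13) (fun l => ee (z ^ 2 / a / 2) * (-a ^ 2 * (a ^ (12 - l) * z ^ (l - i) * (l.choose i : ℂ))))
    (fun l b => f l a z b * ee (-(b / 2))) m (hc a z + 1)
    (fun l _ => (h.per l ha).line_cont (by linarith))
  rw [coef_congr (h := fun b => ∑ l ∈ Finset.range 13,
    (ee (z ^ 2 / a / 2) * (-a ^ 2 * (a ^ (12 - l) * z ^ (l - i) * (l.choose i : ℂ)))) * (f l a z b * ee (-(b / 2))))]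
  · rw [e3, Finset.sum_mul, Finset.mul_sum]
    refine Finset.sum_congr rfl fun l _ => ?_
    rw [ee_neg]
    have := ee_ne (z ^ 2 / a / 2)
    generalize ee (z ^ 2 / a / 2) = E at *
    field_simp
  · intro b hb
    have := h.S i a z b (mem_Dom ha (by rw [hb]; linarith))
    rw [← sub_eq_add_neg, this, show -((b - z ^ 2 / a) / 2) = (z ^ 2 / a / 2) + -(b / 2) by ring, ee_add,
      mul_assoc, Finset.sum_mul, Finset.mul_sum]
    refine Finset.sum_congr rfl fun l _ => ?_
    ring

lemma Dat.phi_cont (h : Dat f) (m : ℤ) (l : ℕ) :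
    ContinuousOn (fun p : ℂ × ℂ => phi f m l p.1 p.2) {p | 0 < p.1.im} := by
  rintro ⟨a0, z0⟩ ha0
  have ha0' : 0 < a0.im := ha0
  obtain ⟨v, hv⟩ : ∃ v, hc a0 z0 < v := exists_gt _
  let U : Set (ℂ × ℂ) := {p | 0 < p.1.im ∧ p.2.im ^ 2 < p.1.im * v}
  have hU : IsOpen U := by
    refine IsOpen.and (isOpen_lt ?_ ?_) (isOpen_lt ?_ ?_) <;> fun_prop
  have hmem : ∀ p ∈ U, hc p.1 p.2 < v := fun p hp => by
    show _ / _ < _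
    rw [div_lt_iff₀ hp.1]; linarith [hp.2]
  have h0 : (a0, z0) ∈ U := ⟨ha0', by
    have : z0.im ^ 2 / a0.im < v := hv
    rw [div_lt_iff₀ ha0'] at this; show z0.im ^ 2 < a0.im * v; linarith⟩
  have key : ContinuousOn (fun p : ℂ × ℂ => coef (fun b => f l p.1 p.2 b * ee (-(b / 2))) m v) U := by
    unfold coef
    apply param_cont (h := fun (p : ℂ × ℂ) (u : ℝ) => f l p.1 p.2 (u + v * I) * ee (-((u + v * I) / 2)) *
      ee (-(m * (u + v * I))))
    refine ContinuousOn.mul (ContinuousOn.mul ?_ (by fun_prop)) (by fun_prop)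
    exact (h.H l).continuousOn.comp (f := fun q : (ℂ × ℂ) × ℝ => (q.1.1, q.1.2, (q.2 + v * I : ℂ)))
      (by fun_prop) fun q hq => mem_Dom hq.1.1 (by simpa using hmem _ hq.1)
  refine ContinuousAt.continuousWithinAt ?_
  refine (key.continuousAt (hU.mem_nhds h0)).congr ?_
  filter_upwards [hU.mem_nhds h0] with p hp
  exact (h.phi_eq m l hp.1 (hmem p hp)).symm

lemma Dat.phi_dz (h : Dat f) (m : ℤ) (l : ℕ) {a : ℂ} (ha : 0 < a.im) :
    Differentiable ℂ (fun z => phi f m l a z) := by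
  intro z0
  obtain ⟨v, hv⟩ : ∃ v, hc a z0 < v := exists_gt _
  let U : Set ℂ := {z | hc a z < v}
  have hU : IsOpen U := isOpen_lt (by unfold hc; fun_prop) (by fun_prop)
  have key : DifferentiableOn ℂ (fun z => coef (fun b => f l a z b * ee (-(b / 2))) m v) U := by
    unfold coef
    apply param_diff hU (h := fun (z : ℂ) (u : ℝ) => f l a z (u + v * I) * ee (-((u + v * I) / 2)) *
      ee (-(m * (u + v * I))))
    · refine ContinuousOn.mul (ContinuousOn.mul ?_ (by fun_prop)) (by fun_prop)
      exact (h.H l).continuousOn.comp (f := fun q : ℂ × ℝ => (a, q.1, (q.2 + v * I : ℂ)))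
        (by fun_prop) fun q hq => mem_Dom ha (by have h9 : hc a q.1 < v := hq.1; simpa using h9)
    · intro u
      refine ((DifferentiableOn.mul_const ?_ _).mul_const _)
      exact (h.H l).comp (f := fun q : ℂ => (a, q, (u + v * I : ℂ)))
        (by fun_prop) fun q hq => mem_Dom ha (by have h9 : hc a q < v := hq; simpa using h9)
  refine (key.differentiableAt (hU.mem_nhds hv)).congr_of_eventuallyEq ?_
  filter_upwards [hU.mem_nhds hv] with p hp
  exact h.phi_eq m l ha hp

lemma Dat.phi_da (h : Dat f) (m : ℤ) (l : ℕ) (z : ℂ) :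
    DifferentiableOn ℂ (fun a => phi f m l a z) {a | 0 < a.im} := by
  intro a0 ha0
  have ha0' : 0 < a0.im := ha0
  obtain ⟨v, hv⟩ : ∃ v, hc a0 z < v := exists_gt _
  let U : Set ℂ := {a | 0 < a.im ∧ z.im ^ 2 < a.im * v}
  have hU : IsOpen U := by
    refine IsOpen.and (isOpen_lt ?_ ?_) (isOpen_lt ?_ ?_) <;> fun_prop
  have hmem : ∀ p ∈ U, hc p z < v := fun p hp => by
    show _ / _ < _
    rw [div_lt_iff₀ hp.1]; linarith [hp.2]
  have h0 : a0 ∈ U := ⟨ha0', by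
    have : z.im ^ 2 / a0.im < v := hv
    rw [div_lt_iff₀ ha0'] at this; linarith⟩
  have key : DifferentiableOn ℂ (fun a => coef (fun b => f l a z b * ee (-(b / 2))) m v) U := by
    unfold coef
    apply param_diff hU (h := fun (a : ℂ) (u : ℝ) => f l a z (u + v * I) * ee (-((u + v * I) / 2)) *
      ee (-(m * (u + v * I))))
    · refine ContinuousOn.mul (ContinuousOn.mul ?_ (by fun_prop)) (by fun_prop)
      exact (h.H l).continuousOn.comp (f := fun q : ℂ × ℝ => (q.1, z, (q.2 + v * I : ℂ)))
        (by fun_prop) fun q hq => mem_Dom hq.1.1 (by simpa using hmem _ hq.1)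
    · intro u
      refine ((DifferentiableOn.mul_const ?_ _).mul_const _)
      exact (h.H l).comp (f := fun q : ℂ => (q, z, (u + v * I : ℂ)))
        (by fun_prop) fun q hq => mem_Dom hq.1 (by simpa using hmem _ hq)
  refine ((key.differentiableAt (hU.mem_nhds h0)).congr_of_eventuallyEq ?_).differentiableWithinAt
  filter_upwards [hU.mem_nhds h0] with p hp
  exact h.phi_eq m l hp.1 (hmem p hp)

end

section
variable {f : ℕ → ℂ → ℂ → ℂ → ℂ}

lemma Dat.U_top (h : Dat f) (m : ℤ) {L : ℕ} (hL : L ≤ 12) {a : ℂ} (ha : 0 < a.im)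
    (hz : ∀ l, L < l → l ≤ 12 → ∀ z, phi f m l a z = 0) (z : ℂ) :
    phi f m L a (z + a) * ee ((m + 1 / 2) * (2 * z + a)) = -phi f m L a z := by
  rw [h.phi_U m L ha, Finset.sum_eq_single L]
  · simp
  · intro l hl hne
    rw [Finset.mem_range] at hl
    rcases lt_or_gt_of_ne hne with h1 | h1
    · rw [Nat.choose_eq_zero_of_lt h1]; simp
    · rw [hz l h1 (by omega)]; simp
  · intro h1; exact absurd (Finset.mem_range.2 (by omega)) h1

lemma Dat.U_sub (h : Dat f) (m : ℤ) {L : ℕ} (hL : L + 1 ≤ 12) {a : ℂ} (ha : 0 < a.im)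
    (hz : ∀ l, L + 1 < l → l ≤ 12 → ∀ z, phi f m l a z = 0) (z : ℂ) :
    phi f m L a (z + a) * ee ((m + 1 / 2) * (2 * z + a)) =
      -(phi f m L a z - (L + 1) * phi f m (L + 1) a z) := by
  rw [h.phi_U m L ha, ← Finset.sum_subset (s₁ := {L, L + 1})]
  · rw [Finset.sum_pair (by omega)]
    simp; ring
  · intro x hx; simp at hx ⊢; omega
  · intro l hl hne
    simp at hl hne
    rcases lt_trichotomy l L with h1 | h1 | h1
    · rw [Nat.choose_eq_zero_of_lt h1]; simp
    · omega
    · rw [hz l (by omega) (by omega)]; simp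

lemma Dat.S_top (h : Dat f) (m : ℤ) {L : ℕ} (hL : L ≤ 12) {a : ℂ} (ha : 0 < a.im) (z : ℂ)
    (hz : ∀ l, L < l → l ≤ 12 → z ^ (l - L) * phi f m l a z = 0) :
    phi f m L (-1 / a) (z / a) * ee (-((m + 1 / 2) * (z ^ 2 / a))) = -a ^ (14 - L) * phi f m L a z := by
  rw [h.phi_S m L ha, Finset.sum_eq_single L]
  · simp; rw [show 14 - L = 2 + (12 - L) by omega, pow_add]; ring
  · intro l hl hne
    rw [Finset.mem_range] at hl
    rcases lt_or_gt_of_ne hne with h1 | h1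
    · rw [Nat.choose_eq_zero_of_lt h1]; simp
    · have := hz l h1 (by omega)
      linear_combination (a ^ (12 - l) * (l.choose L : ℂ)) * this
  · intro h1; exact absurd (Finset.mem_range.2 (by omega)) h1

lemma koecher1 {a : ℂ} (ha : 0 < a.im) {φ : ℂ → ℂ} (hd : Differentiable ℂ φ) {κ : ℝ} (hκ : κ < 0)
    (h1 : ∀ z, φ (z + 1) = -φ z) (h2 : ∀ z, φ (z + a) * ee (κ * (2 * z + a)) = -φ z) (z : ℂ) :
    φ z = 0 := by
  have hpi := Real.pi_pos
  obtain ⟨C, hC⟩ := dper_bdd ha (N := fun z => ‖φ z‖ * Real.exp (-(2 * Real.pi * κ * (z.im ^ 2 / a.im))))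
    (by have := hd.continuous; fun_prop)
    (fun z => by simp [h1]) (fun z => by
      have e : ‖φ (z + a)‖ = ‖φ z‖ * Real.exp (2 * Real.pi * κ * (2 * z.im + a.im)) := by
        have := congrArg norm (h2 z)
        rw [norm_mul, norm_ee, norm_neg] at this
        rw [← this, mul_assoc, ← Real.exp_add]
        rw [show -(2 * Real.pi * ((κ:ℂ) * (2 * z + a)).im) + 2 * Real.pi * κ * (2 * z.im + a.im) = 0 by
          simp; ring, Real.exp_zero, mul_one]
      rw [e, mul_assoc, ← Real.exp_add]
      congr 2
      simp only [add_im]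
      field_simp
      ring)
  have hb : ∀ z, ‖φ z‖ ≤ C * Real.exp (2 * Real.pi * κ * (z.im ^ 2 / a.im)) := fun z => by
    have := hC z
    rwa [Real.exp_neg, ← div_eq_mul_inv, div_le_iff₀ (Real.exp_pos _)] at this
  have hC0 : 0 ≤ C := by
    have := (norm_nonneg _).trans (hb 0)
    simpa using this
  have hconst : ∀ w, φ w = φ z := fun w => by
    apply hd.apply_eq_apply_of_bounded
    rw [isBounded_iff_forall_norm_le]
    refine ⟨C, ?_⟩
    rintro _ ⟨w, rfl⟩
    refine (hb w).trans ?_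
    have : Real.exp (2 * Real.pi * κ * (w.im ^ 2 / a.im)) ≤ 1 := by
      rw [Real.exp_le_one_iff]
      have : 0 ≤ w.im ^ 2 / a.im := by positivity
      have h3 : 2 * Real.pi * κ ≤ 0 := by nlinarith
      nlinarith
    nlinarith
  have h3 := h1 z
  rw [hconst (z + 1)] at h3
  linear_combination h3 / 2

lemma Dat.koecher (h : Dat f) {m : ℤ} (hm : m < 0) {a : ℂ} (ha : 0 < a.im) :
    ∀ j : ℕ, ∀ l, 12 < l + j → l ≤ 12 → ∀ z, phi f m l a z = 0 := by
  intro j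
  induction j with
  | zero => intro l h1 h2; omega
  | succ j ih =>
    intro l h1 h2 z
    refine koecher1 ha (h.phi_dz m l ha) (κ := m + 1 / 2) ?_ (fun z => h.phi_T12 m l ha) (fun z => ?_) z
    · have : (m:ℝ) ≤ -1 := by exact_mod_cast (by omega : m ≤ -1)
      linarith
    · have := h.U_top m h2 ha (fun l' h3 h4 => ih l' (by omega) h4) z
      push_cast
      exact this

lemma Dat.koe (h : Dat f) {m : ℤ} (hm : m < 0) {a : ℂ} (ha : 0 < a.im) {l : ℕ} (hl : l ≤ 12) (z : ℂ) :
    phi f m l a z = 0 := h.koecher hm ha 13 l (by omega) hl z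

lemma Dat.phi_per (h : Dat f) (m : ℤ) (l : ℕ) (z : ℂ) :
    PerHol 0 (fun a => phi f m l a z * ee (-(a / 2))) := by
  refine ⟨(h.phi_da m l z).mul (ee_diff.comp (by fun_prop)).differentiableOn, fun b hb => ?_⟩
  rw [h.phi_T1 m l hb, show -((b + 1) / 2) = -(b / 2) + -(1 / 2) by ring, ee_add,
      ee_neg (1 / 2), ee_half]
  ring

/-- double coefficient -/
def dc (f : ℕ → ℂ → ℂ → ℂ → ℂ) (n m : ℤ) (l : ℕ) (z : ℂ) : ℂ :=
  coef (fun a => phi f m l a z * ee (-(a / 2))) n (|z.im| + 1)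

lemma hc_v (z : ℂ) (u : ℝ) : hc (u + ((|z.im| + 1 : ℝ) : ℂ) * I) z < |z.im| + 1 := by
  have e : ((u:ℂ) + ((|z.im| + 1 : ℝ) : ℂ) * I).im = |z.im| + 1 := by simp
  have := abs_nonneg z.im
  rw [hc, e, div_lt_iff₀ (by linarith), ← sq_abs]
  nlinarith

lemma Dat.dc_W (h : Dat f) (n m : ℤ) {l : ℕ} (hl : l ≤ 12) (z : ℂ) :
    dc f n m l z = -dc f m n (12 - l) z := by
  have hv := abs_nonneg z.im
  have key : ∀ (n m : ℤ) (l : ℕ), dc f n m l z = ∫ u in (0:ℝ)..1, ∫ w in (0:ℝ)..1,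
      f l (u + ((|z.im| + 1 : ℝ) : ℂ) * I) z (w + ((|z.im| + 1 : ℝ) : ℂ) * I) *
        (ee (-((m + 1 / 2) * (w + ((|z.im| + 1 : ℝ) : ℂ) * I))) *
        ee (-((n + 1 / 2) * (u + ((|z.im| + 1 : ℝ) : ℂ) * I)))) := by
    intro n m l
    rw [dc, coef]
    congr 1; ext u
    rw [h.phi_eq m l (v := |z.im| + 1) (by simp; linarith) (hc_v z u), coef,
      ← intervalIntegral.integral_mul_const, ← intervalIntegral.integral_mul_const]
    congr 1; ext w
    simp only [mul_assoc, ← ee_add]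
    ring_nf
  rw [key, key, int_swap, ← intervalIntegral.integral_neg]
  · congr 1; ext w
    rw [← intervalIntegral.integral_neg]
    congr 1; ext u
    rw [h.W l (w + ((|z.im| + 1 : ℝ) : ℂ) * I) z (u + ((|z.im| + 1 : ℝ) : ℂ) * I) ?_ hl]
    · ring
    · exact mem_Dom (by simp; linarith) (by simpa using hc_v z w)
  · refine Continuous.mul ?_ (by fun_prop)
    exact (h.H l).continuousOn.comp_continuous
      (f := fun q : ℝ × ℝ => ((q.1 + ((|z.im| + 1 : ℝ) : ℂ) * I : ℂ), z, (q.2 + ((|z.im| + 1 : ℝ) : ℂ) * I : ℂ)))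
      (by fun_prop) fun q => mem_Dom (by simp; linarith) (by simpa using hc_v z q.1)

/-- vanishing of low coefficients gives decay -/
lemma decay_half {g : ℂ → ℂ} (hg : PerHol 0 (fun a => g a * ee (-(a / 2)))) {v : ℝ} (hv : 0 < v) (N : ℤ)
    (h0 : ∀ n < N, coef (fun a => g a * ee (-(a / 2))) n v = 0) :
    ∃ C, ∀ a : ℂ, 2 ≤ a.im → ‖g a‖ ≤ C * Real.exp (-(2 * Real.pi * (N + 1 / 2) * a.im)) := by
  obtain ⟨C, hC0, hC⟩ := hg.line_bdd (v := 1) one_pos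
  refine ⟨2 * C * Real.exp (2 * Real.pi * N), fun a ha => ?_⟩
  have := hg.decay hv N h0 one_pos hC a (by linarith)
  rw [norm_mul, norm_ee] at this
  rw [show -(2 * Real.pi * (-(a / 2)).im) = Real.pi * a.im by simp; ring, ← le_div_iff₀ (Real.exp_pos _)] at this
  refine this.trans (le_of_eq ?_)
  rw [div_eq_mul_inv, ← Real.exp_neg, mul_assoc (2 * C), mul_assoc (2 * C), ← Real.exp_add, ← Real.exp_add]
  congr 2; ring

lemma Dat.diag_zero (h : Dat f) (m N : ℤ) {l : ℕ} (hl : l ≤ 12) (h0 : ∀ n < N, dc f n m l 0 = 0)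
    (hk : ((14 - l : ℕ) : ℝ) < 10.87 * (N + 1 / 2)) {a : ℂ} (ha : 0 < a.im) : phi f m l a 0 = 0 := by
  obtain ⟨C, hC⟩ := decay_half (h.phi_per m l 0) (v := |(0:ℂ).im| + 1) (by simp) N h0
  refine genus_one (h.phi_da m l 0) (fun a ha => by rw [h.phi_T1 m l ha, norm_neg]) (14 - l)
    (fun a ha => ?_) (N + 1 / 2) C 2 hC hk a ha
  have := h.S_top m hl ha 0 (fun l' h1 _ => by rw [zero_pow (by omega), zero_mul])
  simp only [zero_div, ne_eq, OfNat.ofNat_ne_zero, not_false_eq_true, zero_pow, mul_zero, neg_zero,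
    ee_zero, mul_one] at this
  rw [this, norm_mul, norm_neg, norm_pow]

lemma Dat.dc_neg (h : Dat f) {n m : ℤ} (hn : n < 0) {l : ℕ} (hl : l ≤ 12) (z : ℂ) : dc f n m l z = 0 := by
  rw [h.dc_W n m hl]
  rw [dc, coef]
  have : ∀ u : ℝ, phi f n (12 - l) (u + ((|z.im| + 1 : ℝ) : ℂ) * I) z = 0 := fun u =>
    h.koe hn (by simp; have := abs_nonneg z.im; linarith) (by omega) z
  simp only [this, zero_mul, intervalIntegral.integral_zero, neg_zero]

lemma dc_of_phi {n m : ℤ} {l : ℕ} {z : ℂ} (hz : ∀ a : ℂ, 0 < a.im → phi f m l a z = 0) :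
    dc f n m l z = 0 := by
  rw [dc, coef]
  have : ∀ u : ℝ, phi f m l (u + ((|z.im| + 1 : ℝ) : ℂ) * I) z = 0 := fun u =>
    hz _ (by simp; have := abs_nonneg z.im; linarith)
  simp only [this, zero_mul, intervalIntegral.integral_zero, neg_zero]

lemma Dat.f_zero (h : Dat f) {l : ℕ} {a z : ℂ} (ha : 0 < a.im) (hz : ∀ m, phi f m l a z = 0) (b : ℂ)
    (hb : hc a z < b.im) : f l a z b = 0 := by
  have := (h.per l ha).eq_zero (v := hc a z + 1) (by linarith) hz b hb
  exact (mul_eq_zero.1 this).resolve_right (ee_ne _)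

lemma Dat.phi_zero (h : Dat f) {l : ℕ} {a z : ℂ} (ha : 0 < a.im) (hz : ∀ b : ℂ, hc a z < b.im → f l a z b = 0)
    (m : ℤ) : phi f m l a z = 0 := by
  rw [phi, coef]
  have : ∀ u : ℝ, f l a z (u + ((hc a z + 1 : ℝ) : ℂ) * I) = 0 := fun u => hz _ (by simp)
  simp only [this, zero_mul, intervalIntegral.integral_zero, neg_zero]

lemma Dat.diag_W (h : Dat f) {l : ℕ} (hl : l ≤ 12) (hz : ∀ a : ℂ, 0 < a.im → ∀ m, phi f m l a 0 = 0)
    {a : ℂ} (ha : 0 < a.im) (m : ℤ) : phi f m (12 - l) a 0 = 0 := by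
  refine h.phi_zero ha (fun b hb => ?_) m
  have hb' : 0 < b.im := by simpa [hc] using hb
  have := h.W l a 0 b (mem_Dom ha hb) hl
  rw [h.f_zero hb' (hz b hb') a (by simpa [hc] using ha)] at this
  linear_combination this

lemma Dat.diag_c (h : Dat f) {l : ℕ} (hl : l ≤ 12) (h0 : dc f 0 0 l 0 = 0)
    {a : ℂ} (ha : 0 < a.im) (m : ℤ) : phi f m (12 - l) a 0 = 0 := by
  have hk : ∀ l : ℕ, ((14 - l : ℕ) : ℝ) < 10.87 * (((1:ℤ):ℝ) + 1 / 2) := fun l => by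
    have : ((14 - l : ℕ) : ℝ) ≤ 14 := by exact_mod_cast (by omega : 14 - l ≤ 14)
    norm_num; linarith
  have h1 : ∀ a : ℂ, 0 < a.im → phi f 0 l a 0 = 0 := fun a ha => by
    refine h.diag_zero 0 1 hl (fun n hn => ?_) (hk l) ha
    rcases (show n < 0 ∨ n = 0 by omega) with h2 | rfl
    · exact h.dc_neg h2 hl 0
    · exact h0
  refine h.diag_zero m 1 (by omega) (fun n hn => ?_) (hk _) ha
  rcases (show n < 0 ∨ n = 0 by omega) with h2 | rfl
  · exact h.dc_neg h2 (by omega) 0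
  · rw [h.dc_W 0 m (by omega), show 12 - (12 - l) = l by omega, dc_of_phi h1, neg_zero]

lemma Dat.diag (h : Dat f) (h8 : dc f 0 0 8 0 = 0) {l : ℕ} (hl : l ≤ 12)
    {a : ℂ} (ha : 0 < a.im) (m : ℤ) : phi f m l a 0 = 0 := by
  have hbig : ∀ l, 10 ≤ l → l ≤ 12 → ∀ a : ℂ, 0 < a.im → ∀ m, phi f m l a 0 = 0 := by
    intro l h1 h2 a ha m
    refine h.diag_zero m 0 h2 (fun n hn => h.dc_neg hn h2 0) ?_ ha
    have : ((14 - l : ℕ) : ℝ) ≤ 4 := by exact_mod_cast (by omega : 14 - l ≤ 4)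
    norm_num; linarith
  have h4 : ∀ a : ℂ, 0 < a.im → ∀ m, phi f m 4 a 0 = 0 := fun a ha m => h.diag_c (l := 8) (by norm_num) h8 ha m
  by_cases hodd : Odd l
  · have := h.phi_D m l (z := 0) ha
    rw [hodd.neg_one_pow, neg_zero] at this
    linear_combination this / 2
  · rcases Nat.lt_or_ge l 3 with h1 | h1
    · have := h.diag_W (l := 12 - l) (by omega) (hbig _ (by omega) (by omega)) ha m
      rwa [show 12 - (12 - l) = l by omega] at this
    · rcases Nat.lt_or_ge l 10 with h2 | h2
      · interval_cases l
        · exact absurd (by decide) hodd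
        · exact h4 a ha m
        · exact absurd (by decide) hodd
        · refine h.diag_c (l := 6) (by norm_num) ?_ ha m
          have := h.dc_W 0 0 (l := 6) (by norm_num) 0
          norm_num at this
          linear_combination this / 2
        · exact absurd (by decide) hodd
        · exact h.diag_W (l := 4) (by norm_num) h4 ha m
        · exact absurd (by decide) hodd
      · exact hbig l h2 hl a ha m

end

section
variable {f : ℕ → ℂ → ℂ → ℂ → ℂ}

lemma mul_zero_ent {D P : ℂ → ℂ} (hD : Differentiable ℂ D) (hP : Differentiable ℂ P)
    (h : ∀ z, D z * P z = 0) {w : ℂ} (hw : deriv P w ≠ 0) (z : ℂ) : D z = 0 := by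
  have hD' : AnalyticOnNhd ℂ D Set.univ := fun z _ => hD.analyticAt z
  have hP' : AnalyticOnNhd ℂ P Set.univ := fun z _ => hP.analyticAt z
  rcases AnalyticOnNhd.eq_zero_or_eq_zero_of_mul_eq_zero hD' hP' (fun z _ => h z)
    isPreconnected_univ with h1 | h1
  · exact h1 z trivial
  · exfalso; apply hw
    have : P = fun _ => 0 := funext fun z => h1 z trivial
    rw [this]; simp

lemma lim_eq0 {A B : ℂ → ℂ} (hA : Continuous A) (hB : Continuous B) (h : ∀ z, z ≠ 0 → A z = B z) :
    A 0 = B 0 :=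
  congrFun (Continuous.ext_on (dense_compl_singleton (0:ℂ)) hA hB fun z hz => h z hz) 0

lemma dslope_diff {φ : ℂ → ℂ} (h : Differentiable ℂ φ) (z0 : ℂ) : Differentiable ℂ (dslope φ z0) := by
  rw [← differentiableOn_univ, Complex.differentiableOn_dslope univ_mem]
  exact h.differentiableOn

lemma dslope_mul {φ : ℂ → ℂ} (h0 : φ 0 = 0) (z : ℂ) : φ z = z * dslope φ 0 z := by
  have := sub_smul_dslope φ 0 z
  simp only [sub_zero, h0, smul_eq_mul] at this
  exact this.symm

lemma mean_val {ψ : ℂ → ℂ} (h : Differentiable ℂ ψ) : ∫ u in (0:ℝ)..1, ψ (ee u) = ψ 0 := by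
  have h1 := DiffContOnCl.circleAverage (f := ψ) (R := 1) (c := 0) h.diffContOnCl
  rw [← h1, Real.circleAverage_def]
  have := intervalIntegral.integral_comp_mul_left (a := 0) (b := 1)
    (fun θ => ψ (circleMap 0 1 θ)) (c := 2 * Real.pi) (by positivity)
  simp only [mul_zero, mul_one] at this
  rw [← this]
  congr 1; ext u
  simp only [circleMap, ee]
  push_cast
  rw [zero_add, one_mul]; ring_nf

lemma case0 {a : ℂ} (ha : 0 < a.im) {φ : ℂ → ℂ} (hd : Differentiable ℂ φ) (L : ℕ)
    (h1 : ∀ z, φ (z + 1) = -φ z) (h2 : ∀ z, φ (z + a) * ee (1 / 2 * (2 * z + a)) = -φ z)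
    (hD : ∀ z, φ (-z) = (-1) ^ L * φ z) (h0 : φ 0 = 0) {χ : ℂ → ℂ} (hχ : Differentiable ℂ χ)
    (hχ0 : χ 0 = 0) (hχ1 : ∀ z, χ (z + 1) = -χ z)
    (hχ2 : 0 < L → ∀ z, χ (z + a) * ee (1 / 2 * (2 * z + a)) = -(χ z - L * φ z)) (z : ℂ) : φ z = 0 := by
  obtain ⟨P, hP⟩ := exists_P ha
  have hP0 : deriv P 0 ≠ 0 := hP.sim 0 hP.z0
  have hee : ∀ z, ee (-z - a / 2) * ee (1 / 2 * (2 * z + a)) = 1 := fun z => by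
    rw [← ee_add, show -z - a / 2 + 1 / 2 * (2 * z + a) = 0 by ring, ee_zero]
  obtain ⟨c, hc⟩ := lemZ ha hP 1 φ hd (by simpa using h1) (fun z => by
      have := h2 z
      simp only [pow_one, Nat.cast_one, one_mul]
      linear_combination (-φ (z + a)) * hee z + ee (-z - a / 2) * this)
    (by
      rw [natCast_le_analyticOrderAt (hd.analyticAt 0)]
      exact ⟨dslope φ 0, (dslope_diff hd 0).analyticAt 0, Eventually.of_forall fun z => by
        simpa using dslope_mul h0 z⟩)
  simp only [pow_one] at hc
  suffices hc0 : c = 0 by rw [hc, hc0, zero_mul]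
  rcases Nat.even_or_odd L with hL | hL
  · have h3 : (fun z => φ (-z)) = φ := funext fun z => by rw [hD, hL.neg_one_pow, one_mul]
    have h4 := deriv_comp_neg φ 0
    rw [h3, neg_zero] at h4
    have h5 : deriv φ 0 = c * deriv P 0 := by
      rw [show φ = fun z => c * P z from funext hc, deriv_const_mul _ (hP.d 0)]
    have h6 : deriv φ 0 = 0 := by linear_combination h4 / 2
    rw [h6] at h5
    exact (mul_eq_zero.1 h5.symm).resolve_right hP0
  · have hLp : 0 < L := hL.pos
    have hlat : ∀ m n : ℤ, (χ (m + n * a) = 0 ∧ P (m + n * a) = 0) := by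
      refine latt_ind (Q := fun z => χ z = 0 ∧ P z = 0) (fun z => ?_) (fun z => ?_) ⟨hχ0, hP.z0⟩
      · rw [hχ1, hP.p1, neg_eq_zero, neg_eq_zero]
      · have e1 : P (z + a) = 0 ↔ P z = 0 := by
          rw [hP.pa]; simp [ee_ne]
        rw [e1]
        refine and_congr_left fun hPz => ?_
        have := hχ2 hLp z
        rw [hc, hPz] at this
        simp only [mul_zero, sub_zero] at this
        constructor
        · intro h9; rw [h9, neg_zero] at this
          exact (mul_eq_zero.1 this).resolve_right (ee_ne _)
        · intro h9; rw [h9, zero_mul] at this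
          exact (neg_eq_zero.1 this.symm)
    obtain ⟨R, hR, hRP⟩ := div_simple hχ hP.d hP.sim (fun z hz => by
      obtain ⟨m, n, rfl⟩ := hP.zer z hz
      exact (hlat m n).1)
    have hR1 : ∀ z, R (z + 1) - R z = 0 := fun z => by
      refine mul_zero_ent (D := fun z => R (z + 1) - R z) (by fun_prop) hP.d (fun z => ?_) hP0 z
      have := hχ1 z
      rw [hRP, hRP, hP.p1] at this
      linear_combination -this
    have hRa : ∀ z, R (z + a) - R z + L * c = 0 := fun z => by
      refine mul_zero_ent (D := fun z => R (z + a) - R z + L * c) (by fun_prop) hP.d (fun z => ?_) hP0 z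
      have := hχ2 hLp z
      rw [hRP, hRP, hP.pa, hc] at this
      linear_combination -this - R (z + a) * P z * hee z
    have hR' : Differentiable ℂ (deriv R) := (hR.contDiff (n := 2)).differentiable_deriv_two
    have hconst := ell_const ha hR' (fun z => by
        rw [← deriv_comp_add_const]
        rw [show (fun x => R (x + 1)) = R from funext fun x => by linear_combination hR1 x])
      (fun z => by
        rw [← deriv_comp_add_const]
        rw [show (fun x => R (x + a)) = fun x => R x - L * c from funext fun x => by
          linear_combination hRa x]
        simp)
    have hlin : ∀ z, R z - deriv R 0 * z = R 0 - deriv R 0 * 0 := fun z => by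
      refine is_const_of_deriv_eq_zero (f := fun z => R z - deriv R 0 * z) (by fun_prop) (fun z => ?_) z 0
      rw [deriv_fun_sub (hR z) (by fun_prop), hconst z, deriv_const_mul _ (by fun_prop)]; simp
    have e1 := hlin 1
    have e2 := hlin a
    have e3 := hR1 0
    have e4 := hRa 0
    rw [zero_add] at e3 e4
    have hk : deriv R 0 = 0 := by linear_combination e3 - e1
    rw [hk] at e2
    have : (L:ℂ) * c = 0 := by linear_combination e4 - e2
    exact (mul_eq_zero.1 this).resolve_left (by exact_mod_cast hLp.ne')

def ps (φ : ℂ → ℂ) : ℕ → ℂ → ℂ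
  | 0 => φ
  | n + 1 => dslope (ps φ n) 0

lemma ps_diff {φ : ℂ → ℂ} (h : Differentiable ℂ φ) (n : ℕ) : Differentiable ℂ (ps φ n) := by
  induction n with
  | zero => exact h
  | succ n ih => exact dslope_diff ih 0

lemma ps_mul {φ : ℂ → ℂ} (n : ℕ) (h : ∀ j < n, ps φ j 0 = 0) (z : ℂ) : φ z = z ^ n * ps φ n z := by
  induction n with
  | zero => simp [ps]
  | succ n ih =>
    rw [ih fun j hj => h j (by omega), dslope_mul (h n (by omega)) z, pow_succ, mul_assoc]; rfl

lemma ps_int {φ : ℂ → ℂ} (hd : Differentiable ℂ φ) (n : ℕ) (h : ∀ j < n, ps φ j 0 = 0) :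
    ps φ n 0 = ∫ u in (0:ℝ)..1, φ (ee u) * ee (-(n * u)) := by
  rw [← mean_val (ps_diff hd n)]
  congr 1; ext u
  rw [ps_mul n h, ee_pow, ee_neg]
  have := ee_ne (n * u)
  field_simp

lemma case1_end {a : ℂ} (ha : 0 < a.im) {φ : ℂ → ℂ} (hd : Differentiable ℂ φ) (m : ℕ)
    (h1 : ∀ z, φ (z + 1) = -φ z) (h2 : ∀ z, φ (z + a) * ee ((m + 1 / 2) * (2 * z + a)) = -φ z)
    (h0 : ∀ j ≤ 2 * m + 1, ps φ j 0 = 0) (z : ℂ) : φ z = 0 := by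
  obtain ⟨P, hP⟩ := exists_P ha
  have hP0 : deriv P 0 ≠ 0 := hP.sim 0 hP.z0
  have hodd : (-1 : ℂ) ^ (2 * m + 1) = -1 := Odd.neg_one_pow ⟨m, rfl⟩
  obtain ⟨c, hc⟩ := lemZ ha hP (2 * m + 1) φ hd (fun z => by rw [hodd, h1]; ring) (fun z => by
      have := h2 z
      have hee : ee (-((2 * m + 1 : ℕ) * z) - (2 * m + 1 : ℕ) * a / 2) * ee ((m + 1 / 2) * (2 * z + a)) = 1 := by
        rw [← ee_add, show -((2 * m + 1 : ℕ) * z) - (2 * m + 1 : ℕ) * a / 2 + (m + 1 / 2) * (2 * z + a) = 0 by push_cast; ring, ee_zero]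
      rw [hodd]
      linear_combination (-φ (z + a)) * hee + ee (-((2 * m + 1 : ℕ) * z) - (2 * m + 1 : ℕ) * a / 2) * this)
    (by
      rw [natCast_le_analyticOrderAt (hd.analyticAt 0)]
      exact ⟨ps φ (2 * m + 1), (ps_diff hd _).analyticAt 0, Eventually.of_forall fun z => by
        simpa using ps_mul (2 * m + 1) (fun j hj => h0 j (by omega)) z⟩)
  have hlim := lim_eq0 (A := fun z => c * dslope P 0 z ^ (2 * m + 1)) (B := fun z => z * ps φ (2 * m + 2) z)
    (by have := (dslope_diff hP.d 0).continuous; fun_prop)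
    (by have := (ps_diff hd (2 * m + 2)).continuous; fun_prop) (fun z hz => by
      have e1 := ps_mul (2 * m + 2) (fun j hj => h0 j (by omega)) z
      rw [hc, dslope_mul hP.z0 z] at e1
      have : z ^ (2 * m + 1) ≠ 0 := pow_ne_zero _ hz
      apply mul_left_cancel₀ this
      rw [mul_pow] at e1
      linear_combination e1)
  simp only [dslope_same, zero_mul, mul_eq_zero] at hlim
  rw [hc, hlim.resolve_right (pow_ne_zero _ hP0), zero_mul]

lemma Dat.case1 (h : Dat f) {m : ℕ} (hm : 1 ≤ m) (hmin : ∀ m' : ℤ, m' < m → ∀ l ≤ 12, ∀ a : ℂ, 0 < a.im →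
    ∀ z, phi f m' l a z = 0) {L : ℕ} (hL : L ≤ 12)
    (hz : ∀ l, L < l → l ≤ 12 → ∀ a : ℂ, 0 < a.im → ∀ z, phi f m l a z = 0) (ν : ℕ) :
    ν ≤ 2 * m + 1 → ∀ a : ℂ, 0 < a.im → ps (phi f m L a) ν 0 = 0 := by
  induction ν using Nat.strong_induction_on with
  | _ ν ih =>
  intro hν
  have hlow : ∀ a : ℂ, 0 < a.im → ∀ j < ν, ps (phi f m L a) j 0 = 0 := fun a ha j hj =>
    ih j hj (by omega) a ha
  have hmul : ∀ a : ℂ, 0 < a.im → ∀ z, phi f m L a z = z ^ ν * ps (phi f m L a) ν z :=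
    fun a ha z => ps_mul ν (hlow a ha) z
  have hcont : ∀ a : ℂ, 0 < a.im → Continuous (ps (phi f m L a) ν) := fun a ha =>
    (ps_diff (h.phi_dz m L ha) ν).continuous
  by_cases hpar : Even (ν + L)
  swap
  · intro a ha
    rw [Nat.not_even_iff_odd] at hpar
    have := lim_eq0 (A := fun z => ps (phi f m L a) ν (-z)) (B := fun z => -ps (phi f m L a) ν z)
      (by have := hcont a ha; fun_prop) (by have := hcont a ha; fun_prop) (fun z hz0 => by
        have e1 := h.phi_D m L (z := z) ha
        rw [hmul a ha, hmul a ha, neg_pow] at e1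
        have e2 : (-1 : ℂ) ^ L * (-1) ^ ν = -1 := by rw [← pow_add, add_comm, hpar.neg_one_pow]
        have e3 : ((-1 : ℂ) ^ L) ^ 2 = 1 := by rw [← pow_mul, mul_comm, pow_mul]; simp
        have : z ^ ν ≠ 0 := pow_ne_zero _ hz0
        apply mul_left_cancel₀ this
        linear_combination (-(-1 : ℂ) ^ L) * e1 + z ^ ν * ps (phi f m L a) ν (-z) * e2 -
          z ^ ν * ps (phi f m L a) ν z * e3)
    simp only [neg_zero] at this
    linear_combination this / 2
  set g : ℂ → ℂ := fun a => ∫ u in (0:ℝ)..1, phi f m L a (ee u) * ee (-(ν * u)) with hg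
  have hgp : ∀ a : ℂ, 0 < a.im → ps (phi f m L a) ν 0 = g a := fun a ha =>
    ps_int (h.phi_dz m L ha) ν (hlow a ha)
  have hcu : ContinuousOn (Function.uncurry fun (a : ℂ) (u : ℝ) => phi f m L a (ee u) * ee (-(ν * u)))
      ({a : ℂ | 0 < a.im} ×ˢ Set.univ) := by
    refine ContinuousOn.mul ?_ (by fun_prop)
    exact (h.phi_cont m L).comp (f := fun q : ℂ × ℝ => (q.1, ee q.2)) (by fun_prop) fun q hq => hq.1
  have hgd : DifferentiableOn ℂ g {a | 0 < a.im} :=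
    param_diff (isOpen_imgt 0) (fun a u => phi f m L a (ee u) * ee (-(ν * u))) hcu
      (fun u => (h.phi_da m L (ee u)).mul_const _)
  have hg1 : ∀ a : ℂ, 0 < a.im → g (a + 1) = -g a := fun a ha => by
    simp only [hg]
    rw [← intervalIntegral.integral_neg]
    congr 1; ext u
    rw [h.phi_T1 m L ha]; ring
  have hper : PerHol 0 (fun a => g a * ee (-(a / 2))) := by
    refine ⟨hgd.mul (ee_diff.comp (by fun_prop)).differentiableOn, fun b hb => ?_⟩
    rw [hg1 b hb, show -((b + 1) / 2) = -(b / 2) + -(1 / 2) by ring, ee_add,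
        ee_neg (1 / 2), ee_half]
    ring
  obtain ⟨C, hC⟩ := decay_half hper one_pos m (fun n hn => by
    have e : coef (fun a => g a * ee (-(a / 2))) n 1 = ∫ x in (0:ℝ)..1, ∫ u in (0:ℝ)..1,
        phi f m L (x + (1:ℝ) * I) (ee u) * ee (-(ν * u)) * (ee (-((x + (1:ℝ) * I) / 2)) *
          ee (-(n * (x + (1:ℝ) * I)))) := by
      rw [coef]
      congr 1; ext x
      rw [hg, mul_assoc, ← intervalIntegral.integral_mul_const]
    rw [e, int_swap]
    · have : ∀ u : ℝ, ∫ x in (0:ℝ)..1, phi f m L (x + (1:ℝ) * I) (ee u) * ee (-(ν * u)) *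
          (ee (-((x + (1:ℝ) * I) / 2)) * ee (-(n * (x + (1:ℝ) * I)))) = 0 := fun u => by
        have e2 : dc f n m L (ee u) = 0 := by
          rw [h.dc_W n m hL, dc_of_phi, neg_zero]
          exact fun a ha => hmin n hn _ (by omega) a ha _
        have e3 := (h.phi_per m L (ee u)).coef_indep n (v := |(ee u).im| + 1) (w := 1)
          (by have := abs_nonneg (ee u).im; linarith) one_pos
        rw [← dc, e2, coef] at e3
        rw [← zero_mul (ee (-(ν * u))), e3, ← intervalIntegral.integral_mul_const]
        congr 1; ext x; ring
      simp only [this, intervalIntegral.integral_zero]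
    · refine Continuous.mul ?_ (by fun_prop)
      exact hcu.comp_continuous (f := fun q : ℝ × ℝ => ((q.1 + (1:ℝ) * I : ℂ), q.2)) (by fun_prop)
        fun q => ⟨by show (0:ℝ) < Complex.im _; simp, trivial⟩)
  intro a ha
  rw [hgp a ha]
  refine genus_one hgd (fun a ha => by rw [hg1 a ha, norm_neg]) (14 - L + ν) (fun a ha => ?_)
    ((m:ℤ) + 1 / 2) C 2 hC ?_ a ha
  · have ha0 : a ≠ 0 := by rintro rfl; simp at ha
    rw [← hgp a ha, ← hgp _ (im_S ha)]
    have := lim_eq0 (A := fun z => ps (phi f m L (-1 / a)) ν (z / a) * ee (-((m + 1 / 2) * (z ^ 2 / a))))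
      (B := fun z => -a ^ (14 - L + ν) * ps (phi f m L a) ν z)
      (by have := hcont _ (im_S ha); fun_prop) (by have := hcont a ha; fun_prop) (fun z hz0 => by
        have e1 := h.S_top m hL ha z (fun l h1 h2 => by rw [hz l h1 h2 a ha, mul_zero])
        rw [hmul a ha, hmul _ (im_S ha), div_pow] at e1
        push_cast at e1
        have h5 : z ^ ν ≠ 0 := pow_ne_zero _ hz0
        have h6 : a ^ ν ≠ 0 := pow_ne_zero _ ha0
        apply mul_left_cancel₀ h5
        rw [pow_add]
        show z ^ ν * (ps (phi f m L (-1 / a)) ν (z / a) * ee (-((m + 1 / 2) * (z ^ 2 / a)))) =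
          z ^ ν * (-(a ^ (14 - L) * a ^ ν) * ps (phi f m L a) ν z)
        generalize ps (phi f m L (-1 / a)) ν (z / a) = p1 at e1 ⊢
        generalize ee (-((m + 1 / 2) * (z ^ 2 / a))) = p2 at e1 ⊢
        generalize ps (phi f m L a) ν z = p3 at e1 ⊢
        have e2 : z ^ ν / a ^ ν * a ^ ν = z ^ ν := by field_simp
        linear_combination a ^ ν * e1 - p1 * p2 * e2)
    simp only [zero_div, ne_eq, OfNat.ofNat_ne_zero, not_false_eq_true, zero_pow, mul_zero, neg_zero,
      ee_zero, mul_one] at this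
    rw [this, norm_mul, norm_neg, norm_pow]
  · have : 14 - L + ν ≤ 13 + (2 * m + 1) := by
      rcases Nat.eq_zero_or_pos L with rfl | hLp
      · obtain ⟨r, hr⟩ := hpar; omega
      · omega
    have h7 : ((14 - L + ν : ℕ) : ℝ) ≤ 13 + (2 * m + 1) := by exact_mod_cast this
    have h8 : (1:ℝ) ≤ m := by exact_mod_cast hm
    push_cast at h7 ⊢
    linarith

theorem Dat.zero (h : Dat f) (h8 : dc f 0 0 8 0 = 0) {l : ℕ} (hl : l ≤ 12) {a z b : ℂ}
    (hb : (a, z, b) ∈ Dom) : f l a z b = 0 := by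
  have ha : 0 < a.im := hb.1
  suffices H : ∀ m : ℕ, ∀ l ≤ 12, ∀ a : ℂ, 0 < a.im → ∀ z, phi f m l a z = 0 by
    refine h.f_zero ha (fun m => ?_) b (Dom_hc hb)
    rcases lt_or_ge m 0 with hm | hm
    · exact h.koe hm ha hl z
    · obtain ⟨k, rfl⟩ := Int.eq_ofNat_of_zero_le hm
      exact H k l hl a ha z
  intro m
  induction m using Nat.strong_induction_on with
  | _ m ih =>
  have hmin : ∀ m' : ℤ, m' < m → ∀ l ≤ 12, ∀ a : ℂ, 0 < a.im → ∀ z, phi f m' l a z = 0 := by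
    intro m' hm' l hl a ha z
    rcases lt_or_ge m' 0 with hm | hm
    · exact h.koe hm ha hl z
    · obtain ⟨k, rfl⟩ := Int.eq_ofNat_of_zero_le hm
      exact ih k (by exact_mod_cast hm') l hl a ha z
  suffices H : ∀ j : ℕ, ∀ l, 12 < l + j → l ≤ 12 → ∀ a : ℂ, 0 < a.im → ∀ z, phi f m l a z = 0 from
    fun l hl => H 13 l (by omega) hl
  intro j
  induction j with
  | zero => intro l h1 h2; omega
  | succ j ihj =>
    intro L h1 hL a ha z
    have hz : ∀ l, L < l → l ≤ 12 → ∀ a : ℂ, 0 < a.im → ∀ z, phi f m l a z = 0 :=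
      fun l h3 h4 => ihj l (by omega) h4
    rcases Nat.eq_zero_or_pos m with rfl | hm
    · refine case0 ha (h.phi_dz _ L ha) L (fun z => h.phi_T12 _ L ha) (fun z => ?_)
        (fun z => h.phi_D _ L ha) (h.diag h8 hL ha _) (h.phi_dz 0 (L - 1) ha) (h.diag h8 (by omega) ha _)
        (fun z => h.phi_T12 _ _ ha) (fun hLp z => ?_) z
      · have := h.U_top (0:ℕ) hL ha (fun l h3 h4 => hz l h3 h4 a ha) z
        simpa using this
      · obtain ⟨L', rfl⟩ : ∃ L', L = L' + 1 := ⟨L - 1, by omega⟩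
        have := h.U_sub (0:ℕ) hL ha (fun l h3 h4 => hz l h3 h4 a ha) z
        simpa using this
    · refine case1_end ha (h.phi_dz m L ha) m (fun z => h.phi_T12 _ L ha) (fun z => ?_)
        (fun j hj => h.case1 hm hmin hL hz j hj a ha) z
      have := h.U_top m hL ha (fun l h3 h4 => hz l h3 h4 a ha) z
      push_cast at this
      exact this

end

section
abbrev M4 := Matrix (Fin 4) (Fin 4) ℤ

lemma sl2_gen (Q : ℤ → ℤ → ℤ → ℤ → Prop) (hm : ∀ a b c d a' b' c' d', a * d - b * c = 1 →
      a' * d' - b' * c' = 1 → Q a b c d → Q a' b' c' d' →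
      Q (a * a' + b * c') (a * b' + b * d') (c * a' + d * c') (c * b' + d * d'))
    (hS : Q 0 (-1) 1 0) (hT : Q 1 1 0 1) (a b c d : ℤ) (h : a * d - b * c = 1) : Q a b c d := by
  have hS2 := hm _ _ _ _ _ _ _ _ (by norm_num) (by norm_num) hS hS
  have hS3 := hm _ _ _ _ _ _ _ _ (by norm_num) (by norm_num) hS hS2
  have hS4 := hm _ _ _ _ _ _ _ _ (by norm_num) (by norm_num) hS hS3
  have hR := hm _ _ _ _ _ _ _ _ (by norm_num) (by norm_num) hS hT
  have hR2 := hm _ _ _ _ _ _ _ _ (by norm_num) (by norm_num) hR hR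
  have hR4 := hm _ _ _ _ _ _ _ _ (by norm_num) (by norm_num) hR2 hR2
  have hR5 := hm _ _ _ _ _ _ _ _ (by norm_num) (by norm_num) hR4 hR
  have hTi := hm _ _ _ _ _ _ _ _ (by norm_num) (by norm_num) hR5 hS
  norm_num at hS3 hS4 hTi
  let R : SpecialLinearGroup (Fin 2) ℤ → Prop := fun A =>
    Q (A 0 0) (A 0 1) (A 1 0) (A 1 1) ∧ Q (A 1 1) (-A 0 1) (-A 1 0) (A 0 0)
  have key : ∀ A, R A := fun A => by
    have hA : A ∈ Subgroup.closure {ModularGroup.S, ModularGroup.T} := by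
      rw [SpecialLinearGroup.SL2Z_generators]; trivial
    induction hA using Subgroup.closure_induction with
    | mem x hx =>
      rcases hx with rfl | rfl
      · refine ⟨by simpa [ModularGroup.S] using hS, by simpa [ModularGroup.S] using hS3⟩
      · refine ⟨by simpa [ModularGroup.T] using hT, by simpa [ModularGroup.T] using hTi⟩
    | one => exact ⟨by simpa using hS4, by simpa using hS4⟩
    | mul x y _ _ hx hy =>
      have d1 := x.det_coe; have d2 := y.det_coe
      rw [det_fin_two] at d1 d2
      constructor
      · have := hm _ _ _ _ _ _ _ _ d1 d2 hx.1 hy.1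
        simpa [Matrix.mul_apply, Fin.sum_univ_two] using this
      · have := hm _ _ _ _ _ _ _ _ (by linarith) (by linarith) hy.2 hx.2
        convert this using 1 <;> simp [Matrix.mul_apply, Fin.sum_univ_two] <;> ring
    | inv x _ hx =>
      refine ⟨?_, ?_⟩
      · have := hx.2
        simpa [SpecialLinearGroup.coe_inv, adjugate_fin_two] using this
      · have := hx.1
        simpa [SpecialLinearGroup.coe_inv, adjugate_fin_two] using this
  simpa using (key ⟨!![a, b; c, d], by rw [det_fin_two_of]; exact h⟩).1

/-- first SL2 -/
def e1 (a b c d : ℤ) : M4 := !![a, 0, b, 0; 0, 1, 0, 0; c, 0, d, 0; 0, 0, 0, 1]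
def e2 (a b c d : ℤ) : M4 := !![1, 0, 0, 0; 0, a, 0, b; 0, 0, 1, 0; 0, c, 0, d]
def lv (a b c d : ℤ) : M4 := !![a, b, 0, 0; c, d, 0, 0; 0, 0, d, -c; 0, 0, -b, a]
def hs (q r : ℤ) : M4 := !![1, 0, r, q; 0, 1, q, 0; 0, 0, 1, 0; 0, 0, 0, 1]

lemma e1_mul (a b c d a' b' c' d' : ℤ) : e1 a b c d * e1 a' b' c' d' =
    e1 (a * a' + b * c') (a * b' + b * d') (c * a' + d * c') (c * b' + d * d') := by
  ext i j; fin_cases i <;> fin_cases j <;> simp [e1, Matrix.mul_apply, Fin.sum_univ_four]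
lemma lv_mul (a b c d a' b' c' d' : ℤ) : lv a b c d * lv a' b' c' d' =
    lv (a * a' + b * c') (a * b' + b * d') (c * a' + d * c') (c * b' + d * d') := by
  ext i j; fin_cases i <;> fin_cases j <;> simp [lv, Matrix.mul_apply, Fin.sum_univ_four] <;> ring
lemma e2_eq (a b c d : ℤ) : e2 a b c d = lv 0 (-1) 1 0 * e1 a b c d * lv 0 1 (-1) 0 := by
  ext i j; fin_cases i <;> fin_cases j <;> simp [lv, e1, e2, Matrix.mul_apply, Fin.sum_univ_four]
lemma hs_eq (q r : ℤ) : hs q r = e1 0 1 (-1) 0 * lv 1 0 (-q) 1 * e1 0 (-1) 1 0 * e1 1 r 0 1 := by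
  ext i j; fin_cases i <;> fin_cases j <;> simp [lv, e1, hs, Matrix.mul_apply, Fin.sum_univ_four]

lemma e1_Sp {a b c d : ℤ} (h : a * d - b * c = 1) : e1 a b c d ∈ Sp4Z := by
  show _ = _
  ext i j; fin_cases i <;> fin_cases j <;> simp [e1, J4, Matrix.mul_apply, Fin.sum_univ_four] <;> linarith
lemma lv_Sp {a b c d : ℤ} (h : a * d - b * c = 1) : lv a b c d ∈ Sp4Z := by
  show _ = _
  ext i j; fin_cases i <;> fin_cases j <;> simp [lv, J4, Matrix.mul_apply, Fin.sum_univ_four] <;> linarith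
lemma mul_Sp {x y : M4} (hx : x ∈ Sp4Z) (hy : y ∈ Sp4Z) : x * y ∈ Sp4Z := by
  change _ = _ at hx hy
  show _ = _
  rw [transpose_mul, show yᵀ * xᵀ * J4 * (x * y) = yᵀ * (xᵀ * J4 * x) * y by simp only [Matrix.mul_assoc],
    hx, hy]
lemma e2_Sp {a b c d : ℤ} (h : a * d - b * c = 1) : e2 a b c d ∈ Sp4Z := by
  rw [e2_eq]; exact mul_Sp (mul_Sp (lv_Sp (by norm_num)) (e1_Sp h)) (lv_Sp (by norm_num))
lemma hs_Sp (q r : ℤ) : hs q r ∈ Sp4Z := by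
  rw [hs_eq]
  exact mul_Sp (mul_Sp (mul_Sp (e1_Sp (by norm_num)) (lv_Sp (by ring))) (e1_Sp (by norm_num))) (e1_Sp (by ring))

lemma gcd_red (x y : ℤ) : ∃ a b c d : ℤ, a * d - b * c = 1 ∧ 0 ≤ a * x + b * y ∧ c * x + d * y = 0 := by
  rcases eq_or_ne (Int.gcd x y) 0 with h | h
  · obtain ⟨rfl, rfl⟩ := Int.gcd_eq_zero_iff.1 h
    exact ⟨1, 0, 0, 1, by norm_num, by norm_num, by norm_num⟩
  · have h' : (Int.gcd x y : ℤ) ≠ 0 := by exact_mod_cast h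
    have hb := Int.gcd_eq_gcd_ab x y
    obtain ⟨u, hu⟩ := Int.gcd_dvd_left x y
    obtain ⟨v, hv⟩ := Int.gcd_dvd_right x y
    refine ⟨Int.gcdA x y, Int.gcdB x y, -v, u, ?_, ?_, ?_⟩
    · apply mul_left_cancel₀ h'
      linear_combination (-Int.gcdA x y) * hu - Int.gcdB x y * hv - hb
    · have : (0:ℤ) ≤ Int.gcd x y := by positivity
      linarith
    · linear_combination (-v) * hu + u * hv

/-- the group is generated by four elements -/
theorem sp_gen (P : M4 → Prop) (hm : ∀ x ∈ Sp4Z, ∀ y ∈ Sp4Z, P x → P y → P (x * y))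
    (h1 : P (e1 1 1 0 1)) (h2 : P (e1 0 (-1) 1 0)) (h3 : P (lv 1 1 0 1)) (h4 : P (lv 0 (-1) 1 0))
    (γ : M4) (hγ : γ ∈ Sp4Z) : P γ := by
  have E1 : ∀ a b c d : ℤ, a * d - b * c = 1 → P (e1 a b c d) := sl2_gen _
    (fun a b c d a' b' c' d' h h' i j => by rw [← e1_mul]; exact hm _ (e1_Sp h) _ (e1_Sp h') i j) h2 h1
  have LV : ∀ a b c d : ℤ, a * d - b * c = 1 → P (lv a b c d) := sl2_gen _
    (fun a b c d a' b' c' d' h h' i j => by rw [← lv_mul]; exact hm _ (lv_Sp h) _ (lv_Sp h') i j) h4 h3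
  have E2 : ∀ a b c d : ℤ, a * d - b * c = 1 → P (e2 a b c d) := fun a b c d h => by
    rw [e2_eq]
    exact hm _ (mul_Sp (lv_Sp (by norm_num)) (e1_Sp h)) _ (lv_Sp (by norm_num))
      (hm _ (lv_Sp (by norm_num)) _ (e1_Sp h) (LV _ _ _ _ (by norm_num)) (E1 _ _ _ _ h)) (LV _ _ _ _ (by norm_num))
  have HS : ∀ q r : ℤ, P (hs q r) := fun q r => by
    rw [hs_eq]
    have s1 : e1 0 1 (-1) 0 ∈ Sp4Z := e1_Sp (by norm_num)
    have s2 : lv 1 0 (-q) 1 ∈ Sp4Z := lv_Sp (by ring)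
    have s3 : e1 0 (-1) 1 0 ∈ Sp4Z := e1_Sp (by norm_num)
    have s4 : e1 1 r 0 1 ∈ Sp4Z := e1_Sp (by ring)
    exact hm _ (mul_Sp (mul_Sp s1 s2) s3) _ s4 (hm _ (mul_Sp s1 s2) _ s3 (hm _ s1 _ s2
      (E1 _ _ _ _ (by norm_num)) (LV _ _ _ _ (by ring))) h2) (E1 _ _ _ _ (by ring))
  -- reductions
  have R1 : ∀ (a b c d : ℤ) (g : M4), a * d - b * c = 1 → g ∈ Sp4Z → P (e1 a b c d * g) → P g := by
    intro a b c d g h hg hp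
    have : g = e1 d (-b) (-c) a * (e1 a b c d * g) := by
      rw [← Matrix.mul_assoc, e1_mul]
      rw [show e1 _ _ _ _ = (1 : M4) by
        rw [show d * a + -b * c = 1 by linarith, show d * b + -b * d = 0 by ring, show -c * a + a * c = 0 by ring,
          show -c * b + a * d = 1 by linarith]
        decide, Matrix.one_mul]
    rw [this]
    exact hm _ (e1_Sp (by linarith)) _ (mul_Sp (e1_Sp h) hg) (E1 _ _ _ _ (by linarith)) hp
  have R3 : ∀ (a b c d : ℤ) (g : M4), a * d - b * c = 1 → g ∈ Sp4Z → P (lv a b c d * g) → P g := by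
    intro a b c d g h hg hp
    have : g = lv d (-b) (-c) a * (lv a b c d * g) := by
      rw [← Matrix.mul_assoc, lv_mul]
      rw [show lv _ _ _ _ = (1 : M4) by
        rw [show d * a + -b * c = 1 by linarith, show d * b + -b * d = 0 by ring, show -c * a + a * c = 0 by ring,
          show -c * b + a * d = 1 by linarith]
        decide, Matrix.one_mul]
    rw [this]
    exact hm _ (lv_Sp (by linarith)) _ (mul_Sp (lv_Sp h) hg) (LV _ _ _ _ (by linarith)) hp
  have R2 : ∀ (a b c d : ℤ) (g : M4), a * d - b * c = 1 → g ∈ Sp4Z → P (e2 a b c d * g) → P g := by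
    intro a b c d g h hg hp
    have : g = e2 d (-b) (-c) a * (e2 a b c d * g) := by
      rw [← Matrix.mul_assoc]
      rw [show e2 d (-b) (-c) a * e2 a b c d = (1 : M4) by
        ext i j; fin_cases i <;> fin_cases j <;> simp [e2, Matrix.mul_apply, Fin.sum_univ_four] <;> linarith, Matrix.one_mul]
    rw [this]
    exact hm _ (e2_Sp (by linarith)) _ (mul_Sp (e2_Sp h) hg) (E2 _ _ _ _ (by linarith)) hp
  have sp : ∀ g ∈ Sp4Z, ∀ i j, g 0 i * g 2 j + g 1 i * g 3 j - g 2 i * g 0 j - g 3 i * g 1 j = J4 i j := by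
    intro g hg i j
    change _ = _ at hg
    rw [← hg]
    simp [J4, Matrix.mul_apply, Fin.sum_univ_four]; ring
  -- step 4 : first column e1 and middle block trivial
  have st4 : ∀ g ∈ Sp4Z, g 0 0 = 1 → g 1 0 = 0 → g 2 0 = 0 → g 3 0 = 0 → g 1 1 = 1 → g 1 3 = 0 →
      g 3 1 = 0 → g 3 3 = 1 → P g := by
    intro g hg c0 c1 c2 c3 d0 d1 d2 d3
    have r1 := sp g hg 0 1; have r2 := sp g hg 0 2; have r3 := sp g hg 0 3
    have r4 := sp g hg 1 2; have r5 := sp g hg 2 3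
    simp [J4, c0, c1, c2, c3] at r1 r2 r3
    simp [J4, d0, d1, d2, d3, r1, r2, r3] at r4 r5
    apply R3 1 (-g 0 1) 0 1 g (by ring) hg
    have : lv 1 (-g 0 1) 0 1 * g = hs (g 1 2) (g 0 2 - g 0 1 * g 1 2) := by
      ext i j; fin_cases i <;> fin_cases j <;> simp [lv, hs, Matrix.mul_apply, Fin.sum_univ_four, c0, c1, c2, c3, d0, d1, d2, d3, r1, r2, r3] <;> linarith
    rw [this]; exact HS _ _
  have st3 : ∀ g ∈ Sp4Z, g 0 0 = 1 → g 1 0 = 0 → g 2 0 = 0 → g 3 0 = 0 → P g := by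
    intro g hg c0 c1 c2 c3
    have r1 := sp g hg 0 1; have r3 := sp g hg 0 3
    have r4 := sp g hg 1 3
    simp [J4, c0, c1, c2, c3] at r1 r3
    simp [J4, r1, r3] at r4
    have hdet : g 3 3 * g 1 1 - -g 1 3 * -g 3 1 = 1 := by linarith
    apply R2 (g 3 3) (-g 1 3) (-g 3 1) (g 1 1) g hdet hg
    apply st4 _ (mul_Sp (e2_Sp hdet) hg) <;> simp [e2, Matrix.mul_apply, Fin.sum_univ_four, c0, c1, c2, c3] <;> linarith
  have st2 : ∀ g ∈ Sp4Z, g 2 0 = 0 → g 3 0 = 0 → P g := by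
    intro g hg c2 c3
    obtain ⟨a, b, c, d, h, hp, hz⟩ := gcd_red (g 0 0) (g 1 0)
    apply R3 a b c d g h hg
    have hs := mul_Sp (lv_Sp h) hg
    have q0 : (lv a b c d * g) 0 0 = a * g 0 0 + b * g 1 0 := by simp [lv, Matrix.mul_apply, Fin.sum_univ_four]
    have q1 : (lv a b c d * g) 1 0 = 0 := by simp [lv, Matrix.mul_apply, Fin.sum_univ_four, hz]
    have q2 : (lv a b c d * g) 2 0 = 0 := by simp [lv, Matrix.mul_apply, Fin.sum_univ_four, c2, c3]
    have q3 : (lv a b c d * g) 3 0 = 0 := by simp [lv, Matrix.mul_apply, Fin.sum_univ_four, c2, c3]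
    have r2 := sp _ hs 0 2
    rw [q1, q2, q3, q0] at r2
    simp [J4] at r2
    rcases Int.eq_one_or_neg_one_of_mul_eq_one r2 with h1 | h1
    · exact st3 _ hs (q0.trans h1) q1 q2 q3
    · omega
  have st1 : ∀ g ∈ Sp4Z, g 2 0 = 0 → P g := by
    intro g hg c2
    obtain ⟨a, b, c, d, h, hp, hz⟩ := gcd_red (g 1 0) (g 3 0)
    apply R2 a b c d g h hg
    exact st2 _ (mul_Sp (e2_Sp h) hg) (by simp [e2, Matrix.mul_apply, Fin.sum_univ_four, c2])
      (by simp [e2, Matrix.mul_apply, Fin.sum_univ_four, hz])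
  obtain ⟨a, b, c, d, h, hp, hz⟩ := gcd_red (γ 0 0) (γ 2 0)
  apply R1 a b c d γ h hγ
  exact st1 _ (mul_Sp (e1_Sp h) hγ) (by simp [e1, Matrix.mul_apply, Fin.sum_univ_four, hz])

structure EpsVals (ε : M4 → ℂ) : Prop where
  t1 : ε (e1 1 1 0 1) = -1
  j1 : ε (e1 0 (-1) 1 0) = -1
  lt : ε (lv 1 1 0 1) = -1
  ls : ε (lv 0 (-1) 1 0) = -1
  t12 : ε (hs 1 0) = -1
  t2 : ε (e2 1 1 0 1) = -1
  w : ε (lv 0 (-1) 1 0 * e2 (-1) 0 0 (-1)) = -1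
  d : ε (e2 (-1) 0 0 (-1)) = 1
  u : ε (lv 1 0 1 1) = -1

theorem eps_vals {ε : M4 → ℂ} (hε : IsEps ε) : EpsVals ε := by
  obtain ⟨h1, hm, hn⟩ := hε
  have sq : ∀ γ ∈ Sp4Z, ε γ * ε γ = 1 := fun γ hγ => by rcases h1 γ hγ with h | h <;> rw [h] <;> norm_num
  have t1S : e1 1 1 0 1 ∈ Sp4Z := e1_Sp (by norm_num)
  have j1S : e1 0 (-1) 1 0 ∈ Sp4Z := e1_Sp (by norm_num)
  have ltS : lv 1 1 0 1 ∈ Sp4Z := lv_Sp (by norm_num)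
  have lsS : lv 0 (-1) 1 0 ∈ Sp4Z := lv_Sp (by norm_num)
  have t12S : hs 1 0 ∈ Sp4Z := hs_Sp _ _
  have t2S : e2 1 1 0 1 ∈ Sp4Z := e2_Sp (by norm_num)
  have dS : e2 (-1) 0 0 (-1) ∈ Sp4Z := e2_Sp (by norm_num)
  have uS : lv 1 0 1 1 ∈ Sp4Z := lv_Sp (by norm_num)
  have j2S : e2 0 (-1) 1 0 ∈ Sp4Z := e2_Sp (by norm_num)
  have q1 := sq _ t1S; have q2 := sq _ j1S; have q3 := sq _ ltS; have q4 := sq _ lsS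
  have q5 := sq _ t2S; have q6 := sq _ t12S; have q7 := sq _ uS; have q8 := sq _ j2S
  -- relations
  have a1 : ε (e1 0 (-1) 1 0) = ε (e1 1 1 0 1) := by
    have : (e1 0 (-1) 1 0 * e1 1 1 0 1) * ((e1 0 (-1) 1 0 * e1 1 1 0 1) * (e1 0 (-1) 1 0 * e1 1 1 0 1))
      = e1 0 (-1) 1 0 * e1 0 (-1) 1 0 := by decide +kernel
    have := congrArg ε this
    rw [hm _ (mul_Sp j1S t1S) _ (mul_Sp (mul_Sp j1S t1S) (mul_Sp j1S t1S)), hm _ (mul_Sp j1S t1S) _ (mul_Sp j1S t1S), hm _ j1S _ t1S,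
      hm _ j1S _ j1S] at this
    generalize ε (e1 0 (-1) 1 0) = x at *
    generalize ε (e1 1 1 0 1) = y at *
    linear_combination y * this - x * q1 - x * y ^ 2 * q1 + (y - x * y ^ 4) * q2
  have a2 : ε (lv 0 (-1) 1 0) = ε (lv 1 1 0 1) := by
    have : (lv 0 (-1) 1 0 * lv 1 1 0 1) * ((lv 0 (-1) 1 0 * lv 1 1 0 1) * (lv 0 (-1) 1 0 * lv 1 1 0 1))
      = lv 0 (-1) 1 0 * lv 0 (-1) 1 0 := by decide +kernel
    have := congrArg ε this
    rw [hm _ (mul_Sp lsS ltS) _ (mul_Sp (mul_Sp lsS ltS) (mul_Sp lsS ltS)), hm _ (mul_Sp lsS ltS) _ (mul_Sp lsS ltS), hm _ lsS _ ltS,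
      hm _ lsS _ lsS] at this
    generalize ε (lv 0 (-1) 1 0) = x at *
    generalize ε (lv 1 1 0 1) = y at *
    linear_combination y * this - x * q3 - x * y ^ 2 * q3 + (y - x * y ^ 4) * q4
  have a3 : ε (e2 1 1 0 1) = ε (e1 1 1 0 1) := by
    have : e2 1 1 0 1 * lv 0 (-1) 1 0 = lv 0 (-1) 1 0 * e1 1 1 0 1 := by decide +kernel
    have := congrArg ε this
    rw [hm _ t2S _ lsS, hm _ lsS _ t1S] at this
    linear_combination ε (lv 0 (-1) 1 0) * this + (ε (e1 1 1 0 1) - ε (e2 1 1 0 1)) * q4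
  have a4 : ε (hs 1 0) = ε (e1 1 1 0 1) := by
    have : lv 1 1 0 1 * e2 1 1 0 1 = (e1 1 1 0 1 * (hs 1 0 * e2 1 1 0 1)) * lv 1 1 0 1 := by decide +kernel
    have := congrArg ε this
    rw [hm _ ltS _ t2S, hm _ (mul_Sp t1S (mul_Sp t12S t2S)) _ ltS, hm _ t1S _ (mul_Sp t12S t2S), hm _ t12S _ t2S] at this
    generalize ε (hs 1 0) = x at *
    generalize ε (e1 1 1 0 1) = y at *
    generalize ε (e2 1 1 0 1) = w at *
    generalize ε (lv 1 1 0 1) = v at *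
    have e : x * y = 1 := by
      have : v * w * v * w = v * w * v * w * (x * y) := by linear_combination v * w * this
      rw [show v * w * v * w = (v * v) * (w * w) by ring, q3, q5] at this
      linear_combination -this
    linear_combination y * e - x * q1
  have a5 : ε (lv 1 0 1 1) = ε (hs 1 0) := by
    have : lv 1 0 1 1 * e1 0 (-1) 1 0 * hs 1 0 = e1 0 (-1) 1 0 := by decide +kernel
    have := congrArg ε this
    rw [hm _ (mul_Sp uS j1S) _ t12S, hm _ uS _ j1S] at this
    generalize ε (hs 1 0) = x at *
    generalize ε (e1 0 (-1) 1 0) = y at *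
    generalize ε (lv 1 0 1 1) = w at *
    linear_combination y * x * this - (w * x ^ 2 - x) * q2 - w * q6
  have a6 : ε (lv 1 0 1 1) = ε (lv 1 1 0 1) := by
    have : lv 1 0 1 1 * lv 0 (-1) 1 0 * lv 1 1 0 1 = lv 0 (-1) 1 0 := by decide +kernel
    have := congrArg ε this
    rw [hm _ (mul_Sp uS lsS) _ ltS, hm _ uS _ lsS] at this
    generalize ε (lv 0 (-1) 1 0) = x at *
    generalize ε (lv 1 1 0 1) = y at *
    generalize ε (lv 1 0 1 1) = w at *
    linear_combination x * y * this - (w * y ^ 2 - y) * q4 - w * q3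
  have ed : ε (e2 (-1) 0 0 (-1)) = 1 := by
    have : e2 (-1) 0 0 (-1) = e2 0 (-1) 1 0 * e2 0 (-1) 1 0 := by decide +kernel
    rw [this, hm _ j2S _ j2S, q8]
  have key : ε (e1 1 1 0 1) = -1 := by
    rcases h1 _ t1S with h | h
    · exfalso
      obtain ⟨γ, hγ, hne⟩ := hn
      refine hne (sp_gen (fun γ => ε γ = 1) (fun x hx y hy i j => by rw [hm x hx y hy, i, j, one_mul]) h
        (a1.trans h) (a6.symm.trans (a5.trans (a4.trans h))) (a2.trans (a6.symm.trans (a5.trans (a4.trans h)))) γ hγ)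
    · exact h
  exact ⟨key, a1.trans key, a6.symm.trans (a5.trans (a4.trans key)), a2.trans (a6.symm.trans (a5.trans (a4.trans key))),
    a4.trans key, a3.trans key, by rw [hm _ lsS _ dS, ed, a2.trans (a6.symm.trans (a5.trans (a4.trans key)))]; norm_num, ed,
    a5.trans (a4.trans key)⟩

end

section
def mkH (a z b : ℂ) : Fin 2 → Fin 2 → ℂ := ![![a, z], ![z, b]]

lemma mk_of (a z b : ℂ) : Matrix.of (mkH a z b) = !![a, z; z, b] := rfl

lemma mk_mem {a z b : ℂ} : mkH a z b ∈ H2 ↔ (a, z, b) ∈ Dom := by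
  have hM : (Matrix.of fun i j => (mkH a z b i j).im) = !![a.im, z.im; z.im, b.im] := by
    ext i j; fin_cases i <;> fin_cases j <;> rfl
  show (_ ∧ _) ↔ (_ ∧ _)
  rw [hM, posDef_iff_dotProduct_mulVec]
  constructor
  · rintro ⟨-, -, h⟩
    have h1 := h (x := ![1, 0]) (fun h => by simpa using congrFun h 0)
    have h2 := h (x := ![-z.im, a.im])
    simp [Matrix.mulVec, dotProduct, Fin.sum_univ_two] at h1
    refine ⟨h1, ?_⟩
    have h3 := h2 (fun h => by have := congrFun h 1; simp at this; linarith)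
    simp [Matrix.mulVec, dotProduct, Fin.sum_univ_two] at h3
    have : 0 < a.im * (a.im * b.im - z.im ^ 2) := by nlinarith
    have := (mul_pos_iff_of_pos_left h1).1 this
    linarith
  · rintro ⟨h1, h2⟩
    simp only at h1 h2
    refine ⟨?_, ?_, ?_⟩
    · ext i j; fin_cases i <;> fin_cases j <;> rfl
    · ext i j; fin_cases i <;> fin_cases j <;> simp
    · intro x hx
      simp only [Matrix.mulVec, dotProduct, Fin.sum_univ_two, star_trivial, Pi.star_apply]
      simp
      have key : 0 < a.im * (x 0 * (a.im * x 0 + z.im * x 1) + x 1 * (z.im * x 0 + b.im * x 1)) := by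
        have : a.im * (x 0 * (a.im * x 0 + z.im * x 1) + x 1 * (z.im * x 0 + b.im * x 1)) =
          (a.im * x 0 + z.im * x 1) ^ 2 + (a.im * b.im - z.im ^ 2) * x 1 ^ 2 := by ring
        rw [this]
        by_cases h0 : x 1 = 0
        · have : x 0 ≠ 0 := fun h => hx (by ext i; fin_cases i <;> assumption)
          rw [h0]; simp; positivity
        · have : 0 < a.im * b.im - z.im ^ 2 := by linarith
          positivity
      exact (mul_pos_iff_of_pos_left h1).1 key

lemma H2_mk {τ : Fin 2 → Fin 2 → ℂ} (h : τ ∈ H2) : τ = mkH (τ 0 0) (τ 0 1) (τ 1 1) := by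
  have := congrFun (congrFun h.1 0) 1
  simp [Matrix.transpose] at this
  ext i j; fin_cases i <;> fin_cases j <;> simp [mkH, this]

lemma blk_eq (γ : M4) : blk γ 0 0 = !![(γ 0 0 : ℂ), γ 0 1; γ 1 0, γ 1 1] ∧ blk γ 0 1 = !![(γ 0 2 : ℂ), γ 0 3; γ 1 2, γ 1 3] ∧
    blk γ 1 0 = !![(γ 2 0 : ℂ), γ 2 1; γ 3 0, γ 3 1] ∧ blk γ 1 1 = !![(γ 2 2 : ℂ), γ 2 3; γ 3 2, γ 3 3] := by
  refine ⟨?_, ?_, ?_, ?_⟩ <;> ext i j <;> fin_cases i <;> fin_cases j <;> rfl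

lemma blk_mul (γ δ : M4) (r s : Fin 2) : blk (γ * δ) r s = blk γ r 0 * blk δ 0 s + blk γ r 1 * blk δ 1 s := by
  obtain ⟨a1, a2, a3, a4⟩ := blk_eq γ
  obtain ⟨b1, b2, b3, b4⟩ := blk_eq δ
  obtain ⟨c1, c2, c3, c4⟩ := blk_eq (γ * δ)
  fin_cases r <;> fin_cases s <;> simp only [Fin.zero_eta, Fin.mk_one, Fin.isValue, a1, a2, a3, a4, b1, b2, b3, b4, c1, c2, c3, c4] <;>
    ext i j <;> fin_cases i <;> fin_cases j <;> simp [Matrix.mul_apply, Fin.sum_univ_four] <;> ring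

def num (γ : M4) (τ : Fin 2 → Fin 2 → ℂ) : Matrix (Fin 2) (Fin 2) ℂ := blk γ 0 0 * Matrix.of τ + blk γ 0 1

lemma moeb_num (γ : M4) (τ : Fin 2 → Fin 2 → ℂ) : Matrix.of (moeb γ τ) = num γ τ * (den γ τ)⁻¹ := rfl

lemma moeb_of {γ : M4} {τ X : Fin 2 → Fin 2 → ℂ} (hd : (den γ τ).det ≠ 0) (h : num γ τ = Matrix.of X * den γ τ) :
    moeb γ τ = X := by
  have : Matrix.of (moeb γ τ) = Matrix.of X := by
    rw [moeb_num, h, Matrix.mul_assoc, Matrix.mul_nonsing_inv _ (isUnit_iff_ne_zero.2 hd), Matrix.mul_one]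
  exact this

lemma num_eq {γ : M4} {τ : Fin 2 → Fin 2 → ℂ} (hd : (den γ τ).det ≠ 0) : num γ τ = Matrix.of (moeb γ τ) * den γ τ := by
  rw [moeb_num, Matrix.mul_assoc, Matrix.nonsing_inv_mul _ (isUnit_iff_ne_zero.2 hd), Matrix.mul_one]

lemma den_mul {γ δ : M4} {τ : Fin 2 → Fin 2 → ℂ} (hd : (den δ τ).det ≠ 0) :
    den (γ * δ) τ = den γ (moeb δ τ) * den δ τ := by
  have h : (blk γ 1 0 * Matrix.of (moeb δ τ) + blk γ 1 1) * den δ τ = blk γ 1 0 * num δ τ + blk γ 1 1 * den δ τ := by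
    rw [num_eq hd]; noncomm_ring
  rw [den, blk_mul, blk_mul, den, h, num, den]
  noncomm_ring

lemma moeb_mul {γ δ : M4} {τ : Fin 2 → Fin 2 → ℂ} (hd : (den δ τ).det ≠ 0) (hd' : (den γ (moeb δ τ)).det ≠ 0) :
    moeb (γ * δ) τ = moeb γ (moeb δ τ) := by
  have h : (blk γ 0 0 * Matrix.of (moeb δ τ) + blk γ 0 1) * den δ τ = blk γ 0 0 * num δ τ + blk γ 0 1 * den δ τ := by
    rw [num_eq hd]; noncomm_ring
  have h' := num_eq hd'
  apply moeb_of
  · rw [den_mul hd, det_mul]; exact mul_ne_zero hd' hd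
  · rw [den_mul hd, ← Matrix.mul_assoc, ← h', num, num, blk_mul, blk_mul, h, num, den]
    noncomm_ring

/-- evaluation of binary forms -/
def ev (v : Fin 13 → ℂ) (s t : ℂ) : ℂ := ∑ l : Fin 13, v l * (s ^ (12 - (l : ℕ)) * t ^ (l : ℕ))

def evp (v : Fin 13 → ℂ) : Polynomial ℂ := ∑ l : Fin 13, Polynomial.C (v l) * Polynomial.X ^ (l : ℕ)

lemma evp_coeff (v : Fin 13 → ℂ) (i : Fin 13) : (evp v).coeff i = v i := by
  simp only [evp, Polynomial.finsetSum_coeff, Polynomial.coeff_C_mul, Polynomial.coeff_X_pow]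
  rw [Finset.sum_eq_single i]
  · simp
  · intro l _ hl; rw [if_neg (fun h => hl (Fin.ext h.symm)), mul_zero]
  · simp

lemma ev_inj {v w : Fin 13 → ℂ} (h : ∀ t, ev v 1 t = ev w 1 t) : v = w := by
  have : evp v = evp w := Polynomial.funext fun t => by
    simpa [evp, ev, Polynomial.eval_finsetSum] using h t
  ext i; rw [← evp_coeff v, this, evp_coeff]

lemma ev_symAct (m : Matrix (Fin 2) (Fin 2) ℂ) (v : Fin 13 → ℂ) (t : ℂ) :
    ev (symAct 12 m v) 1 t = ev v (m 0 0 + m 1 0 * t) (m 0 1 + m 1 1 * t) := by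
  simp only [ev, symAct, Finset.sum_mul, one_pow, one_mul]
  rw [Finset.sum_comm]
  refine Finset.sum_congr rfl fun l _ => ?_
  have hdeg : ((Polynomial.C (m 0 0) + Polynomial.C (m 1 0) * Polynomial.X) ^ (12 - (l : ℕ)) *
    (Polynomial.C (m 0 1) + Polynomial.C (m 1 1) * Polynomial.X) ^ (l : ℕ)).natDegree < 13 := by
    have h1 : ∀ x y : ℂ, (Polynomial.C x + Polynomial.C y * Polynomial.X).natDegree ≤ 1 := fun x y => by
      rw [add_comm]; exact Polynomial.natDegree_linear_le
    have h2 := Polynomial.natDegree_pow_le_of_le (12 - (l : ℕ)) (h1 (m 0 0) (m 1 0))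
    have h3 := Polynomial.natDegree_pow_le_of_le (l : ℕ) (h1 (m 0 1) (m 1 1))
    have h4 := Polynomial.natDegree_mul_le_of_le h2 h3
    have := l.isLt
    omega
  have := Polynomial.eval_eq_sum_range' hdeg t
  rw [← Fin.sum_univ_eq_sum_range (fun i => Polynomial.coeff _ i * t ^ i) 13] at this
  simp only [Polynomial.eval_mul, Polynomial.eval_pow, Polynomial.eval_add, Polynomial.eval_C, Polynomial.eval_X] at this
  rw [this, Finset.mul_sum]
  refine Finset.sum_congr rfl fun i _ => ?_
  rw [symCoeff]; ring

lemma ev_hom (v : Fin 13 → ℂ) (c s t : ℂ) : ev v (c * s) (c * t) = c ^ 12 * ev v s t := by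
  simp only [ev, Finset.mul_sum]
  refine Finset.sum_congr rfl fun l _ => ?_
  have : c ^ 12 = c ^ (12 - (l:ℕ)) * c ^ (l:ℕ) := by rw [← pow_add]; congr 1; have := l.isLt; omega
  rw [this]; ring

lemma ev_cont (v : Fin 13 → ℂ) {p q : ℂ → ℂ} (hp : Continuous p) (hq : Continuous q) : Continuous fun s => ev v (p s) (q s) := by
  unfold ev; fun_prop

lemma ev_symAct' (m : Matrix (Fin 2) (Fin 2) ℂ) (v : Fin 13 → ℂ) (s t : ℂ) :
    ev (symAct 12 m v) s t = ev v (m 0 0 * s + m 1 0 * t) (m 0 1 * s + m 1 1 * t) := by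
  have h : ∀ s : ℂ, s ≠ 0 → ev (symAct 12 m v) s t = ev v (m 0 0 * s + m 1 0 * t) (m 0 1 * s + m 1 1 * t) := by
    intro s hs
    have h1 := ev_hom (symAct 12 m v) s 1 (t / s)
    rw [mul_one, mul_div_cancel₀ _ hs, ev_symAct, ← ev_hom] at h1
    rw [h1]; congr 1 <;> field_simp
  by_cases hs : s = 0
  · subst hs
    have c1 := ev_cont (symAct 12 m v) (p := fun s => s) (q := fun _ => t) continuous_id continuous_const
    have c2 := ev_cont v (p := fun s => m 0 0 * s + m 1 0 * t) (q := fun s => m 0 1 * s + m 1 1 * t) (by fun_prop) (by fun_prop)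
    exact congrFun (c1.ext_on (dense_compl_singleton (0:ℂ)) c2 (fun s hs => h s hs)) 0
  · exact h s hs

lemma symAct_mul (m n : Matrix (Fin 2) (Fin 2) ℂ) (v : Fin 13 → ℂ) :
    symAct 12 (m * n) v = symAct 12 m (symAct 12 n v) := by
  apply ev_inj; intro t
  rw [ev_symAct, ev_symAct, ev_symAct']
  simp only [Matrix.mul_apply, Fin.sum_univ_two]
  congr 1 <;> ring

lemma symAct_one (v : Fin 13 → ℂ) : symAct 12 1 v = v := by
  apply ev_inj; intro t; rw [ev_symAct]; simp

lemma wt_mul (m n : Matrix (Fin 2) (Fin 2) ℂ) (v : Fin 13 → ℂ) : wt 12 2 (m * n) v = wt 12 2 m (wt 12 2 n v) := by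
  simp only [wt, symAct_smul, symAct_mul, det_mul, mul_zpow, smul_smul]

lemma slash_eq {γ : M4} {F : (Fin 2 → Fin 2 → ℂ) → (Fin 13 → ℂ)} {τ : Fin 2 → Fin 2 → ℂ} {e : ℂ}
    (hd : (den γ τ).det ≠ 0) (h : F (moeb γ τ) = e • wt 12 2 (den γ τ) (F τ)) : slashS 12 2 γ F τ = e • F τ := by
  rw [slashS, h, wt, symAct_smul, symAct_smul, ← symAct_mul, Matrix.nonsing_inv_mul _ (isUnit_iff_ne_zero.2 hd), symAct_one,
    smul_smul, smul_smul]
  congr 1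
  rw [mul_right_comm, ← zpow_add₀ hd]; simp

end

section
def fF (F : (Fin 2 → Fin 2 → ℂ) → (Fin 13 → ℂ)) (l : ℕ) (a z b : ℂ) : ℂ :=
  if h : l < 13 then F (mkH a z b) ⟨l, h⟩ else 0

lemma fF_fin (F : (Fin 2 → Fin 2 → ℂ) → (Fin 13 → ℂ)) (l : Fin 13) (a z b : ℂ) : fF F l a z b = F (mkH a z b) l := by
  rw [fF, dif_pos l.isLt]

lemma fF_sum (F : (Fin 2 → Fin 2 → ℂ) → (Fin 13 → ℂ)) (c : ℕ → ℂ) (a z b : ℂ) :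
    ∑ l ∈ Finset.range 13, c l * fF F l a z b = ∑ l : Fin 13, c l * F (mkH a z b) l := by
  rw [Finset.sum_range]; exact Finset.sum_congr rfl fun l _ => by rw [fF_fin]

lemma symCoeff_up (a z : ℂ) (l i : Fin 13) : symCoeff 12 !![a, z; 0, 1] l i =
    a ^ (12 - (l : ℕ)) * z ^ ((l : ℕ) - i) * ((l : ℕ).choose i : ℂ) := by
  rw [symCoeff]
  simp only [Matrix.of_apply, Matrix.cons_val', Matrix.cons_val_zero, Matrix.cons_val_one, Matrix.cons_val_fin_one,
    map_zero, zero_mul, add_zero, map_one, one_mul]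
  rw [← Polynomial.C_pow, Polynomial.coeff_C_mul, add_comm (Polynomial.C z), Polynomial.coeff_X_add_C_pow]; ring

lemma symAct_D (v : Fin 13 → ℂ) : symAct 12 !![1, 0; 0, -1] v = fun l : Fin 13 => (-1) ^ (l : ℕ) * v l := by
  apply ev_inj; intro t; rw [ev_symAct]
  simp only [ev]
  refine Finset.sum_congr rfl fun l _ => ?_
  simp [neg_pow t]; ring

lemma symAct_W (v : Fin 13 → ℂ) : symAct 12 !![0, 1; 1, 0] v = fun l => v (Fin.rev l) := by
  apply ev_inj; intro t; rw [ev_symAct]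
  simp only [ev]
  rw [← Equiv.sum_comp Fin.revPerm]
  refine Finset.sum_congr rfl fun l _ => ?_
  have : 12 - (12 - (l:ℕ)) = l := by have := l.isLt; omega
  simp [Fin.val_rev, this]

structure Good (ε : M4 → ℂ) (F : (Fin 2 → Fin 2 → ℂ) → (Fin 13 → ℂ)) : Prop where
  d : DifferentiableOn ℂ F H2
  l : ∀ γ ∈ Sp4Z, ∀ τ ∈ H2, F (moeb γ τ) = ε γ • wt 12 2 (den γ τ) (F τ)

lemma den_e1 (p q r s : ℤ) (a z b : ℂ) : den (e1 p q r s) (mkH a z b) = !![r * a + s, r * z; 0, 1] := by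
  rw [den, (blk_eq _).2.2.1, (blk_eq _).2.2.2]
  ext i j; fin_cases i <;> fin_cases j <;> simp [e1, mkH]
lemma num_e1 (p q r s : ℤ) (a z b : ℂ) : num (e1 p q r s) (mkH a z b) = !![p * a + q, p * z; z, b] := by
  rw [num, (blk_eq _).1, (blk_eq _).2.1]
  ext i j; fin_cases i <;> fin_cases j <;> simp [e1, mkH]
lemma den_e2 (p q r s : ℤ) (a z b : ℂ) : den (e2 p q r s) (mkH a z b) = !![1, 0; r * z, r * b + s] := by
  rw [den, (blk_eq _).2.2.1, (blk_eq _).2.2.2]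
  ext i j; fin_cases i <;> fin_cases j <;> simp [e2, mkH]
lemma num_e2 (p q r s : ℤ) (a z b : ℂ) : num (e2 p q r s) (mkH a z b) = !![a, z; p * z, p * b + q] := by
  rw [num, (blk_eq _).1, (blk_eq _).2.1]
  ext i j; fin_cases i <;> fin_cases j <;> simp [e2, mkH]
lemma den_lv (p q r s : ℤ) (a z b : ℂ) : den (lv p q r s) (mkH a z b) = !![(s : ℂ), -r; -q, p] := by
  rw [den, (blk_eq _).2.2.1, (blk_eq _).2.2.2]
  ext i j; fin_cases i <;> fin_cases j <;> simp [lv, mkH]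
lemma num_lv (p q r s : ℤ) (a z b : ℂ) : num (lv p q r s) (mkH a z b) = !![p * a + q * z, p * z + q * b; r * a + s * z, r * z + s * b] := by
  rw [num, (blk_eq _).1, (blk_eq _).2.1]
  ext i j; fin_cases i <;> fin_cases j <;> simp [lv, mkH]
lemma den_hs (q r : ℤ) (a z b : ℂ) : den (hs q r) (mkH a z b) = !![1, 0; 0, 1] := by
  rw [den, (blk_eq _).2.2.1, (blk_eq _).2.2.2]
  ext i j; fin_cases i <;> fin_cases j <;> simp [hs, mkH]
lemma num_hs (q r : ℤ) (a z b : ℂ) : num (hs q r) (mkH a z b) = !![a + r, z + q; z + q, b] := by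
  rw [num, (blk_eq _).1, (blk_eq _).2.1]
  ext i j; fin_cases i <;> fin_cases j <;> simp [hs, mkH]

lemma law_use {γ : M4} {F : (Fin 2 → Fin 2 → ℂ) → (Fin 13 → ℂ)} {e a z b a' z' b' : ℂ} {m : Matrix (Fin 2) (Fin 2) ℂ}
    (h : F (moeb γ (mkH a z b)) = e • wt 12 2 (den γ (mkH a z b)) (F (mkH a z b)))
    (hden : den γ (mkH a z b) = m) (hdet : m.det ≠ 0) (hnum : num γ (mkH a z b) = !![a', z'; z', b'] * m) :
    F (mkH a' z' b') = (e * m.det ^ 2) • symAct 12 m (F (mkH a z b)) := by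
  have hm : moeb γ (mkH a z b) = mkH a' z' b' := moeb_of (by rwa [hden]) (by rw [hden, hnum]; rfl)
  rw [hm, hden, wt, smul_smul] at h
  exact_mod_cast h

lemma den_w (a z b : ℂ) : den (lv 0 (-1) 1 0 * e2 (-1) 0 0 (-1)) (mkH a z b) = !![0, 1; 1, 0] := by
  rw [show lv 0 (-1) 1 0 * e2 (-1) 0 0 (-1) = !![0,1,0,0;1,0,0,0;0,0,0,1;0,0,1,0] by decide +kernel, den, (blk_eq _).2.2.1, (blk_eq _).2.2.2]
  ext i j; fin_cases i <;> fin_cases j <;> simp [mkH]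
lemma num_w (a z b : ℂ) : num (lv 0 (-1) 1 0 * e2 (-1) 0 0 (-1)) (mkH a z b) = !![z, b; a, z] := by
  rw [show lv 0 (-1) 1 0 * e2 (-1) 0 0 (-1) = !![0,1,0,0;1,0,0,0;0,0,0,1;0,0,1,0] by decide +kernel, num, (blk_eq _).1, (blk_eq _).2.1]
  ext i j; fin_cases i <;> fin_cases j <;> simp [mkH]

lemma mat1 : !![(1:ℂ), 0; 0, 1] = 1 := by ext i j; fin_cases i <;> fin_cases j <;> rfl

lemma fF_of {F : (Fin 2 → Fin 2 → ℂ) → (Fin 13 → ℂ)} {a z b a' z' b' c : ℂ} (h : F (mkH a' z' b') = c • F (mkH a z b)) (l : ℕ) :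
    fF F l a' z' b' = c * fF F l a z b := by
  unfold fF; split_ifs
  · rw [h]; rfl
  · simp

theorem Good.dat {ε : M4 → ℂ} {F : (Fin 2 → Fin 2 → ℂ) → (Fin 13 → ℂ)} (hε : EpsVals ε) (hF : Good ε F) : Dat (fF F) where
  H := by
    intro l
    unfold fF
    split_ifs with h
    · have h1 : DifferentiableOn ℂ (fun p : ℂ × ℂ × ℂ => F (mkH p.1 p.2.1 p.2.2)) Dom := by
        refine hF.d.comp (t := H2) (f := fun p : ℂ × ℂ × ℂ => mkH p.1 p.2.1 p.2.2) ?_ (fun p hp => mk_mem.2 hp)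
        apply Differentiable.differentiableOn
        rw [differentiable_pi]; intro i; rw [differentiable_pi]; intro j
        fin_cases i <;> fin_cases j <;> simp [mkH]
      exact differentiableOn_pi.1 h1 ⟨l, h⟩
    · exact differentiableOn_const 0
  T1 := by
    intro l a z b hd
    have := law_use (a' := a + 1) (z' := z) (b' := b) (hF.l _ (e1_Sp (by norm_num)) _ (mk_mem.2 hd)) (den_e1 1 1 0 1 a z b) (by simp)
      (by rw [num_e1]; simp)
    rw [hε.t1, show !![((0:ℤ):ℂ) * a + (1:ℤ), (0:ℤ) * z; 0, 1] = 1 by rw [← mat1]; simp, symAct_one] at this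
    rw [fF_of this]; simp
  T2 := by
    intro l a z b hd
    have := law_use (a' := a) (z' := z) (b' := b + 1) (hF.l _ (e2_Sp (by norm_num)) _ (mk_mem.2 hd)) (den_e2 1 1 0 1 a z b) (by simp)
      (by rw [num_e2]; simp)
    rw [hε.t2, show !![1, 0; ((0:ℤ):ℂ) * z, (0:ℤ) * b + (1:ℤ)] = 1 by rw [← mat1]; simp, symAct_one] at this
    rw [fF_of this]; simp
  T12 := by
    intro l a z b hd
    have := law_use (a' := a) (z' := z + 1) (b' := b) (hF.l _ (hs_Sp 1 0) _ (mk_mem.2 hd)) (den_hs 1 0 a z b) (by simp)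
      (by rw [num_hs]; simp)
    rw [hε.t12, mat1, symAct_one] at this
    rw [fF_of this]; simp
  W := by
    intro l a z b hd hl
    have := law_use (a' := b) (z' := z) (b' := a) (hF.l _ (mul_Sp (lv_Sp (by norm_num)) (e2_Sp (by norm_num))) _ (mk_mem.2 hd)) (den_w a z b) (by simp)
      (by rw [num_w]; simp)
    rw [hε.w, symAct_W] at this
    have h1 : l < 13 := by omega
    have h2 : 12 - l < 13 := by omega
    rw [fF, fF, dif_pos h1, dif_pos h2, this]
    simp [Fin.rev]
  D := by
    intro l a z b hd
    have := law_use (a' := a) (z' := -z) (b' := b) (hF.l _ (e2_Sp (by norm_num)) _ (mk_mem.2 hd)) (den_e2 (-1) 0 0 (-1) a z b) (by simp)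
      (by rw [num_e2]; simp)
    rw [hε.d, show !![1, 0; ((0:ℤ):ℂ) * z, (0:ℤ) * b + (-1:ℤ)] = !![1, 0; 0, -1] by simp, symAct_D] at this
    unfold fF; split_ifs
    · rw [this]; simp
    · simp
  U := by
    intro i a z b hd
    have := law_use (a' := a) (z' := z + a) (b' := b + 2 * z + a) (hF.l _ (lv_Sp (by norm_num)) _ (mk_mem.2 hd)) (den_lv 1 0 1 1 a z b) (by simp)
      (by rw [num_lv]; simp; constructor <;> ring)
    rw [hε.u, show !![((1:ℤ):ℂ), -(1:ℤ); -(0:ℤ), (1:ℤ)] = !![1, -1; 0, 1] by simp] at this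
    rw [fF_sum (c := fun l => (-1)^(l-i)*(l.choose i:ℂ))]
    rw [fF]; split_ifs with hi
    · rw [this]
      simp only [Pi.smul_apply, symAct, symCoeff_up]; simp
    · symm; rw [neg_eq_zero]; apply Finset.sum_eq_zero; intro l _
      rw [Nat.choose_eq_zero_of_lt (by have := l.isLt; omega)]; simp
  S := by
    intro i a z b hd
    have ha : a ≠ 0 := by rintro rfl; simpa using hd.1
    have := law_use (a' := -1 / a) (z' := z / a) (b' := b - z ^ 2 / a) (hF.l _ (e1_Sp (by norm_num)) _ (mk_mem.2 hd)) (den_e1 0 (-1) 1 0 a z b) (by simpa using ha)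
      (by rw [num_e1]; simp; refine ⟨⟨?_, ?_⟩, ?_, ?_⟩ <;> field_simp <;> ring)
    rw [hε.j1, show !![((1:ℤ):ℂ) * a + (0:ℤ), (1:ℤ) * z; 0, 1] = !![a, z; 0, 1] by simp] at this
    rw [fF_sum (c := fun l => a^(12-l)*z^(l-i)*(l.choose i:ℂ))]
    rw [fF]; split_ifs with hi
    · rw [this]
      simp only [Pi.smul_apply, symAct, symCoeff_up]; simp
    · symm; rw [neg_mul, neg_eq_zero]; apply mul_eq_zero_of_right; apply Finset.sum_eq_zero; intro l _
      rw [Nat.choose_eq_zero_of_lt (by have := l.isLt; omega)]; simp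

end

section
lemma coef_lin {c : ℝ} {g g' : ℂ → ℂ} (h : PerHol c g) (h' : PerHol c g') {v : ℝ} (hv : c < v) (n : ℤ) (x y : ℂ) :
    coef (fun t => x * g t + y * g' t) n v = x * coef g n v + y * coef g' n v := by
  have c1 : Continuous fun u : ℝ => g (u + v * I) := h.line_cont hv
  have c2 : Continuous fun u : ℝ => g' (u + v * I) := h'.line_cont hv
  have c3 : Continuous fun u : ℝ => ee (-(n * (u + v * I))) := ee_cont.comp (by fun_prop)
  rw [coef, coef, coef, ← intervalIntegral.integral_const_mul, ← intervalIntegral.integral_const_mul,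
    ← intervalIntegral.integral_add (Continuous.intervalIntegrable (u := fun u : ℝ => x * (g (u + v * I) * ee (-(n * (u + v * I))))) (by exact continuous_const.mul (c1.mul c3)) _ _) (Continuous.intervalIntegrable (u := fun u : ℝ => y * (g' (u + v * I) * ee (-(n * (u + v * I))))) (by exact continuous_const.mul (c2.mul c3)) _ _)]
  refine intervalIntegral.integral_congr fun u _ => ?_
  show (x * g _ + y * g' _) * _ = _
  ring

lemma dc_lin {f g : ℕ → ℂ → ℂ → ℂ → ℂ} (hf : Dat f) (hg : Dat g) (x y : ℂ) :
    dc (fun l a z b => x * f l a z b + y * g l a z b) 0 0 8 0 = x * dc f 0 0 8 0 + y * dc g 0 0 8 0 := by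
  have hv : (0:ℝ) < |(0:ℂ).im| + 1 := by positivity
  have h1 : ∀ a : ℂ, 0 < a.im → phi (fun l a z b => x * f l a z b + y * g l a z b) 0 8 a 0 = x * phi f 0 8 a 0 + y * phi g 0 8 a 0 := by
    intro a ha
    rw [phi, phi, phi, ← coef_lin (hf.per 8 ha) (hg.per 8 ha) (by linarith)]
    congr 1; funext b; ring
  rw [dc, dc, dc, ← coef_lin (hf.phi_per 0 8 0) (hg.phi_per 0 8 0) hv, coef, coef]
  refine intervalIntegral.integral_congr fun u _ => ?_
  show phi _ 0 8 _ 0 * _ * _ = _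
  rw [h1 _ (by show (0:ℝ) < Complex.im _; simp)]; ring

lemma fF_lin (F G : (Fin 2 → Fin 2 → ℂ) → (Fin 13 → ℂ)) (x y : ℂ) :
    fF (x • F + y • G) = fun l a z b => x * fF F l a z b + y * fF G l a z b := by
  funext l a z b; unfold fF; split_ifs <;> simp

lemma cusp_good {ε : M4 → ℂ} {F : (Fin 2 → Fin 2 → ℂ) → (Fin 13 → ℂ)} (h : F ∈ SiegelCusp 12 2 Sp4Z ε) : Good ε F :=
  ⟨h.1, h.2.1⟩

lemma cusp_zero {ε : M4 → ℂ} (hε : EpsVals ε) {F : (Fin 2 → Fin 2 → ℂ) → (Fin 13 → ℂ)} (h : F ∈ SiegelCusp 12 2 Sp4Z ε)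
    (h8 : dc (fF F) 0 0 8 0 = 0) : F = 0 := by
  funext τ
  by_cases hτ : τ ∈ H2
  · funext l
    have h1 := H2_mk hτ
    rw [h1] at hτ ⊢
    rw [← fF_fin F l]
    exact ((cusp_good h).dat hε).zero h8 (by have := l.isLt; omega) (mk_mem.1 hτ)
  · exact h.2.2.2 τ hτ

theorem finrank_one {ε : M4 → ℂ} (hε : EpsVals ε) {F : (Fin 2 → Fin 2 → ℂ) → (Fin 13 → ℂ)} (h : F ∈ SiegelCusp 12 2 Sp4Z ε)
    (hF : F ≠ 0) : Module.finrank ℂ (SiegelCusp 12 2 Sp4Z ε) = 1 := by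
  have h8 : dc (fF F) 0 0 8 0 ≠ 0 := fun h8 => hF (cusp_zero hε h h8)
  rw [finrank_eq_one_iff_of_nonzero' (⟨F, h⟩ : SiegelCusp 12 2 Sp4Z ε) (fun h0 => hF (congrArg Subtype.val h0))]
  rintro ⟨G, hG⟩
  refine ⟨dc (fF G) 0 0 8 0 / dc (fF F) 0 0 8 0, Subtype.ext ?_⟩
  set c := dc (fF G) 0 0 8 0 / dc (fF F) 0 0 8 0 with hc
  have hmem : c • F + (-1:ℂ) • G ∈ SiegelCusp 12 2 Sp4Z ε :=
    Submodule.add_mem _ (Submodule.smul_mem _ _ h) (Submodule.smul_mem _ _ hG)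
  have := cusp_zero hε hmem (by
    rw [fF_lin, dc_lin ((cusp_good h).dat hε) ((cusp_good hG).dat hε), hc, div_mul_cancel₀ _ h8]; ring)
  show c • F = G
  rw [neg_one_smul, ← sub_eq_add_neg] at this
  exact sub_eq_zero.1 this

/-- the group preserves the half space -/
lemma H2_pres (γ : M4) (hγ : γ ∈ Sp4Z) : ∀ τ ∈ H2, (den γ τ).det ≠ 0 ∧ moeb γ τ ∈ H2 := by
  have mk' : ∀ γ : M4, (∀ a z b, (a, z, b) ∈ Dom → (den γ (mkH a z b)).det ≠ 0 ∧ ∃ a' z' b',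
      num γ (mkH a z b) = !![a', z'; z', b'] * den γ (mkH a z b) ∧ (a', z', b') ∈ Dom) →
      ∀ τ ∈ H2, (den γ τ).det ≠ 0 ∧ moeb γ τ ∈ H2 := by
    intro γ h τ hτ
    have h1 := H2_mk hτ
    rw [h1] at hτ ⊢
    obtain ⟨h2, a', z', b', h3, h4⟩ := h _ _ _ (mk_mem.1 hτ)
    refine ⟨h2, ?_⟩
    rw [moeb_of (X := mkH a' z' b') h2 h3]
    exact mk_mem.2 h4
  refine sp_gen (fun γ => ∀ τ ∈ H2, (den γ τ).det ≠ 0 ∧ moeb γ τ ∈ H2) ?_ ?_ ?_ ?_ ?_ γ hγ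
  · intro x _ y _ hx hy τ hτ
    have h1 := hy τ hτ
    have h2 := hx _ h1.2
    refine ⟨by rw [den_mul h1.1, det_mul]; exact mul_ne_zero h2.1 h1.1, ?_⟩
    rw [moeb_mul h1.1 h2.1]; exact h2.2
  · refine mk' _ fun a z b h => ?_
    rw [den_e1, num_e1]
    refine ⟨by simp, a + 1, z, b, by simp, ?_⟩
    exact ⟨by simpa using h.1, by simpa using h.2⟩
  · refine mk' _ fun a z b h => ?_
    have ha : a ≠ 0 := by rintro rfl; simpa using h.1
    rw [den_e1, num_e1]
    refine ⟨by simpa using ha, -1 / a, z / a, b - z ^ 2 / a, by simp; refine ⟨⟨?_, ?_⟩, ?_, ?_⟩ <;> field_simp <;> ring, ?_⟩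
    have := Dom_hc h
    have h3 := im_S h.1
    refine mem_Dom h3 ?_
    rw [hc_S z h.1]
    simpa using this
  · refine mk' _ fun a z b h => ?_
    rw [den_lv, num_lv]
    refine ⟨by simp, a + 2 * z + b, z + b, b, by simp; ring, ?_⟩
    obtain ⟨h1, h2⟩ := h
    simp only at h1 h2
    have hb : 0 < b.im := by
      by_contra hb
      nlinarith [sq_nonneg z.im]
    refine ⟨?_, ?_⟩
    · simp only [add_im, mul_im, re_ofNat, im_ofNat]
      have : 0 < b.im * (a.im + (2 * z.im + 0 * z.re) + b.im) := by nlinarith [sq_nonneg (z.im + b.im)]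
      exact (mul_pos_iff_of_pos_left hb).1 this
    · simp only [add_im, mul_im, re_ofNat, im_ofNat]
      nlinarith
  · refine mk' _ fun a z b h => ?_
    rw [den_lv, num_lv]
    refine ⟨by simp, b, -z, a, by simp, ?_⟩
    obtain ⟨h1, h2⟩ := h
    simp only at h1 h2
    have hb : 0 < b.im := by
      by_contra hb
      nlinarith [sq_nonneg z.im]
    exact ⟨hb, by simp; linarith⟩

lemma diagH_eq (a b : ℂ) : diagH a b = mkH a 0 b := by
  ext i j; fin_cases i <;> fin_cases j <;> simp [diagH, mkH]

theorem Good.cusp {ε : M4 → ℂ} {F : (Fin 2 → Fin 2 → ℂ) → (Fin 13 → ℂ)} (hε : EpsVals ε) (hF : Good ε F)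
    (hz : ∀ τ, τ ∉ H2 → F τ = 0) : F ∈ SiegelCusp 12 2 Sp4Z ε := by
  refine ⟨hF.d, hF.l, ?_, hz⟩
  intro γ hγ a ha
  have hD := hF.dat hε
  have hdom : ∀ t : ℝ, 0 < t → (a, (0:ℂ), (t * I : ℂ)) ∈ Dom := fun t ht => ⟨ha, by simpa using mul_pos ha ht⟩
  have h1 : Tendsto (fun t : ℝ => F (mkH a 0 (t * I))) atTop (𝓝 0) := by
    rw [tendsto_pi_nhds]; intro l
    have hl : (l:ℕ) ≤ 12 := by have := l.isLt; omega
    have hper := hD.per l (z := 0) ha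
    have hc0 : hc a 0 = 0 := by simp [hc]
    rw [hc0] at hper
    obtain ⟨C, -, hC⟩ := hper.line_bdd (v := 1) (by norm_num)
    have hdec := hper.decay (v := 1) (by norm_num) 0 (fun n hn => by
      rw [← hD.phi_eq n l ha (by rw [hc0]; norm_num)]; exact hD.koe hn ha hl 0) (y1 := 1) (by norm_num) hC
    have hbd : ∀ t : ℝ, 2 ≤ t → ‖F (mkH a 0 (t * I)) l‖ ≤ 2 * C * Real.exp (-(Real.pi * t)) := by
      intro t ht
      have := hdec (t * I) (by simp; linarith)
      rw [norm_mul, norm_ee, fF_fin] at this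
      simp at this
      have e1 : Real.exp (-(2 * Real.pi * (-t / 2))) * Real.exp (-(Real.pi * t)) = 1 := by
        rw [← Real.exp_add, ← Real.exp_zero]; congr 1; ring
      calc ‖F (mkH a 0 (t * I)) l‖ = ‖F (mkH a 0 (t * I)) l‖ * Real.exp (-(2 * Real.pi * (-t / 2))) * Real.exp (-(Real.pi * t)) := by
            rw [mul_assoc, e1, mul_one]
        _ ≤ _ := by
          refine mul_le_mul_of_nonneg_right ?_ (Real.exp_pos _).le
          rw [show -(2 * Real.pi * (-t / 2)) = 2 * Real.pi * (t / 2) by ring]; exact this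
    refine squeeze_zero_norm' ((eventually_ge_atTop 2).mono hbd) ?_
    have : Tendsto (fun t : ℝ => Real.exp (-(Real.pi * t))) atTop (𝓝 0) :=
      Real.tendsto_exp_neg_atTop_nhds_zero.comp (tendsto_id.const_mul_atTop Real.pi_pos)
    simpa using this.const_mul (2 * C)
  have h2 := h1.const_smul (ε γ)
  rw [smul_zero] at h2
  refine h2.congr' ((eventually_gt_atTop 0).mono fun t ht => ?_)
  have hm := mk_mem.2 (hdom t ht)
  show _ = slashS 12 2 γ F (diagH a (t * I))
  rw [diagH_eq]
  exact (slash_eq (H2_pres γ hγ _ hm).1 (hF.l γ hγ _ hm)).symm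

end

section
def hx (a n : ℤ) : ℝ := n + a / 2

lemma sum1 {d : ℝ} (hd : 0 < d) (R : ℝ) (a : ℤ) :
    Summable fun n : ℤ => Real.exp (-d * hx a n ^ 2 + R * |hx a n|) := by
  have h0 : Summable fun n : ℤ => Real.exp (-|(n : ℝ)|) := by
    have : Summable fun n : ℕ => Real.exp (-(n : ℝ)) := Real.summable_exp_neg_nat
    refine Summable.of_nat_of_neg ?_ ?_ <;> simpa using this
  refine Summable.of_nonneg_of_le (fun _ => (Real.exp_pos _).le) (fun n => ?_)
    (h0.mul_left (Real.exp ((R + 1) ^ 2 / (4 * d) + |(a : ℝ) / 2|)))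
  rw [← Real.exp_add, Real.exp_le_exp]
  have h1 : |(n : ℝ)| ≤ |hx a n| + |(a : ℝ) / 2| := by
    have := abs_sub (hx a n) ((a : ℝ) / 2)
    simpa [hx] using this
  have h2 : -d * hx a n ^ 2 + (R + 1) * |hx a n| ≤ (R + 1) ^ 2 / (4 * d) := by
    rw [le_div_iff₀ (by positivity), ← sq_abs (hx a n)]
    nlinarith [sq_nonneg (2 * d * |hx a n| - (R + 1))]
  linarith

abbrev K2 := ℤ × ℤ
abbrev L8 := (K2 × K2) × (K2 × K2)

/-- sums over the four components -/
def s4 (g : K2 → ℝ) (N : L8) : ℝ := (g N.1.1 + g N.1.2) + (g N.2.1 + g N.2.2)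

def qS (a c : ℤ) (n : K2) : ℝ := hx a n.1 ^ 2 + hx c n.2 ^ 2
def qT (a c : ℤ) (n : K2) : ℝ := |hx a n.1| + |hx c n.2|

def GN (d R : ℝ) (a c : ℤ) (N : L8) : ℝ := Real.exp (-d * s4 (qS a c) N + R * s4 (qT a c) N)

lemma sum2 {d : ℝ} (hd : 0 < d) (R : ℝ) (a c : ℤ) :
    Summable fun n : K2 => Real.exp (-d * qS a c n + R * qT a c n) := by
  refine ((sum1 hd R a).mul_of_nonneg (sum1 hd R c) (fun _ => (Real.exp_pos _).le)
    (fun _ => (Real.exp_pos _).le)).congr fun n => ?_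
  rw [← Real.exp_add]; congr 1; unfold qS qT; ring

lemma sumN {d : ℝ} (hd : 0 < d) (R : ℝ) (a c : ℤ) : Summable (GN d R a c) := by
  have h := sum2 hd R a c
  have p : ∀ n : K2, 0 ≤ Real.exp (-d * qS a c n + R * qT a c n) := fun _ => (Real.exp_pos _).le
  have h2 := h.mul_of_nonneg h p p
  refine (h2.mul_of_nonneg h2 (fun n => mul_nonneg (p _) (p _)) (fun n => mul_nonneg (p _) (p _))).congr
    fun n => ?_
  simp only [← Real.exp_add]; unfold GN; congr 1; unfold s4; ring

/-- theta term -/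
def TE (a b c e : ℤ) (p : ℂ × ℂ × ℂ) (s t : ℂ) (n : K2) : ℂ :=
  cexp (Real.pi * I * (p.1 * (hx a n.1 : ℂ) ^ 2 + 2 * p.2.1 * hx a n.1 * hx c n.2 + p.2.2 * (hx c n.2 : ℂ) ^ 2
    + b * hx a n.1 + e * hx c n.2 + 2 * (hx a n.1 * s + hx c n.2 * t)))

def cA (a : ℤ) (N : L8) (pr : K2 → ℤ) : ℂ :=
  hx a (pr N.1.1) + 2 * hx a (pr N.1.2) + 2 * hx a (pr N.2.1) + 3 * I * hx a (pr N.2.2)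

def AA (a : ℤ) (N : L8) : ℂ := cA a N Prod.fst
def BB (c : ℤ) (N : L8) : ℂ := cA c N Prod.snd

def WW (a b c e : ℤ) (p : ℂ × ℂ × ℂ) (N : L8) : ℂ :=
  (TE a b c e p 0 0 N.1.1 * TE a b c e p 0 0 N.1.2) * (TE a b c e p 0 0 N.2.1 * TE a b c e p 0 0 N.2.2)

def cc (a c : ℤ) (s t : ℂ) (N : L8) : ℂ := s * AA a N + t * BB c N

lemma TE_prod (a b c e : ℤ) (p : ℂ × ℂ × ℂ) (s t v : ℂ) (N : L8) :
    (TE a b c e p (v * s) (v * t) N.1.1 * TE a b c e p (2 * v * s) (2 * v * t) N.1.2) *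
    (TE a b c e p (2 * v * s) (2 * v * t) N.2.1 * TE a b c e p (3 * I * v * s) (3 * I * v * t) N.2.2)
    = WW a b c e p N * cexp (v * (2 * Real.pi * I * cc a c s t N)) := by
  unfold WW TE cc AA BB cA
  simp only [← Complex.exp_add]
  congr 1; ring

def Pos (d : ℝ) (p : ℂ × ℂ × ℂ) : Prop := ∀ x y : ℝ, d * (x ^ 2 + y ^ 2) ≤
    p.1.im * x ^ 2 + 2 * p.2.1.im * x * y + p.2.2.im * y ^ 2

lemma Pos_nhds {p : ℂ × ℂ × ℂ} (hp : p ∈ Dom) : ∃ d > 0, ∃ r > 0, ∀ q ∈ Metric.ball p r, Pos d q := by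
  obtain ⟨h1, h2⟩ := hp
  have h3 : 0 < p.2.2.im := by
    by_contra h
    nlinarith [sq_nonneg p.2.1.im]
  set D := (p.1.im * p.2.2.im - p.2.1.im ^ 2) / (p.1.im + p.2.2.im) with hD
  have hD0 : 0 < D := div_pos (by linarith) (by linarith)
  have hP : Pos D p := fun x y => by
    rw [hD, div_mul_eq_mul_div, div_le_iff₀ (by linarith)]
    nlinarith [sq_nonneg (p.1.im * x + p.2.1.im * y), sq_nonneg (p.2.1.im * x + p.2.2.im * y)]
  refine ⟨D / 2, by linarith, D / 4, by linarith, fun q hq x y => ?_⟩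
  rw [Metric.mem_ball, dist_eq_norm] at hq
  have a1 : |q.1.im - p.1.im| ≤ D / 4 := by
    have := (Complex.abs_im_le_norm (q - p).1).trans ((norm_fst_le (q - p)).trans hq.le)
    simpa using this
  have a2 : |q.2.1.im - p.2.1.im| ≤ D / 4 := by
    have := (Complex.abs_im_le_norm (q - p).2.1).trans ((norm_fst_le _).trans ((norm_snd_le (q - p)).trans hq.le))
    simpa using this
  have a3 : |q.2.2.im - p.2.2.im| ≤ D / 4 := by
    have := (Complex.abs_im_le_norm (q - p).2.2).trans ((norm_snd_le _).trans ((norm_snd_le (q - p)).trans hq.le))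
    simpa using this
  rw [abs_le] at a1 a2 a3
  have := hP x y
  have b1 : -(D / 4) * x ^ 2 ≤ (q.1.im - p.1.im) * x ^ 2 := mul_le_mul_of_nonneg_right a1.1 (sq_nonneg x)
  have b3 : -(D / 4) * y ^ 2 ≤ (q.2.2.im - p.2.2.im) * y ^ 2 := mul_le_mul_of_nonneg_right a3.1 (sq_nonneg y)
  have b2 : -(D / 4) * (x ^ 2 + y ^ 2) ≤ 2 * (q.2.1.im - p.2.1.im) * x * y := by
    nlinarith [mul_nonneg (sub_nonneg.2 a2.1) (sq_nonneg (x + y)), mul_nonneg (sub_nonneg.2 a2.2) (sq_nonneg (x - y))]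
  linarith

lemma Pos_of {p : ℂ × ℂ × ℂ} (hp : p ∈ Dom) : ∃ d > 0, Pos d p := by
  obtain ⟨d, hd, r, hr, h⟩ := Pos_nhds hp
  exact ⟨d, hd, h p (Metric.mem_ball_self hr)⟩

lemma TE_norm (a b c e : ℤ) {d : ℝ} {p : ℂ × ℂ × ℂ} (h : Pos d p) {s t : ℂ} {R : ℝ} (hs : ‖s‖ ≤ R) (ht : ‖t‖ ≤ R) (n : K2) :
    ‖TE a b c e p s t n‖ ≤ Real.exp (-(Real.pi * d) * qS a c n + 2 * Real.pi * R * qT a c n) := by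
  unfold TE
  rw [Complex.norm_exp, Real.exp_le_exp]
  have e1 : (Real.pi * I * (p.1 * (hx a n.1 : ℂ) ^ 2 + 2 * p.2.1 * hx a n.1 * hx c n.2 + p.2.2 * (hx c n.2 : ℂ) ^ 2
    + b * hx a n.1 + e * hx c n.2 + 2 * (hx a n.1 * s + hx c n.2 * t))).re =
    -Real.pi * ((p.1.im * hx a n.1 ^ 2 + 2 * p.2.1.im * hx a n.1 * hx c n.2 + p.2.2.im * hx c n.2 ^ 2)
      + 2 * (hx a n.1 * s.im + hx c n.2 * t.im)) := by
    simp [← Complex.ofReal_pow]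
  rw [e1]
  have h1 := h (hx a n.1) (hx c n.2)
  have h2 : -(hx a n.1 * s.im) ≤ |hx a n.1| * R := by
    refine (neg_le_abs _).trans ?_
    rw [abs_mul]; exact mul_le_mul_of_nonneg_left ((abs_im_le_norm s).trans hs) (abs_nonneg _)
  have h3 : -(hx c n.2 * t.im) ≤ |hx c n.2| * R := by
    refine (neg_le_abs _).trans ?_
    rw [abs_mul]; exact mul_le_mul_of_nonneg_left ((abs_im_le_norm t).trans ht) (abs_nonneg _)
  have hpi := Real.pi_pos
  unfold qS qT
  have h4 := mul_le_mul_of_nonneg_left h1 hpi.le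
  have h5 := mul_le_mul_of_nonneg_left h2 hpi.le
  have h6 := mul_le_mul_of_nonneg_left h3 hpi.le
  linarith

lemma TE_summable (a b c e : ℤ) {p : ℂ × ℂ × ℂ} (h : p ∈ Dom) (s t : ℂ) :
    Summable fun n => ‖TE a b c e p s t n‖ := by
  obtain ⟨d, hd, h⟩ := Pos_of h
  exact Summable.of_nonneg_of_le (fun _ => norm_nonneg _)
    (TE_norm a b c e h (le_max_left ‖s‖ ‖t‖) (le_max_right ‖s‖ ‖t‖)) (sum2 (by positivity) _ a c)

lemma WW_norm (a b c e : ℤ) {d : ℝ} {p : ℂ × ℂ × ℂ} (h : Pos d p) (N : L8) :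
    ‖WW a b c e p N‖ ≤ GN (Real.pi * d) 0 a c N := by
  have := TE_norm a b c e h (s := 0) (t := 0) (R := 0) (by simp) (by simp)
  have e1 : GN (Real.pi * d) 0 a c N = (Real.exp (-(Real.pi * d) * qS a c N.1.1 + 2 * Real.pi * 0 * qT a c N.1.1) *
     Real.exp (-(Real.pi * d) * qS a c N.1.2 + 2 * Real.pi * 0 * qT a c N.1.2)) *
     (Real.exp (-(Real.pi * d) * qS a c N.2.1 + 2 * Real.pi * 0 * qT a c N.2.1) *
     Real.exp (-(Real.pi * d) * qS a c N.2.2 + 2 * Real.pi * 0 * qT a c N.2.2)) := by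
    simp only [← Real.exp_add]; unfold GN; congr 1; unfold s4; ring
  rw [e1]; unfold WW
  simp only [norm_mul]
  gcongr <;> exact this _

lemma AB_norm (a c : ℤ) (N : L8) : ‖AA a N‖ ≤ 3 * s4 (qT a c) N ∧ ‖BB c N‖ ≤ 3 * s4 (qT a c) N := by
  have key : ∀ (x y z w : ℝ), ‖(x + 2 * y + 2 * z + 3 * I * w : ℂ)‖ ≤ 3 * ((|x| + |y|) + (|z| + |w|)) := by
    intro x y z w
    refine (norm_add_le _ _).trans ?_
    have h1 := norm_add_le ((x : ℂ) + 2 * y) (2 * z)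
    have h2 := norm_add_le (x : ℂ) (2 * y)
    simp at h1 h2 ⊢
    linarith [abs_nonneg x, abs_nonneg y, abs_nonneg z, abs_nonneg w]
  constructor
  · refine (key _ _ _ _).trans ?_
    unfold s4 qT
    linarith [abs_nonneg (hx c N.1.1.2), abs_nonneg (hx c N.1.2.2), abs_nonneg (hx c N.2.1.2), abs_nonneg (hx c N.2.2.2)]
  · refine (key _ _ _ _).trans ?_
    unfold s4 qT
    linarith [abs_nonneg (hx a N.1.1.1), abs_nonneg (hx a N.1.2.1), abs_nonneg (hx a N.2.1.1), abs_nonneg (hx a N.2.2.1)]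

lemma qT_nonneg (a c : ℤ) (N : L8) : 0 ≤ s4 (qT a c) N := by unfold s4 qT; positivity

lemma S_le (a c : ℤ) (N : L8) : s4 (qS a c) N ≤ s4 (qT a c) N ^ 2 := by
  have key : ∀ x y : ℝ, x ^ 2 + y ^ 2 ≤ (|x| + |y|) ^ 2 := fun x y => by
    nlinarith [sq_abs x, sq_abs y, abs_nonneg x, abs_nonneg y, mul_nonneg (abs_nonneg x) (abs_nonneg y)]
  have k4 : ∀ x y z w : ℝ, 0 ≤ x → 0 ≤ y → 0 ≤ z → 0 ≤ w → (x ^ 2 + y ^ 2) + (z ^ 2 + w ^ 2) ≤ ((x + y) + (z + w)) ^ 2 :=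
    fun x y z w hx hy hz hw => by
      nlinarith [mul_nonneg hx hy, mul_nonneg hx hz, mul_nonneg hx hw, mul_nonneg hy hz, mul_nonneg hy hw, mul_nonneg hz hw]
  unfold s4
  refine le_trans ?_ (k4 _ _ _ _ ?_ ?_ ?_ ?_)
  · unfold qS qT
    gcongr ?_ + ?_ + (?_ + ?_) <;> exact key _ _
  all_goals unfold qT; positivity

/-- polynomially weighted bound -/
lemma poly_bd (a c : ℤ) (k : ℕ) (d R : ℝ) (N : L8) :
    GN d R a c N * s4 (qT a c) N ^ k ≤ k.factorial * GN d (R + 1) a c N := by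
  have h := Real.pow_div_factorial_le_exp (s4 (qT a c) N) (qT_nonneg a c N) k
  rw [div_le_iff₀ (by positivity)] at h
  have e1 : GN d (R + 1) a c N = GN d R a c N * Real.exp (s4 (qT a c) N) := by
    unfold GN; rw [← Real.exp_add]; congr 1; ring
  rw [e1]
  have : 0 < GN d R a c N := Real.exp_pos _
  nlinarith

lemma cc_norm (a c : ℤ) (s t : ℂ) (N : L8) : ‖cc a c s t N‖ ≤ 3 * (‖s‖ + ‖t‖) * s4 (qT a c) N := by
  obtain ⟨h1, h2⟩ := AB_norm a c N
  refine (norm_add_le _ _).trans ?_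
  rw [norm_mul, norm_mul]
  nlinarith [mul_le_mul_of_nonneg_left h1 (norm_nonneg s), mul_le_mul_of_nonneg_left h2 (norm_nonneg t)]

end

section
set_option linter.unusedSimpArgs false

def ES (W c : L8 → ℂ) : Prop := ∀ R : ℝ, Summable fun N => ‖W N‖ * Real.exp (R * ‖c N‖)

lemma ES.mul {W c : L8 → ℂ} (h : ES W c) : ES (fun N => W N * c N) c := fun R => by
  refine Summable.of_nonneg_of_le (fun _ => by positivity) (fun N => ?_) (h (R + 1))
  have := Real.add_one_le_exp ‖c N‖
  rw [norm_mul, mul_assoc, add_mul, Real.exp_add, mul_comm (Real.exp (R * _)), one_mul]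
  gcongr
  linarith

lemma ES.le {W c : L8 → ℂ} (v : ℂ) {R : ℝ} (hv : ‖v‖ ≤ R) (N : L8) :
    ‖W N * cexp (v * c N)‖ ≤ ‖W N‖ * Real.exp (R * ‖c N‖) := by
  rw [norm_mul, Complex.norm_exp]
  gcongr
  refine (Complex.re_le_norm _).trans ?_
  rw [norm_mul]; gcongr

lemma ES.deriv {W c : L8 → ℂ} (h : ES W c) (v : ℂ) :
    deriv (fun v => ∑' N, W N * cexp (v * c N)) v = ∑' N, W N * c N * cexp (v * c N) := by
  have hs := Complex.hasSum_deriv_of_summable_norm (F := fun N v => W N * cexp (v * c N)) (h (‖v‖ + 1))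
    (U := Metric.ball 0 (‖v‖ + 1)) (fun N => by fun_prop) Metric.isOpen_ball
    (fun N w hw => ES.le w (by simpa using (Metric.mem_ball.1 hw).le) N) (z := v) (by simp)
  rw [← hs.tsum_eq]
  congr 1; ext N
  have : HasDerivAt (fun v => W N * cexp (v * c N)) (W N * (cexp (v * c N) * (1 * c N))) v :=
    (((hasDerivAt_id v).mul_const (c N)).cexp).const_mul (W N)
  rw [this.deriv]; ring

lemma ES.moments {W c W' c' : L8 → ℂ} {κ : ℂ} (h : ES W c) (h' : ES W' c')
    (he : ∀ v, ∑' N, W N * cexp (v * c N) = κ * ∑' N, W' N * cexp (v * c' N)) (j : ℕ) :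
    ∑' N, W N * c N ^ j = κ * ∑' N, W' N * c' N ^ j := by
  have key : ∀ (j : ℕ) (W W' : L8 → ℂ), ES W c → ES W' c' →
      (∀ v, ∑' N, W N * cexp (v * c N) = κ * ∑' N, W' N * cexp (v * c' N)) →
      ∑' N, W N * c N ^ j = κ * ∑' N, W' N * c' N ^ j := by
    intro j
    induction j with
    | zero => intro W W' h h' he; simpa using he 0
    | succ j ih =>
      intro W W' h h' he
      have := ih _ _ h.mul h'.mul (fun v => by
        rw [← h.deriv, ← h'.deriv, ← deriv_const_mul_field]
        congr 1; ext v; exact he v)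
      simpa only [pow_succ', mul_assoc] using this
  exact key j W W' h h' he

def Mom (a b c e : ℤ) (p : ℂ × ℂ × ℂ) (s t : ℂ) : ℂ := ∑' N, WW a b c e p N * cc a c s t N ^ 12

def Mc (a b c e : ℤ) (l : ℕ) (p : ℂ × ℂ × ℂ) : ℂ := ∑' N, WW a b c e p N * (AA a N ^ (12 - l) * BB c N ^ l)

lemma WW_ES (a b c e : ℤ) {p : ℂ × ℂ × ℂ} (hp : p ∈ Dom) (s t : ℂ) :
    ES (WW a b c e p) (fun N => 2 * Real.pi * I * cc a c s t N) := fun R => by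
  obtain ⟨d, hd, h⟩ := Pos_of hp
  refine Summable.of_nonneg_of_le (fun _ => by positivity) (fun N => ?_)
    (sumN (d := Real.pi * d) (by positivity) (|R| * (2 * Real.pi * (3 * (‖s‖ + ‖t‖)))) a c)
  have h1 := WW_norm a b c e h N
  have h2 : R * ‖2 * Real.pi * I * cc a c s t N‖ ≤ |R| * (2 * Real.pi * (3 * (‖s‖ + ‖t‖))) * s4 (qT a c) N := by
    have : ‖2 * Real.pi * I * cc a c s t N‖ = 2 * Real.pi * ‖cc a c s t N‖ := by
      simp [abs_of_pos Real.pi_pos]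
    rw [this]
    calc R * (2 * Real.pi * ‖cc a c s t N‖) ≤ |R| * (2 * Real.pi * ‖cc a c s t N‖) := by
          gcongr; exact le_abs_self R
      _ ≤ |R| * (2 * Real.pi * (3 * (‖s‖ + ‖t‖) * s4 (qT a c) N)) := by gcongr; exact cc_norm a c s t N
      _ = _ := by ring
  calc _ ≤ GN (Real.pi * d) 0 a c N * Real.exp (|R| * (2 * Real.pi * (3 * (‖s‖ + ‖t‖))) * s4 (qT a c) N) := by
        have : 0 ≤ GN (Real.pi * d) 0 a c N := (Real.exp_pos _).le
        gcongr
    _ = _ := by unfold GN; rw [← Real.exp_add]; congr 1; ring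

lemma Mc_bd (a b c e : ℤ) (l : ℕ) (hl : l ≤ 12) {d : ℝ} {p : ℂ × ℂ × ℂ} (h : Pos d p) (N : L8) :
    ‖WW a b c e p N * (AA a N ^ (12 - l) * BB c N ^ l)‖ ≤ GN (Real.pi * d) 0 a c N * (3 ^ 12 * s4 (qT a c) N ^ 12) := by
  obtain ⟨h1, h2⟩ := AB_norm a c N
  have h3 := qT_nonneg a c N
  rw [norm_mul, norm_mul, norm_pow, norm_pow]
  have : (3 * s4 (qT a c) N) ^ (12 - l) * (3 * s4 (qT a c) N) ^ l = 3 ^ 12 * s4 (qT a c) N ^ 12 := by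
    rw [← pow_add, ← mul_pow, Nat.sub_add_cancel hl]
  rw [← this]
  have := WW_norm a b c e h N
  have : 0 ≤ GN (Real.pi * d) 0 a c N := (Real.exp_pos _).le
  gcongr

lemma Mc_summable (a b c e : ℤ) (l : ℕ) (hl : l ≤ 12) {p : ℂ × ℂ × ℂ} (hp : p ∈ Dom) :
    Summable fun N => WW a b c e p N * (AA a N ^ (12 - l) * BB c N ^ l) := by
  obtain ⟨d, hd, h⟩ := Pos_of hp
  refine Summable.of_norm_bounded (g := fun N => 3 ^ 12 * (Nat.factorial 12 * GN (Real.pi * d) (0 + 1) a c N)) ?_ fun N => ?_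
  · exact ((sumN (by positivity) _ a c).mul_left _).mul_left _
  · refine (Mc_bd a b c e l hl h N).trans ?_
    have := poly_bd a c 12 (Real.pi * d) 0 N
    linarith

lemma Mom_eq (a b c e : ℤ) {p : ℂ × ℂ × ℂ} (hp : p ∈ Dom) (s t : ℂ) :
    Mom a b c e p s t = ev (fun l : Fin 13 => (Nat.choose 12 l : ℂ) * Mc a b c e l p) s t := by
  unfold Mom ev Mc
  have h1 : ∀ l : Fin 13, (Nat.choose 12 l : ℂ) * (∑' N, WW a b c e p N * (AA a N ^ (12 - (l : ℕ)) * BB c N ^ (l : ℕ))) *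
      (s ^ (12 - (l : ℕ)) * t ^ (l : ℕ)) =
      ∑' N, (Nat.choose 12 l : ℂ) * (s ^ (12 - (l : ℕ)) * t ^ (l : ℕ)) * (WW a b c e p N * (AA a N ^ (12 - (l : ℕ)) * BB c N ^ (l : ℕ))) := by
    intro l; rw [tsum_mul_left]; ring
  simp only [h1]
  rw [← Summable.tsum_finsetSum (fun (l : Fin 13) _ => (Mc_summable a b c e l (by omega) hp).mul_left ((Nat.choose 12 l : ℂ) * (s ^ (12 - (l : ℕ)) * t ^ (l : ℕ))))]
  congr 1; ext N
  unfold cc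
  rw [add_comm (s * _), add_pow, Finset.mul_sum, Finset.sum_range]
  refine Finset.sum_congr rfl fun l _ => ?_
  rw [mul_pow, mul_pow]; ring

lemma Mom_of_gen {a b c e a' b' c' e' : ℤ} {p p' : ℂ × ℂ × ℂ} {s t s' t' κ : ℂ} (hp : p ∈ Dom) (hp' : p' ∈ Dom)
    (h : ∀ v : ℂ, ∑' N, WW a b c e p N * cexp (v * (2 * Real.pi * I * cc a c s t N)) =
      κ * ∑' N, WW a' b' c' e' p' N * cexp (v * (2 * Real.pi * I * cc a' c' s' t' N))) :
    Mom a b c e p s t = κ * Mom a' b' c' e' p' s' t' := by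
  have := ES.moments (WW_ES a b c e hp s t) (WW_ES a' b' c' e' hp' s' t') h 12
  simp only [mul_pow _ (cc _ _ _ _ _), mul_left_comm _ ((2 * (Real.pi : ℂ) * I) ^ 12), tsum_mul_left] at this
  have h0 : (2 * (Real.pi : ℂ) * I) ^ 12 ≠ 0 := pow_ne_zero _ Complex.two_pi_I_ne_zero
  exact mul_left_cancel₀ h0 this

/-! termwise transformations -/

lemma exp_pi_int (n : ℤ) : cexp (Real.pi * I * (2 * n)) = 1 := by
  rw [Complex.exp_eq_one_iff]; exact ⟨n, by ring⟩

lemma exp_cong {x y : ℂ} (n : ℤ) (h : x = y + 2 * n) : cexp (Real.pi * I * x) = cexp (Real.pi * I * y) := by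
  rw [h, mul_add, Complex.exp_add, exp_pi_int, mul_one]

def fx (a b c e : ℤ) (p : ℂ × ℂ × ℂ) (n : K2) : ℂ := p.1 * (hx a n.1 : ℂ) ^ 2 + 2 * p.2.1 * hx a n.1 * hx c n.2 +
  p.2.2 * (hx c n.2 : ℂ) ^ 2 + b * hx a n.1 + e * hx c n.2

lemma WW_eq (a b c e : ℤ) (p : ℂ × ℂ × ℂ) (N : L8) : WW a b c e p N = cexp (Real.pi * I *
    (fx a b c e p N.1.1 + fx a b c e p N.1.2 + fx a b c e p N.2.1 + fx a b c e p N.2.2)) := by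
  unfold WW TE fx
  simp only [← Complex.exp_add]
  congr 1; ring

lemma Mom_b (a b c e : ℤ) (p : ℂ × ℂ × ℂ) (s t : ℂ) : Mom a (b + 2) c e p s t = Mom a b c e p s t := by
  unfold Mom; congr 1; ext N
  rw [WW_eq, WW_eq, exp_cong (N.1.1.1 + N.1.2.1 + N.2.1.1 + N.2.2.1 + 2 * a)]
  unfold fx hx; push_cast; ring

lemma Mom_e (a b c e : ℤ) (p : ℂ × ℂ × ℂ) (s t : ℂ) : Mom a b c (e + 2) p s t = Mom a b c e p s t := by
  unfold Mom; congr 1; ext N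
  rw [WW_eq, WW_eq, exp_cong (N.1.1.2 + N.1.2.2 + N.2.1.2 + N.2.2.2 + 2 * c)]
  unfold fx hx; push_cast; ring

def e4 (f : K2 ≃ K2) : L8 ≃ L8 := (f.prodCongr f).prodCongr (f.prodCongr f)

/-- reindexing principle -/
lemma Mom_re {a b c e a' b' c' e' : ℤ} {p p' : ℂ × ℂ × ℂ} {s t s' t' : ℂ} (f : K2 ≃ K2)
    (h : ∀ n, fx a b c e p n = fx a' b' c' e' p' (f n))
    (hc : ∀ n : K2, s * hx a n.1 + t * hx c n.2 = s' * hx a' (f n).1 + t' * hx c' (f n).2) :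
    Mom a b c e p s t = Mom a' b' c' e' p' s' t' := by
  unfold Mom
  rw [← (e4 f).tsum_eq (fun N => WW a' b' c' e' p' N * _)]
  congr 1; ext N
  rw [WW_eq, WW_eq, h, h, h, h]
  have : cc a c s t N = cc a' c' s' t' (e4 f N) := by
    unfold cc AA BB cA
    have h1 := hc N.1.1
    have h2 := hc N.1.2
    have h3 := hc N.2.1
    have h4 := hc N.2.2
    show _ = s' * (hx a' (f N.1.1).1 + 2 * hx a' (f N.1.2).1 + 2 * hx a' (f N.2.1).1 + 3 * I * hx a' (f N.2.2).1) +
      t' * (hx c' (f N.1.1).2 + 2 * hx c' (f N.1.2).2 + 2 * hx c' (f N.2.1).2 + 3 * I * hx c' (f N.2.2).2)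
    linear_combination h1 + 2 * h2 + 2 * h3 + 3 * I * h4
  rw [this]; rfl

lemma Mom_a (a b c e : ℤ) (p : ℂ × ℂ × ℂ) (s t : ℂ) : Mom (a + 2) b c e p s t = Mom a b c e p s t :=
  Mom_re ((Equiv.addRight 1).prodCongr (Equiv.refl _)) (fun n => by simp [fx, hx]; ring) (fun n => by simp only [hx, Equiv.prodCongr_apply, Prod.map, Equiv.coe_addRight, Equiv.coe_refl, Equiv.coe_fn_mk, id]; push_cast; ring)

lemma Mom_c (a b c e : ℤ) (p : ℂ × ℂ × ℂ) (s t : ℂ) : Mom a b (c + 2) e p s t = Mom a b c e p s t :=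
  Mom_re ((Equiv.refl _).prodCongr (Equiv.addRight 1)) (fun n => by simp [fx, hx]; ring) (fun n => by simp only [hx, Equiv.prodCongr_apply, Prod.map, Equiv.coe_addRight, Equiv.coe_refl, Equiv.coe_fn_mk, id]; push_cast; ring)

lemma Mom_T (a b c e : ℤ) (p q r s t : ℂ) :
    Mom a b c e (p + 1, q, r) s t = cexp (Real.pi * I * a) * Mom a (b + 1 + a) c e (p, q, r) s t := by
  unfold Mom
  rw [← tsum_mul_left]
  congr 1; ext N
  rw [← mul_assoc]; congr 1
  have ev2 : ∀ n : ℤ, ∃ k : ℤ, n ^ 2 = n + 2 * k := fun n => by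
    have : Even (n ^ 2 - n) := by simp [parity_simps]
    obtain ⟨k, hk⟩ := this
    exact ⟨k, by omega⟩
  obtain ⟨k1, h1'⟩ := ev2 N.1.1.1
  obtain ⟨k2, h2'⟩ := ev2 N.1.2.1
  obtain ⟨k3, h3'⟩ := ev2 N.2.1.1
  obtain ⟨k4, h4'⟩ := ev2 N.2.2.1
  obtain ⟨k5, h5'⟩ := ev2 a
  replace h5' := congrArg (Int.cast : ℤ → ℂ) h5'
  replace h1' := congrArg (Int.cast : ℤ → ℂ) h1'
  replace h2' := congrArg (Int.cast : ℤ → ℂ) h2'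
  replace h3' := congrArg (Int.cast : ℤ → ℂ) h3'
  replace h4' := congrArg (Int.cast : ℤ → ℂ) h4'
  push_cast at h1' h2' h3' h4' h5'
  rw [WW_eq, WW_eq, ← Complex.exp_add, ← mul_add, exp_cong (k1 + k2 + k3 + k4 - 2 * a - k5)]
  unfold fx hx; push_cast
  linear_combination h1' + h2' + h3' + h4' - h5'

lemma Mom_L (a b c e : ℤ) (p q r s t : ℂ) :
    Mom a b c e (p + 2 * q + r, q + r, r) s t = Mom a (b - e) (a + c) e (p, q, r) (s - t) t :=
  Mom_re ⟨fun n => (n.1, n.1 + n.2), fun n => (n.1, n.2 - n.1), fun n => by simp, fun n => by simp⟩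
    (fun n => by simp [fx, hx]; ring) (fun n => by simp only [hx, Equiv.prodCongr_apply, Prod.map, Equiv.coe_addRight, Equiv.coe_refl, Equiv.coe_fn_mk, id]; push_cast; ring)

lemma Mom_W (a b c e : ℤ) (p q r s t : ℂ) :
    Mom a b c e (r, -q, p) s t = Mom c e (-a) (-b) (p, q, r) t (-s) :=
  Mom_re ⟨fun n => (n.2, -n.1), fun n => (-n.2, n.1), fun n => by simp, fun n => by simp⟩
    (fun n => by simp [fx, hx]; ring) (fun n => by simp only [hx, Equiv.prodCongr_apply, Prod.map, Equiv.coe_addRight, Equiv.coe_refl, Equiv.coe_fn_mk, id]; push_cast; ring)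

end

section
def th (a b c e : ℤ) (p : ℂ × ℂ × ℂ) (s t : ℂ) : ℂ := ∑' n, TE a b c e p s t n

lemma gen_eq (a b c e : ℤ) {p : ℂ × ℂ × ℂ} (hp : p ∈ Dom) (s t v : ℂ) :
    ∑' N, WW a b c e p N * cexp (v * (2 * Real.pi * I * cc a c s t N)) =
    (th a b c e p (v * s) (v * t) * th a b c e p (2 * v * s) (2 * v * t)) *
    (th a b c e p (2 * v * s) (2 * v * t) * th a b c e p (3 * I * v * s) (3 * I * v * t)) := by
  have h := fun s t => TE_summable a b c e hp s t
  unfold th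
  rw [tsum_mul_tsum_of_summable_norm (h _ _) (h _ _), tsum_mul_tsum_of_summable_norm (h _ _) (h _ _),
    tsum_mul_tsum_of_summable_norm ((h _ _).mul_norm (h _ _)) ((h _ _).mul_norm (h _ _))]
  congr 1; ext N
  rw [← TE_prod]

lemma Dom_S {p q r : ℂ} (h : (p, q, r) ∈ Dom) : (-1 / p, q / p, r - q ^ 2 / p) ∈ Dom := by
  refine mem_Dom (im_S h.1) ?_
  rw [hc_S q h.1]
  simpa using Dom_hc h

lemma th_J (a b c e : ℤ) {p q r : ℂ} (h : (p, q, r) ∈ Dom) (s t : ℂ) :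
    th a b c e (-1 / p, q / p, r - q ^ 2 / p) s t =
    ((-I * p) ^ (1 / 2 : ℂ) * cexp (Real.pi * I * (p * s ^ 2 + a * b / 2))) *
      th b (-a) c e (p, q, r) (p * s) (q * s + t) := by
  have hp : p ≠ 0 := by rintro rfl; simpa using h.1
  unfold th
  rw [← (Equiv.prodComm ℤ ℤ).tsum_eq (TE a b c e _ s t), ← (Equiv.prodComm ℤ ℤ).tsum_eq (TE b (-a) c e _ _ _)]
  have s1 := (Equiv.prodComm ℤ ℤ).summable_iff.2 (TE_summable a b c e (Dom_S h) s t).of_norm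
  have s2 := (Equiv.prodComm ℤ ℤ).summable_iff.2 (TE_summable b (-a) c e h (p * s) (q * s + t)).of_norm
  have e1 := s1.tsum_prod
  have e2 := s2.tsum_prod
  simp only [Function.comp_def] at e1 e2
  rw [e1, e2, ← tsum_mul_left]
  congr 1; ext m
  simp only [Equiv.prodComm_apply, Prod.swap_prod_mk]
  set y : ℂ := (hx c m : ℂ) with hy
  set z' : ℂ := q * y + b * p / 2 + p * s - a / 2 with hz
  have l1 : ∀ n : ℤ, TE a b c e (-1 / p, q / p, r - q ^ 2 / p) s t (n, m) =
      cexp (Real.pi * I * (-a ^ 2 / (4 * p) + q / p * a * y + (r - q ^ 2 / p) * y ^ 2 + b * a / 2 + e * y + a * s + 2 * y * t)) *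
        jacobiTheta₂_term n (z' / p) (-1 / p) := by
    intro n
    unfold TE jacobiTheta₂_term
    rw [← Complex.exp_add]; congr 1
    simp only [hz, hy, hx]; push_cast; field_simp; ring
  have l2 : ∀ n : ℤ, TE b (-a) c e (p, q, r) (p * s) (q * s + t) (n, m) =
      cexp (Real.pi * I * (p * b ^ 2 / 4 + q * b * y + r * y ^ 2 - a * b / 2 + e * y + b * p * s + 2 * y * (q * s + t))) *
        jacobiTheta₂_term n z' p := by
    intro n
    unfold TE jacobiTheta₂_term
    rw [← Complex.exp_add]; congr 1
    simp only [hz, hy, hx]; push_cast; ring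
  simp only [l1, l2, tsum_mul_left]
  have hf := jacobiTheta₂_functional_equation z' p
  have h0 : (-I * p) ^ (1 / 2 : ℂ) ≠ 0 := by
    rw [Complex.cpow_ne_zero_iff]; left; simp [hp]
  have hf' : jacobiTheta₂ (z' / p) (-1 / p) = (-I * p) ^ (1 / 2 : ℂ) * cexp (Real.pi * I * (z' ^ 2 / p)) * jacobiTheta₂ z' p := by
    rw [hf]
    have : cexp (Real.pi * I * (z' ^ 2 / p)) * cexp (-Real.pi * I * z' ^ 2 / p) = 1 := by
      rw [← Complex.exp_add, ← Complex.exp_zero]; congr 1; ring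
    have h3 := mul_one_div_cancel h0
    linear_combination (-jacobiTheta₂ (z' / p) (-1 / p)) * this * ((-I * p) ^ (1 / 2 : ℂ) * (1 / (-I * p) ^ (1 / 2 : ℂ))) - jacobiTheta₂ (z' / p) (-1 / p) * h3
  show _ * jacobiTheta₂ (z' / p) (-1 / p) = _ * (_ * jacobiTheta₂ z' p)
  rw [hf']
  have : cexp (Real.pi * I * (-a ^ 2 / (4 * p) + q / p * a * y + (r - q ^ 2 / p) * y ^ 2 + b * a / 2 + e * y + a * s + 2 * y * t)) *
      cexp (Real.pi * I * (z' ^ 2 / p)) = cexp (Real.pi * I * (p * s ^ 2 + a * b / 2)) *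
      cexp (Real.pi * I * (p * b ^ 2 / 4 + q * b * y + r * y ^ 2 - a * b / 2 + e * y + b * p * s + 2 * y * (q * s + t))) := by
    rw [← Complex.exp_add, ← Complex.exp_add]; congr 1
    rw [hz]; field_simp; ring
  linear_combination (-I * p) ^ (1 / 2 : ℂ) * jacobiTheta₂ z' p * this

lemma Mom_J (a b c e : ℤ) {p q r : ℂ} (h : (p, q, r) ∈ Dom) (s t : ℂ) :
    Mom a b c e (-1 / p, q / p, r - q ^ 2 / p) s t = (-p ^ 2) * Mom b (-a) c e (p, q, r) (p * s) (q * s + t) := by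
  refine Mom_of_gen (Dom_S h) h fun v => ?_
  rw [gen_eq _ _ _ _ (Dom_S h), gen_eq _ _ _ _ h, th_J a b c e h, th_J a b c e h, th_J a b c e h]
  have h1 : ((-I * p) ^ (1 / 2 : ℂ)) ^ 4 = -p ^ 2 := by
    rw [← Complex.cpow_nat_mul]
    norm_num
    linear_combination p ^ 2 * Complex.I_sq
  have h2 : (cexp (Real.pi * I * (p * (v * s) ^ 2 + a * b / 2)) * cexp (Real.pi * I * (p * (2 * v * s) ^ 2 + a * b / 2))) *
      (cexp (Real.pi * I * (p * (2 * v * s) ^ 2 + a * b / 2)) * cexp (Real.pi * I * (p * (3 * I * v * s) ^ 2 + a * b / 2))) = 1 := by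
    simp only [← Complex.exp_add, ← mul_add]
    rw [exp_cong (y := 0) (a * b)]; · simp
    push_cast
    linear_combination 9 * p * v ^ 2 * s ^ 2 * Complex.I_sq
  have r1 : ∀ k : ℂ, p * (k * v * s) = k * v * (p * s) := fun k => by ring
  have r2 : ∀ k : ℂ, q * (k * v * s) + k * v * t = k * v * (q * s + t) := fun k => by ring
  rw [r1, r1, r2, r2, show p * (v * s) = v * (p * s) by ring, show q * (v * s) + v * t = v * (q * s + t) by ring]
  set T1 := th b (-a) c e (p, q, r) (v * (p * s)) (v * (q * s + t))
  set T2 := th b (-a) c e (p, q, r) (2 * v * (p * s)) (2 * v * (q * s + t))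
  set T3 := th b (-a) c e (p, q, r) (3 * I * v * (p * s)) (3 * I * v * (q * s + t))
  rw [← h1]
  linear_combination ((-I * p) ^ (1 / 2 : ℂ)) ^ 4 * (T1 * T2 * (T2 * T3)) * h2

/-- the combination -/
def MF (p : ℂ × ℂ × ℂ) (s t : ℂ) : ℂ := Mom 0 0 1 1 p s t - Mom 0 1 1 1 p s t - Mom 1 1 0 0 p s t
  + Mom 1 1 0 1 p s t + Mom 1 1 1 0 p s t - Mom 1 0 1 1 p s t

lemma MF_T (p q r s t : ℂ) : MF (p + 1, q, r) s t = - MF (p, q, r) s t := by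
  unfold MF
  simp only [Mom_T]
  have h1 := Mom_b 0 0 1 1 (p, q, r) s t
  have h2 := fun c e => Mom_b 1 1 c e (p, q, r) s t
  have h3 := Mom_b 1 0 1 1 (p, q, r) s t
  norm_num [Complex.exp_pi_mul_I] at h1 h2 h3 ⊢
  rw [h1, h2, h2, h2, h3]; ring

lemma MF_L (p q r s t : ℂ) : MF (p + 2 * q + r, q + r, r) s t = - MF (p, q, r) (s - t) t := by
  unfold MF
  simp only [Mom_L]
  have h1 := Mom_b 0 (-1) 1 1 (p, q, r) (s - t) t
  have h2 := Mom_c 1 1 0 0 (p, q, r) (s - t) t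
  have h3 := Mom_b 1 (-1) 2 1 (p, q, r) (s - t) t
  have h4 := Mom_c 1 1 0 1 (p, q, r) (s - t) t
  norm_num at h1 h2 h3 h4 ⊢
  rw [← h1, ← h3, h2, h4]; ring

lemma MF_W (p q r s t : ℂ) : MF (r, -q, p) s t = - MF (p, q, r) t (-s) := by
  unfold MF
  simp only [Mom_W]
  have h1 := fun a b c => Mom_e a b c (-1) (p, q, r) t (-s)
  have h2 := fun a b e => Mom_c a b (-1) e (p, q, r) t (-s)
  norm_num at h1 h2 ⊢
  simp only [← h1, ← h2]; ring

lemma MF_J {p q r : ℂ} (h : (p, q, r) ∈ Dom) (s t : ℂ) :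
    MF (-1 / p, q / p, r - q ^ 2 / p) s t = - p ^ 2 * MF (p, q, r) (p * s) (q * s + t) := by
  unfold MF
  simp only [Mom_J _ _ _ _ h]
  have h1 := fun a c e => Mom_b a (-1) c e (p, q, r) (p * s) (q * s + t)
  norm_num at h1 ⊢
  simp only [← h1]; ring

def Fc (l : ℕ) (p : ℂ × ℂ × ℂ) : ℂ := (Nat.choose 12 l : ℂ) * (Mc 0 0 1 1 l p - Mc 0 1 1 1 l p - Mc 1 1 0 0 l p
  + Mc 1 1 0 1 l p + Mc 1 1 1 0 l p - Mc 1 0 1 1 l p)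

lemma MF_ev {p : ℂ × ℂ × ℂ} (hp : p ∈ Dom) (s t : ℂ) : MF p s t = ev (fun l : Fin 13 => Fc l p) s t := by
  unfold MF
  simp only [Mom_eq _ _ _ _ hp]
  unfold ev Fc
  simp only [← Finset.sum_add_distrib, ← Finset.sum_sub_distrib]
  refine Finset.sum_congr rfl fun l _ => ?_
  ring

open Classical in
def FT (τ : Fin 2 → Fin 2 → ℂ) : Fin 13 → ℂ := if τ ∈ H2 then fun l => Fc l (τ 0 0, τ 0 1, τ 1 1) else 0

lemma FT_mk {a z b : ℂ} (h : (a, z, b) ∈ Dom) : FT (mkH a z b) = fun l : Fin 13 => Fc l (a, z, b) := by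
  unfold FT; rw [if_pos (mk_mem.2 h)]; rfl

lemma FT_ev {a z b : ℂ} (h : (a, z, b) ∈ Dom) (s t : ℂ) : ev (FT (mkH a z b)) s t = MF (a, z, b) s t := by
  rw [FT_mk h, MF_ev h]

lemma ev_smul (k : ℂ) (v : Fin 13 → ℂ) (s t : ℂ) : ev (k • v) s t = k * ev v s t := by
  unfold ev; rw [Finset.mul_sum]; exact Finset.sum_congr rfl fun l _ => by simp [mul_assoc]

lemma law_mk {γ : M4} {e : ℂ} (h : ∀ a z b, (a, z, b) ∈ Dom → ∃ a' z' b', ∃ m : Matrix (Fin 2) (Fin 2) ℂ,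
    den γ (mkH a z b) = m ∧ m.det ≠ 0 ∧ num γ (mkH a z b) = !![a', z'; z', b'] * m ∧
    ∀ t, MF (a', z', b') 1 t = e * m.det ^ 2 * MF (a, z, b) (m 0 0 + m 1 0 * t) (m 0 1 + m 1 1 * t)) (hγ : γ ∈ Sp4Z) :
    ∀ τ ∈ H2, FT (moeb γ τ) = e • wt 12 2 (den γ τ) (FT τ) := by
  intro τ hτ
  have h1 := H2_mk hτ
  have h2 := (H2_pres γ hγ τ hτ).2
  rw [h1] at hτ h2 ⊢
  have hd := mk_mem.1 hτ
  obtain ⟨a', z', b', m, hm, hdet, hnum, hl⟩ := h _ _ _ hd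
  have hm' : moeb γ (mkH (τ 0 0) (τ 0 1) (τ 1 1)) = mkH a' z' b' := moeb_of (by rwa [hm]) (by rw [hm, hnum]; rfl)
  rw [hm'] at h2 ⊢
  rw [hm, wt, smul_smul]
  refine ev_inj fun t => ?_
  rw [ev_smul, ev_symAct, FT_ev hd, FT_ev (mk_mem.1 h2), hl t]
  norm_cast

lemma FT_law {ε : M4 → ℂ} (hm : IsEps ε) (hv : EpsVals ε) : ∀ γ ∈ Sp4Z, ∀ τ ∈ H2, FT (moeb γ τ) = ε γ • wt 12 2 (den γ τ) (FT τ) := by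
  intro γ hγ
  refine sp_gen (fun γ => ∀ τ ∈ H2, FT (moeb γ τ) = ε γ • wt 12 2 (den γ τ) (FT τ)) ?_ ?_ ?_ ?_ ?_ γ hγ
  · intro x hx y hy h1 h2 τ hτ
    have g1 := H2_pres y hy τ hτ
    have g2 := H2_pres x hx _ g1.2
    rw [moeb_mul g1.1 g2.1, h1 _ g1.2, h2 _ hτ, hm.2.1 x hx y hy, den_mul g1.1, wt_mul, wt_smul, smul_smul]
  · refine law_mk (fun a z b h => ⟨a + 1, z, b, _, den_e1 _ _ _ _ _ _ _, by simp, by rw [num_e1]; simp, fun t => ?_⟩) (e1_Sp (by norm_num))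
    rw [hv.t1, MF_T]; simp
  · refine law_mk (fun a z b h => ?_) (e1_Sp (by norm_num))
    have ha : a ≠ 0 := by rintro rfl; simpa using h.1
    refine ⟨-1 / a, z / a, b - z ^ 2 / a, _, den_e1 _ _ _ _ _ _ _, by simpa using ha,
      by rw [num_e1]; simp; refine ⟨⟨?_, ?_⟩, ?_, ?_⟩ <;> field_simp <;> ring, fun t => ?_⟩
    rw [hv.j1, MF_J h]; simp
  · refine law_mk (fun a z b h => ⟨a + 2 * z + b, z + b, b, _, den_lv _ _ _ _ _ _ _, by simp, by rw [num_lv]; simp; ring, fun t => ?_⟩) (lv_Sp (by norm_num))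
    rw [hv.lt, MF_L]; simp [sub_eq_add_neg]
  · refine law_mk (fun a z b h => ⟨b, -z, a, _, den_lv _ _ _ _ _ _ _, by simp, by rw [num_lv]; simp, fun t => ?_⟩) (lv_Sp (by norm_num))
    rw [hv.ls, MF_W]; simp

end

section
def lN (a c : ℤ) (N : L8) : ℂ × ℂ × ℂ →L[ℂ] ℂ :=
  (Real.pi * I * (s4 (fun n => hx a n.1 ^ 2) N : ℝ)) • ContinuousLinearMap.fst ℂ ℂ (ℂ × ℂ) +
  (Real.pi * I * (2 * s4 (fun n => hx a n.1 * hx c n.2) N : ℝ)) • (ContinuousLinearMap.fst ℂ ℂ ℂ).comp (ContinuousLinearMap.snd ℂ ℂ (ℂ × ℂ)) +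
  (Real.pi * I * (s4 (fun n => hx c n.2 ^ 2) N : ℝ)) • (ContinuousLinearMap.snd ℂ ℂ ℂ).comp (ContinuousLinearMap.snd ℂ ℂ (ℂ × ℂ))

lemma lN_norm (a c : ℤ) (N : L8) : ‖lN a c N‖ ≤ 2 * Real.pi * s4 (qT a c) N ^ 2 := by
  have hT := S_le a c N
  have hpi := Real.pi_pos
  refine ContinuousLinearMap.opNorm_le_bound _ (by positivity) fun p => ?_
  have n1 := norm_fst_le p
  have n2 := (norm_fst_le p.2).trans (norm_snd_le p)
  have n3 := (norm_snd_le p.2).trans (norm_snd_le p)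
  set X := s4 (fun n => hx a n.1 ^ 2) N with hX
  set Z := s4 (fun n => hx a n.1 * hx c n.2) N with hZ
  set Y := s4 (fun n => hx c n.2 ^ 2) N with hY
  have hXY : s4 (qS a c) N = X + Y := by rw [hX, hY]; unfold s4 qS; ring
  have x0 : 0 ≤ X := by rw [hX]; unfold s4; positivity
  have y0 : 0 ≤ Y := by rw [hY]; unfold s4; positivity
  have hZ2 : |2 * Z| ≤ X + Y := by
    rw [abs_le, hX, hY, hZ]; unfold s4
    constructor
    · nlinarith [sq_nonneg (hx a N.1.1.1 + hx c N.1.1.2), sq_nonneg (hx a N.1.2.1 + hx c N.1.2.2), sq_nonneg (hx a N.2.1.1 + hx c N.2.1.2), sq_nonneg (hx a N.2.2.1 + hx c N.2.2.2)]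
    · nlinarith [sq_nonneg (hx a N.1.1.1 - hx c N.1.1.2), sq_nonneg (hx a N.1.2.1 - hx c N.1.2.2), sq_nonneg (hx a N.2.1.1 - hx c N.2.1.2), sq_nonneg (hx a N.2.2.1 - hx c N.2.2.2)]
  have e1 : lN a c N p = Real.pi * I * (X : ℝ) * p.1 + Real.pi * I * (2 * Z : ℝ) * p.2.1 + Real.pi * I * (Y : ℝ) * p.2.2 := rfl
  have nn : ∀ (x : ℝ) (z : ℂ), ‖Real.pi * I * (x : ℂ) * z‖ = Real.pi * |x| * ‖z‖ := fun x z => by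
    simp [abs_of_pos hpi]
  rw [e1]
  refine (norm_add₃_le).trans ?_
  rw [nn, nn, nn, abs_of_nonneg x0, abs_of_nonneg y0]
  calc _ ≤ Real.pi * X * ‖p‖ + Real.pi * (X + Y) * ‖p‖ + Real.pi * Y * ‖p‖ := by gcongr
    _ = 2 * Real.pi * (X + Y) * ‖p‖ := by ring
    _ ≤ _ := by rw [← hXY]; gcongr

lemma WW_deriv (a b c e : ℤ) (N : L8) (p : ℂ × ℂ × ℂ) :
    HasFDerivAt (fun p => WW a b c e p N) (WW a b c e p N • lN a c N) p := by
  have h : ∀ p, WW a b c e p N = cexp (lN a c N p + Real.pi * I * (b * (s4 (fun n => hx a n.1) N : ℝ) + e * (s4 (fun n => hx c n.2) N : ℝ))) := by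
    intro p
    rw [WW_eq]; congr 1
    have e1 : lN a c N p = Real.pi * I * (s4 (fun n => hx a n.1 ^ 2) N : ℝ) * p.1 +
      Real.pi * I * (2 * s4 (fun n => hx a n.1 * hx c n.2) N : ℝ) * p.2.1 + Real.pi * I * (s4 (fun n => hx c n.2 ^ 2) N : ℝ) * p.2.2 := rfl
    rw [e1]; unfold fx s4; push_cast; ring
  rw [h p]
  simp only [h]
  exact (((lN a c N).hasFDerivAt).add_const _).cexp

lemma Mc_diff (a b c e : ℤ) (l : ℕ) (hl : l ≤ 12) {p : ℂ × ℂ × ℂ} (hp : p ∈ Dom) :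
    DifferentiableAt ℂ (Mc a b c e l) p := by
  obtain ⟨d, hd, r, hr, hP⟩ := Pos_nhds hp
  have hpi := Real.pi_pos
  refine (hasFDerivAt_tsum_of_isPreconnected
    (u := fun N => 2 * Real.pi * 3 ^ 12 * (Nat.factorial 14 * GN (Real.pi * d) (0 + 1) a c N))
    (f' := fun N q => (AA a N ^ (12 - l) * BB c N ^ l) • (WW a b c e q N • lN a c N))
    (((sumN (by positivity) _ a c).mul_left _).mul_left _) Metric.isOpen_ball
    (convex_ball p r).isPreconnected (fun N q _ => (WW_deriv a b c e N q).mul_const _) (fun N q hq => ?_)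
    (Metric.mem_ball_self hr) (Mc_summable a b c e l hl hp) (Metric.mem_ball_self hr)).differentiableAt
  have h1 := Mc_bd a b c e l hl (hP q hq) N
  rw [smul_smul, norm_smul, mul_comm (_ * _) (WW _ _ _ _ _ _)]
  refine (mul_le_mul h1 (lN_norm a c N) (norm_nonneg _) ((norm_nonneg _).trans h1)).trans ?_
  have := poly_bd a c 14 (Real.pi * d) 0 N
  calc _ = 2 * Real.pi * 3 ^ 12 * (GN (Real.pi * d) 0 a c N * s4 (qT a c) N ^ 14) := by ring
    _ ≤ _ := by gcongr

lemma Fc_diff (l : ℕ) (hl : l ≤ 12) {p : ℂ × ℂ × ℂ} (hp : p ∈ Dom) : DifferentiableAt ℂ (Fc l) p := by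
  have h := fun a b c e => Mc_diff a b c e l hl hp
  exact (((((((h _ _ _ _).sub (h _ _ _ _)).sub (h _ _ _ _)).add (h _ _ _ _)).add (h _ _ _ _)).sub (h _ _ _ _)).const_mul _)

lemma FT_diff : DifferentiableOn ℂ FT H2 := by
  have : DifferentiableOn ℂ (fun τ : Fin 2 → Fin 2 → ℂ => fun l : Fin 13 => Fc l (τ 0 0, τ 0 1, τ 1 1)) H2 := by
    rw [differentiableOn_pi]
    intro l τ hτ
    have h1 := H2_mk hτ
    have h2 : (τ 0 0, τ 0 1, τ 1 1) ∈ Dom := by rw [h1] at hτ; exact mk_mem.1 hτ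
    refine DifferentiableAt.differentiableWithinAt ?_
    exact (Fc_diff l (by omega) h2).comp τ (f := fun τ : Fin 2 → Fin 2 → ℂ => (τ 0 0, τ 0 1, τ 1 1)) (by fun_prop)
  exact this.congr fun τ hτ => by unfold FT; rw [if_pos hτ]

end

section
abbrev X4 := (ℤ × ℤ) × (ℤ × ℤ)

def x4 (g : ℤ → ℝ) (n : X4) : ℝ := (g n.1.1 + g n.1.2) + (g n.2.1 + g n.2.2)
def aa (a : ℤ) (n : X4) : ℂ := hx a n.1.1 + 2 * hx a n.1.2 + 2 * hx a n.2.1 + 3 * I * hx a n.2.2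
def tm (a b : ℤ) (j : ℕ) (t : ℝ) (n : X4) : ℂ :=
  cexp (Real.pi * I * (t * I * (x4 (fun k => hx a k ^ 2) n : ℝ) + b * (x4 (hx a) n : ℝ))) * aa a n ^ j

def mm (a b : ℤ) (j : ℕ) (t : ℝ) : ℂ := ∑' n, tm a b j t n

def tl (a b : ℤ) (j : ℕ) (n : X4) : ℂ :=
  if x4 (fun k => hx a k ^ 2) n = 1 then cexp (Real.pi * I * (b * (x4 (hx a) n : ℝ))) * aa a n ^ j else 0

def bd (a : ℤ) (j : ℕ) (n : X4) : ℝ := Real.exp Real.pi * (3 ^ j * j.factorial) *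
  Real.exp (-Real.pi * x4 (fun k => hx a k ^ 2) n + 1 * x4 (fun k => |hx a k|) n)

lemma bd_summable (a : ℤ) (j : ℕ) : Summable (bd a j) := by
  refine Summable.mul_left _ ?_
  have h := sum1 Real.pi_pos 1 a
  have p : ∀ n : ℤ, 0 ≤ Real.exp (-Real.pi * hx a n ^ 2 + 1 * |hx a n|) := fun _ => (Real.exp_pos _).le
  have h2 := h.mul_of_nonneg h p p
  refine (h2.mul_of_nonneg h2 (fun n => mul_nonneg (p _) (p _)) (fun n => mul_nonneg (p _) (p _))).congr
    fun n => ?_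
  simp only [← Real.exp_add]; congr 1; unfold x4; ring

lemma aa_zero {a : ℤ} (ha : a = 0 ∨ a = 1) {n : X4} (h : x4 (fun k => hx a k ^ 2) n < 1) : aa a n = 0 := by
  have key : ∀ k : ℤ, (2 * hx a k) = ((2 * k + a : ℤ) : ℝ) := fun k => by unfold hx; push_cast; ring
  have h1 : ((2 * n.1.1 + a) ^ 2 + (2 * n.1.2 + a) ^ 2 + (2 * n.2.1 + a) ^ 2 + (2 * n.2.2 + a) ^ 2 : ℤ) < 4 := by
    have : (((2 * n.1.1 + a) ^ 2 + (2 * n.1.2 + a) ^ 2 + (2 * n.2.1 + a) ^ 2 + (2 * n.2.2 + a) ^ 2 : ℤ) : ℝ) < (4 : ℤ) := by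
      unfold x4 hx at h
      push_cast
      linarith
    exact_mod_cast this
  rcases ha with rfl | rfl
  · have z : ∀ k : ℤ, (2 * k + 0) ^ 2 < 4 → k = 0 := fun k hk => by nlinarith [sq_nonneg k, show k ^ 2 < 1 by nlinarith, sq_eq_zero_iff.1 (show k ^ 2 = 0 by nlinarith [sq_nonneg k, show k ^ 2 < 1 by nlinarith])]
    have a1 := z n.1.1 (by nlinarith [sq_nonneg (2 * n.1.2 + 0), sq_nonneg (2 * n.2.1 + 0), sq_nonneg (2 * n.2.2 + 0)])
    have a2 := z n.1.2 (by nlinarith [sq_nonneg (2 * n.1.1 + 0), sq_nonneg (2 * n.2.1 + 0), sq_nonneg (2 * n.2.2 + 0)])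
    have a3 := z n.2.1 (by nlinarith [sq_nonneg (2 * n.1.2 + 0), sq_nonneg (2 * n.1.1 + 0), sq_nonneg (2 * n.2.2 + 0)])
    have a4 := z n.2.2 (by nlinarith [sq_nonneg (2 * n.1.2 + 0), sq_nonneg (2 * n.2.1 + 0), sq_nonneg (2 * n.1.1 + 0)])
    unfold aa; rw [a1, a2, a3, a4]; simp [hx]
  · exfalso
    have z : ∀ k : ℤ, 1 ≤ (2 * k + 1) ^ 2 := fun k => by
      have : 0 < (2 * k + 1) ^ 2 := by
        have : (2 * k + 1) ≠ 0 := by omega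
        positivity
      omega
    linarith [z n.1.1, z n.1.2, z n.2.1, z n.2.2]

lemma aa_norm (a : ℤ) (n : X4) : ‖aa a n‖ ≤ 3 * x4 (fun k => |hx a k|) n := by
  unfold aa x4
  refine (norm_add_le _ _).trans ?_
  have h1 := norm_add_le ((hx a n.1.1 : ℂ) + 2 * hx a n.1.2) (2 * hx a n.2.1)
  have h2 := norm_add_le (hx a n.1.1 : ℂ) (2 * hx a n.1.2)
  simp at h1 h2 ⊢
  linarith [abs_nonneg (hx a n.1.1), abs_nonneg (hx a n.1.2), abs_nonneg (hx a n.2.1), abs_nonneg (hx a n.2.2)]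

lemma tm_norm (a b : ℤ) (j : ℕ) (t : ℝ) (n : X4) :
    ‖tm a b j t n‖ = Real.exp (-(Real.pi * t * x4 (fun k => hx a k ^ 2) n)) * ‖aa a n‖ ^ j := by
  unfold tm
  rw [norm_mul, norm_pow, Complex.norm_exp]
  congr 2
  simp; ring

lemma tm_bd {a : ℤ} (b : ℤ) {j : ℕ} (ha : a = 0 ∨ a = 1) (hj : j ≠ 0) {t : ℝ} (ht : 1 ≤ t) (n : X4) :
    Real.exp (Real.pi * t) * ‖tm a b j t n‖ ≤ bd a j n := by
  rw [tm_norm]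
  by_cases h : x4 (fun k => hx a k ^ 2) n < 1
  · rw [aa_zero ha h]; simp [hj]; unfold bd; positivity
  · push Not at h
    set Q := x4 (fun k => hx a k ^ 2) n
    have T0 : 0 ≤ x4 (fun k => |hx a k|) n := by unfold x4; positivity
    have h2 := Real.pow_div_factorial_le_exp _ T0 j
    rw [div_le_iff₀ (by positivity)] at h2
    have h1 : ‖aa a n‖ ^ j ≤ 3 ^ j * j.factorial * Real.exp (x4 (fun k => |hx a k|) n) := by
      calc ‖aa a n‖ ^ j ≤ (3 * x4 (fun k => |hx a k|) n) ^ j := by gcongr; exact aa_norm a n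
        _ = 3 ^ j * x4 (fun k => |hx a k|) n ^ j := mul_pow _ _ _
        _ ≤ 3 ^ j * (Real.exp (x4 (fun k => |hx a k|) n) * j.factorial) := by gcongr
        _ = _ := by ring
    have h3 : Real.exp (Real.pi * t) * Real.exp (-(Real.pi * t * Q)) ≤ Real.exp (Real.pi - Real.pi * Q) := by
      rw [← Real.exp_add, Real.exp_le_exp]
      nlinarith [mul_nonneg (mul_nonneg Real.pi_pos.le (sub_nonneg.2 ht)) (sub_nonneg.2 h)]
    calc _ = (Real.exp (Real.pi * t) * Real.exp (-(Real.pi * t * Q))) * ‖aa a n‖ ^ j := by ring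
      _ ≤ Real.exp (Real.pi - Real.pi * Q) * (3 ^ j * j.factorial * Real.exp (x4 (fun k => |hx a k|) n)) := by gcongr
      _ = _ := by
        unfold bd; rw [Real.exp_add, sub_eq_add_neg, Real.exp_add, one_mul, neg_mul]; ring

lemma tm_summable {a : ℤ} (b : ℤ) {j : ℕ} (ha : a = 0 ∨ a = 1) (hj : j ≠ 0) {t : ℝ} (ht : 1 ≤ t) :
    Summable fun n => ‖tm a b j t n‖ := by
  refine Summable.of_nonneg_of_le (fun _ => norm_nonneg _) (fun n => ?_) (bd_summable a j)
  refine le_trans ?_ (tm_bd b ha hj ht n)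
  have : 1 ≤ Real.exp (Real.pi * t) := Real.one_le_exp (by have := Real.pi_pos; positivity)
  nlinarith [norm_nonneg (tm a b j t n)]

lemma mm_lim {a : ℤ} (b : ℤ) {j : ℕ} (ha : a = 0 ∨ a = 1) (hj : j ≠ 0) :
    Tendsto (fun t : ℝ => (Real.exp (Real.pi * t) : ℂ) * mm a b j t) atTop (𝓝 (∑' n, tl a b j n)) := by
  unfold mm
  simp only [← tsum_mul_left]
  refine tendsto_tsum_of_dominated_convergence (bd_summable a j) (fun n => ?_) ?_
  · unfold tl
    have e1 : ∀ t : ℝ, (Real.exp (Real.pi * t) : ℂ) * tm a b j t n =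
        (Real.exp (-(Real.pi * (x4 (fun k => hx a k ^ 2) n - 1) * t)) : ℝ) * (cexp (Real.pi * I * (b * (x4 (hx a) n : ℝ))) * aa a n ^ j) := by
      intro t
      unfold tm
      rw [← mul_assoc, ← mul_assoc]; congr 1
      push_cast
      rw [← Complex.exp_add, ← Complex.exp_add]; congr 1
      linear_combination (Real.pi * t * (x4 (fun k => hx a k ^ 2) n : ℝ) : ℂ) * Complex.I_sq
    simp only [e1]
    split_ifs with h
    · rw [h]; simp
    · rcases lt_or_gt_of_ne h with h | h
      · rw [aa_zero ha h]; simp [hj]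
      · have h1 : Tendsto (fun t : ℝ => Real.exp (-(Real.pi * (x4 (fun k => hx a k ^ 2) n - 1) * t))) atTop (𝓝 0) :=
          Real.tendsto_exp_neg_atTop_nhds_zero.comp (tendsto_id.const_mul_atTop (mul_pos Real.pi_pos (by linarith)))
        have h2 := ((Complex.continuous_ofReal.tendsto 0).comp h1).mul_const (cexp (Real.pi * I * (b * (x4 (hx a) n : ℝ))) * aa a n ^ j)
        simpa using h2
  · filter_upwards [eventually_ge_atTop 1] with t ht n
    rw [norm_mul, Complex.norm_real, Real.norm_of_nonneg (Real.exp_pos _).le]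
    exact tm_bd b ha hj ht n

/-! finite evaluation -/

def bx : Finset X4 := (Finset.Icc (-1) 1 ×ˢ Finset.Icc (-1) 1) ×ˢ (Finset.Icc (-1) 1 ×ˢ Finset.Icc (-1) 1)

def gt (a b : ℤ) (j : ℕ) (n : X4) : GaussianInt :=
  if (2 * n.1.1 + a) ^ 2 + (2 * n.1.2 + a) ^ 2 + (2 * n.2.1 + a) ^ 2 + (2 * n.2.2 + a) ^ 2 = 4 then
    (if (b * (n.1.1 + n.1.2 + n.2.1 + n.2.2 + 2 * a)) % 2 = 0 then 1 else -1) *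
    (⟨(2 * n.1.1 + a) + 2 * (2 * n.1.2 + a) + 2 * (2 * n.2.1 + a), 3 * (2 * n.2.2 + a)⟩ : GaussianInt) ^ j
  else 0

lemma tl_gt (a b : ℤ) (j : ℕ) (n : X4) : 2 ^ j * tl a b j n = GaussianInt.toComplex (gt a b j n) := by
  unfold tl gt
  have hc : (x4 (fun k => hx a k ^ 2) n = 1) ↔ ((2 * n.1.1 + a) ^ 2 + (2 * n.1.2 + a) ^ 2 + (2 * n.2.1 + a) ^ 2 + (2 * n.2.2 + a) ^ 2 = 4) := by
    rw [← @Int.cast_inj ℝ]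
    unfold x4 hx; push_cast
    constructor <;> intro h <;> linarith
  by_cases h : x4 (fun k => hx a k ^ 2) n = 1
  · rw [if_pos h, if_pos (hc.1 h), map_mul, map_pow]
    have h1 : 2 * aa a n = GaussianInt.toComplex ⟨(2 * n.1.1 + a) + 2 * (2 * n.1.2 + a) + 2 * (2 * n.2.1 + a), 3 * (2 * n.2.2 + a)⟩ := by
      rw [GaussianInt.toComplex_def₂]
      unfold aa hx
      apply Complex.ext <;> simp <;> ring
    have h2 : cexp (Real.pi * I * (b * (x4 (hx a) n : ℝ))) =
        GaussianInt.toComplex (if (b * (n.1.1 + n.1.2 + n.2.1 + n.2.2 + 2 * a)) % 2 = 0 then 1 else -1) := by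
      have h3 : (b * (x4 (hx a) n : ℝ) : ℂ) = ((b * (n.1.1 + n.1.2 + n.2.1 + n.2.2 + 2 * a) : ℤ) : ℂ) := by
        unfold x4 hx; push_cast; ring
      rw [h3]
      generalize b * (n.1.1 + n.1.2 + n.2.1 + n.2.2 + 2 * a) = w
      split_ifs with hw
      · rw [exp_cong (y := 0) (w / 2)]
        · simp
        · have : w = 2 * (w / 2) := by omega
          have := congrArg (Int.cast : ℤ → ℂ) this
          push_cast at this; rw [zero_add]; exact this
      · rw [exp_cong (y := 1) (w / 2)]
        · simp [Complex.exp_pi_mul_I]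
        · have : w = 1 + 2 * (w / 2) := by omega
          have := congrArg (Int.cast : ℤ → ℂ) this
          push_cast at this; exact this
    rw [← h1, ← h2]; ring
  · rw [if_neg h, if_neg (fun h' => h (hc.2 h'))]; simp

lemma tl_sum {a : ℤ} (b : ℤ) (j : ℕ) (ha : a = 0 ∨ a = 1) :
    2 ^ j * ∑' n, tl a b j n = GaussianInt.toComplex (∑ n ∈ bx, gt a b j n) := by
  rw [← tsum_mul_left, map_sum]
  simp only [tl_gt]
  refine tsum_eq_sum fun n hn => ?_
  have : gt a b j n = 0 := by
    unfold gt
    rw [if_neg]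
    intro h
    apply hn
    have z : ∀ k : ℤ, (2 * k + a) ^ 2 ≤ 4 → k ∈ Finset.Icc (-1 : ℤ) 1 := fun k hk => by
      have h1 : 2 * k + a ≤ 2 := by nlinarith
      have h2 : -2 ≤ 2 * k + a := by nlinarith
      rw [Finset.mem_Icc]; omega
    have p1 := sq_nonneg (2 * n.1.1 + a)
    have p2 := sq_nonneg (2 * n.1.2 + a)
    have p3 := sq_nonneg (2 * n.2.1 + a)
    have p4 := sq_nonneg (2 * n.2.2 + a)
    exact Finset.mem_product.2 ⟨Finset.mem_product.2 ⟨z _ (by linarith), z _ (by linarith)⟩,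
      Finset.mem_product.2 ⟨z _ (by linarith), z _ (by linarith)⟩⟩
  rw [this, map_zero]

lemma g8 : (∑ n ∈ bx, gt 0 0 8 n) = ⟨3621888, 0⟩ ∧ (∑ n ∈ bx, gt 0 1 8 n) = ⟨-3621888, 0⟩ ∧
    (∑ n ∈ bx, gt 1 0 8 n) = ⟨-1675008, 0⟩ ∧ (∑ n ∈ bx, gt 1 1 8 n) = ⟨0, -4902912⟩ := by decide +kernel
lemma g4 : (∑ n ∈ bx, gt 0 0 4 n) = ⟨3648, 0⟩ ∧ (∑ n ∈ bx, gt 0 1 4 n) = ⟨-3648, 0⟩ ∧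
    (∑ n ∈ bx, gt 1 0 4 n) = ⟨-3648, 0⟩ ∧ (∑ n ∈ bx, gt 1 1 4 n) = ⟨0, 4608⟩ := by decide +kernel

def eL : L8 ≃ X4 × X4 := ((Equiv.prodProdProdComm ℤ ℤ ℤ ℤ).prodCongr (Equiv.prodProdProdComm ℤ ℤ ℤ ℤ)).trans
  (Equiv.prodProdProdComm _ _ _ _)

lemma Mc_mm {a c : ℤ} (b e : ℤ) (ha : a = 0 ∨ a = 1) (hc : c = 0 ∨ c = 1) {t : ℝ} (ht : 1 ≤ t) :
    Mc a b c e 4 (t * I, 0, t * I) = mm a b 8 t * mm c e 4 t := by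
  unfold mm Mc
  rw [tsum_mul_tsum_of_summable_norm (tm_summable b ha (by norm_num) ht) (tm_summable e hc (by norm_num) ht),
    ← eL.tsum_eq (fun z : X4 × X4 => tm a b 8 t z.1 * tm c e 4 t z.2)]
  congr 1; ext N
  show _ = tm a b 8 t ((N.1.1.1, N.1.2.1), (N.2.1.1, N.2.2.1)) * tm c e 4 t ((N.1.1.2, N.1.2.2), (N.2.1.2, N.2.2.2))
  rw [WW_eq]
  have h1 : AA a N = aa a ((N.1.1.1, N.1.2.1), (N.2.1.1, N.2.2.1)) := rfl
  have h2 : BB c N = aa c ((N.1.1.2, N.1.2.2), (N.2.1.2, N.2.2.2)) := rfl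
  rw [h1, h2]; unfold tm
  rw [mul_mul_mul_comm, ← Complex.exp_add]
  congr 2
  unfold fx x4; push_cast; ring

lemma Fc_ne : ∃ t : ℝ, 1 ≤ t ∧ Fc 4 (t * I, 0, t * I) ≠ 0 := by
  by_contra! H
  have o0 : (0 : ℤ) = 0 ∨ (0 : ℤ) = 1 := Or.inl rfl
  have o1 : (1 : ℤ) = 0 ∨ (1 : ℤ) = 1 := Or.inr rfl
  have l8 := fun b => mm_lim b o0 (show 8 ≠ 0 by norm_num)
  have k8 := fun b => mm_lim b o1 (show 8 ≠ 0 by norm_num)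
  have l4 := fun b => mm_lim b o0 (show 4 ≠ 0 by norm_num)
  have k4 := fun b => mm_lim b o1 (show 4 ≠ 0 by norm_num)
  have lim := ((((l8 0).sub (l8 1)).sub (k8 0)).mul (k4 1)).sub ((k8 1).mul (((l4 0).sub (l4 1)).sub (k4 0)))
  have z := tendsto_nhds_unique (lim.congr' (f₂ := fun _ => (0 : ℂ)) ((eventually_ge_atTop 1).mono fun t ht => by
    have h := H t ht
    unfold Fc at h
    simp only [Mc_mm _ _ o0 o1 ht, Mc_mm _ _ o1 o0 ht, Mc_mm _ _ o1 o1 ht] at h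
    have h' := (mul_eq_zero.1 h).resolve_left (by norm_num [Nat.choose])
    linear_combination (Real.exp (Real.pi * t) : ℂ) ^ 2 * h')) tendsto_const_nhds
  · have s80 := tl_sum 0 8 o0
    have s81 := tl_sum 1 8 o0
    have r80 := tl_sum 0 8 o1
    have r81 := tl_sum 1 8 o1
    have s40 := tl_sum 0 4 o0
    have s41 := tl_sum 1 4 o0
    have r40 := tl_sum 0 4 o1
    have r41 := tl_sum 1 4 o1
    rw [g8.1] at s80
    rw [g8.2.1] at s81
    rw [g8.2.2.1] at r80
    rw [g8.2.2.2] at r81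
    rw [g4.1] at s40
    rw [g4.2.1] at s41
    rw [g4.2.2.1] at r40
    rw [g4.2.2.2] at r41
    rw [GaussianInt.toComplex_def₂] at s80 s81 r80 r81 s40 s41 r40 r41
    set u1 := ∑' n, tl 0 0 8 n
    set u2 := ∑' n, tl 0 1 8 n
    set u3 := ∑' n, tl 1 0 8 n
    set u4 := ∑' n, tl 1 1 8 n
    set v1 := ∑' n, tl 0 0 4 n
    set v2 := ∑' n, tl 0 1 4 n
    set v3 := ∑' n, tl 1 0 4 n
    set v4 := ∑' n, tl 1 1 4 n
    have e : (2 ^ 8 * u1 - 2 ^ 8 * u2 - 2 ^ 8 * u3) * (2 ^ 4 * v4) - (2 ^ 8 * u4) * (2 ^ 4 * v1 - 2 ^ 4 * v2 - 2 ^ 4 * v3) = 0 := by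
      linear_combination 2 ^ 12 * z
    rw [s80, s81, r80, r81, s40, s41, r40, r41] at e
    have := congrArg Complex.im e
    norm_num at this

lemma FT_ne : FT ≠ 0 := by
  obtain ⟨t, ht, h⟩ := Fc_ne
  intro h0
  have hd : ((t * I : ℂ), (0 : ℂ), (t * I : ℂ)) ∈ Dom := ⟨by simp; linarith, by simp; positivity⟩
  have := congrFun (FT_mk hd) 4
  rw [h0] at this
  exact h this.symm

theorem dim_main (ε : Matrix (Fin 4) (Fin 4) ℤ → ℂ) (hε : IsEps ε) :
    Module.finrank ℂ ↥(SiegelCusp 12 2 Sp4Z ε) = 1 := by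
  have hv := eps_vals hε
  have hG : Good ε FT := ⟨FT_diff, FT_law hε hv⟩
  exact finrank_one hv (hG.cusp hv fun τ hτ => by unfold FT; rw [if_neg hτ]) FT_ne

end

/-- The space `S_{12,2}(Γ₂,ε)` has dimension 1 over `ℂ`. -/
theorem dim_S12_2_eps (ε : Matrix (Fin 4) (Fin 4) ℤ → ℂ) (hε : IsEps ε) :
    Module.finrank ℂ ↥(SiegelCusp 12 2 Sp4Z ε) = 1 := by
  exact dim_main ε hε
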